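/- There exists a constant C > 0, depending only on T, α, β, K and δ, such that for every classical solution (v,u,θ,w,b) of the planar compressible MHD system on ℝ × [0,T] with (K,δ)-admissible initial data, one has sup_{0≤t≤T} ∫_ℝ v_x(x,t)² dx ≤ C. -/

import Mathlib

open MeasureTheory Set Filter

noncomputable section

/-- Viscosity function `μ(z) = 1 + α z^(−α)` (here `μ̃₁ = 1`, `μ̃₂ = α`). -/
def visc (α z : ℝ) : ℝ := 1 + α * z ^ (-α)

/-- Squared Euclidean norm on `ℝ × ℝ` (used for the transverse fields `w, b ∈ ℝ²`). -/
def sq2 (p : ℝ × ℝ) : ℝ := p.1 ^ 2 + p.2 ^ 2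

/-- Partial derivative with respect to the first (spatial) variable. -/
def pdx {E : Type*} [NormedAddCommGroup E] [NormedSpace ℝ E]
    (f : ℝ → ℝ → E) (x t : ℝ) : E := deriv (fun y => f y t) x

/-- Partial derivative with respect to the second (time) variable, taken within `[0, T]`
(so it is one-sided at the endpoints). -/
def pdt (T : ℝ) {E : Type*} [NormedAddCommGroup E] [NormedSpace ℝ E]
    (f : ℝ → ℝ → E) (x t : ℝ) : E := derivWithin (fun s => f x s) (Icc 0 T) t

/-- A classical solution of the planar compressible MHD system (in Lagrangian coordinates,
with all physical constants normalized to `1` and `μ̃₂ = α`) on `ℝ × [0,T]`: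
all the derivatives appearing in the equations exist and are continuous, `v, θ > 0`,
the five equations hold pointwise, the solution tends to `(1,0,1,0,0)` as `|x| → ∞`
uniformly in `t ∈ [0,T]`, and `v−1, u, θ−1, b, w` and their first spatial derivatives
are square-integrable in `x` for each `t ∈ [0,T]`. -/
structure IsClassicalSolution (α β T : ℝ) (v u θ : ℝ → ℝ → ℝ)
    (w b : ℝ → ℝ → ℝ × ℝ) : Prop where
  v_pos : ∀ x : ℝ, ∀ t ∈ Icc (0:ℝ) T, 0 < v x t
  θ_pos : ∀ x : ℝ, ∀ t ∈ Icc (0:ℝ) T, 0 < θ x t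
  diff_x : ∀ x : ℝ, ∀ t ∈ Icc (0:ℝ) T,
    DifferentiableAt ℝ (fun y => v y t) x ∧ DifferentiableAt ℝ (fun y => u y t) x ∧
    DifferentiableAt ℝ (fun y => θ y t) x ∧ DifferentiableAt ℝ (fun y => w y t) x ∧
    DifferentiableAt ℝ (fun y => b y t) x
  diff_xx : ∀ x : ℝ, ∀ t ∈ Icc (0:ℝ) T,
    DifferentiableAt ℝ (fun y => pdx u y t) x ∧ DifferentiableAt ℝ (fun y => pdx θ y t) x ∧
    DifferentiableAt ℝ (fun y => pdx w y t) x ∧ DifferentiableAt ℝ (fun y => pdx b y t) x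
  diff_t : ∀ x : ℝ, ∀ t ∈ Icc (0:ℝ) T,
    DifferentiableWithinAt ℝ (fun s => v x s) (Icc 0 T) t ∧
    DifferentiableWithinAt ℝ (fun s => u x s) (Icc 0 T) t ∧
    DifferentiableWithinAt ℝ (fun s => θ x s) (Icc 0 T) t ∧
    DifferentiableWithinAt ℝ (fun s => w x s) (Icc 0 T) t ∧
    DifferentiableWithinAt ℝ (fun s => b x s) (Icc 0 T) t
  cont : ContinuousOn (fun p : ℝ × ℝ =>
      (v p.1 p.2, u p.1 p.2, θ p.1 p.2, w p.1 p.2, b p.1 p.2)) (univ ×ˢ Icc 0 T)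
  cont_dx : ContinuousOn (fun p : ℝ × ℝ =>
      (pdx v p.1 p.2, pdx u p.1 p.2, pdx θ p.1 p.2, pdx w p.1 p.2, pdx b p.1 p.2))
      (univ ×ˢ Icc 0 T)
  cont_dxx : ContinuousOn (fun p : ℝ × ℝ =>
      (pdx (pdx u) p.1 p.2, pdx (pdx θ) p.1 p.2, pdx (pdx w) p.1 p.2, pdx (pdx b) p.1 p.2))
      (univ ×ˢ Icc 0 T)
  cont_dt : ContinuousOn (fun p : ℝ × ℝ =>
      (pdt T v p.1 p.2, pdt T u p.1 p.2, pdt T θ p.1 p.2, pdt T w p.1 p.2, pdt T b p.1 p.2))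
      (univ ×ˢ Icc 0 T)
  eq_mass : ∀ x : ℝ, ∀ t ∈ Icc (0:ℝ) T, pdt T v x t = pdx u x t
  eq_mom : ∀ x : ℝ, ∀ t ∈ Icc (0:ℝ) T,
    pdt T u x t + pdx (fun y s => θ y s / v y s + sq2 (b y s) / 2) x t
      = pdx (fun y s => visc α (v y s) * pdx u y s / v y s) x t
  eq_w : ∀ x : ℝ, ∀ t ∈ Icc (0:ℝ) T,
    pdt T w x t - pdx b x t = pdx (fun y s => (v y s)⁻¹ • pdx w y s) x t
  eq_b : ∀ x : ℝ, ∀ t ∈ Icc (0:ℝ) T,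
    pdt T (fun y s => v y s • b y s) x t - pdx w x t
      = pdx (fun y s => (v y s)⁻¹ • pdx b y s) x t
  eq_temp : ∀ x : ℝ, ∀ t ∈ Icc (0:ℝ) T,
    pdt T θ x t + θ x t / v x t * pdx u x t
      = pdx (fun y s => θ y s ^ β * pdx θ y s / v y s) x t
        + (visc α (v x t) * pdx u x t ^ 2 + sq2 (pdx w x t) + sq2 (pdx b x t)) / v x t
  farfield : ∀ ε > (0:ℝ), ∃ M : ℝ, ∀ x : ℝ, ∀ t ∈ Icc (0:ℝ) T, M ≤ |x| →
    |v x t - 1| < ε ∧ |u x t| < ε ∧ |θ x t - 1| < ε ∧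
    Real.sqrt (sq2 (b x t)) < ε ∧ Real.sqrt (sq2 (w x t)) < ε
  sq_int : ∀ t ∈ Icc (0:ℝ) T,
    Integrable (fun x => (v x t - 1) ^ 2) ∧ Integrable (fun x => (u x t) ^ 2) ∧
    Integrable (fun x => (θ x t - 1) ^ 2) ∧ Integrable (fun x => sq2 (b x t)) ∧
    Integrable (fun x => sq2 (w x t)) ∧
    Integrable (fun x => (pdx v x t) ^ 2) ∧ Integrable (fun x => (pdx u x t) ^ 2) ∧
    Integrable (fun x => (pdx θ x t) ^ 2) ∧ Integrable (fun x => sq2 (pdx b x t)) ∧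
    Integrable (fun x => sq2 (pdx w x t))

/-- The initial data of a solution are `(K, δ)`-admissible: the `H¹`-type norm of
`(v₀−1, u₀, θ₀−1, b₀, w₀)` is at most `K²` and `v₀ ≥ δ`, `θ₀ ≥ δ`. -/
def Admissible (K δ : ℝ) (v u θ : ℝ → ℝ → ℝ) (w b : ℝ → ℝ → ℝ × ℝ) : Prop :=
  (∫ x : ℝ, ((v x 0 - 1) ^ 2 + (u x 0) ^ 2 + (θ x 0 - 1) ^ 2 + sq2 (b x 0) + sq2 (w x 0)
      + (pdx v x 0) ^ 2 + (pdx u x 0) ^ 2 + (pdx θ x 0) ^ 2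
      + sq2 (pdx b x 0) + sq2 (pdx w x 0))) ≤ K ^ 2 ∧
  (∀ x : ℝ, δ ≤ v x 0) ∧ (∀ x : ℝ, δ ≤ θ x 0)

open Topology

/-- Joint continuity and a derivative in the second variable give the integral form of the
fundamental theorem of calculus, integrated over the first variable. -/
lemma integral_param_ftc {f f' : ℝ → ℝ → ℝ} {lo hi a b t : ℝ}
    (hf : Continuous (Function.uncurry f)) (hf' : Continuous (Function.uncurry f'))
    (hd : ∀ x, ∀ t ∈ Icc lo hi, HasDerivWithinAt (f x) (f' x t) (Icc lo hi) t)
    (ht : t ∈ Icc lo hi) :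
    ∫ x in a..b, f x t = (∫ x in a..b, f x lo) + ∫ s in lo..t, ∫ x in a..b, f' x s := by
  have key : ∀ x, f x t = f x lo + ∫ s in lo..t, f' x s := by
    intro x
    rw [intervalIntegral.integral_eq_sub_of_hasDerivAt_of_le (f := f x) ht.1]
    · ring
    · exact Continuous.continuousOn (by fun_prop)
    · intro s hs
      exact (hd x s ⟨hs.1.le, hs.2.le.trans ht.2⟩).hasDerivAt
        (Icc_mem_nhds hs.1 (hs.2.trans_le ht.2))
    · exact Continuous.intervalIntegrable (by fun_prop) _ _
  calc ∫ x in a..b, f x t = ∫ x in a..b, (f x lo + ∫ s in lo..t, f' x s) := by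
        exact intervalIntegral.integral_congr fun x _ => key x
    _ = (∫ x in a..b, f x lo) + ∫ x in a..b, ∫ s in lo..t, f' x s := by
        apply intervalIntegral.integral_add
        · exact Continuous.intervalIntegrable (by fun_prop) _ _
        · exact Continuous.intervalIntegrable (by fun_prop) _ _
    _ = _ := by
        congr 1
        apply intervalIntegral_intervalIntegral_swap
        apply IntegrableOn.mono_set (t := uIcc a b ×ˢ uIcc lo t)
        · exact (Continuous.continuousOn (by fun_prop)).integrableOn_compact
            (isCompact_uIcc.prod isCompact_uIcc)
        · exact prod_mono uIoc_subset_uIcc uIoc_subset_uIcc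

lemma gronwall_integral {y k : ℝ → ℝ} {A T : ℝ} (hy : Continuous y) (hk : Continuous k)
    (hk0 : ∀ t, 0 ≤ k t)
    (h : ∀ t ∈ Icc 0 T, y t ≤ A + ∫ s in 0..t, k s * y s) :
    ∀ t ∈ Icc 0 T, y t ≤ A * Real.exp (∫ s in 0..t, k s) := by
  intro t ht
  let W : ℝ → ℝ := fun t => (A + ∫ s in 0..t, k s * y s) * Real.exp (-∫ s in 0..t, k s)
  have hW : ∀ t, HasDerivAt W ((k t * y t) * Real.exp (-∫ s in 0..t, k s)
      + (A + ∫ s in 0..t, k s * y s) * (Real.exp (-∫ s in 0..t, k s) * -(k t))) t := by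
    intro t
    have h1 : HasDerivAt (fun t => ∫ s in 0..t, k s * y s) (k t * y t) t :=
      (hk.mul hy).integral_hasStrictDerivAt 0 t |>.hasDerivAt
    have h2 : HasDerivAt (fun t => ∫ s in 0..t, k s) (k t) t :=
      hk.integral_hasStrictDerivAt 0 t |>.hasDerivAt
    exact (h1.const_add A).mul h2.neg.exp
  have hanti : AntitoneOn W (Icc 0 T) := by
    apply antitoneOn_of_deriv_nonpos (convex_Icc 0 T)
    · exact fun t _ => (hW t).continuousAt.continuousWithinAt
    · exact fun t _ => (hW t).differentiableAt.differentiableWithinAt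
    · intro s hs
      rw [interior_Icc] at hs
      rw [(hW s).deriv]
      have h3 := h s ⟨hs.1.le, hs.2.le⟩
      have h4 := hk0 s
      have h5 := Real.exp_pos (-∫ s in 0..s, k s)
      have h6 := mul_nonneg (mul_nonneg h4 h5.le) (sub_nonneg.2 h3)
      nlinarith
  have h7 := hanti ⟨le_rfl, ht.1.trans ht.2⟩ ht ht.1
  have h8 : W 0 = A := by simp [W]
  rw [h8] at h7
  have h9 : (A + ∫ s in 0..t, k s * y s) ≤ A * Real.exp (∫ s in 0..t, k s) := by
    simp only [W, Real.exp_neg] at h7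
    rwa [← div_eq_mul_inv, div_le_iff₀ (Real.exp_pos _)] at h7
  exact (h t ht).trans h9

lemma exists_le_unit_integral {f : ℝ → ℝ} (hf : Continuous f) (a : ℝ) :
    ∃ y ∈ Icc a (a + 1), f y ≤ ∫ x in a..(a + 1), f x := by
  obtain ⟨y, hy, hmin⟩ := isCompact_Icc.exists_isMinOn (nonempty_Icc.2 (by linarith : a ≤ a + 1))
    hf.continuousOn
  refine ⟨y, hy, ?_⟩
  have : ∫ x in a..(a + 1), f y ≤ ∫ x in a..(a + 1), f x :=
    intervalIntegral.integral_mono_on (by linarith) (by simp) (hf.intervalIntegrable _ _)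
      fun x hx => hmin hx
  simpa using this

/-- Monotonicity of the interval integral for continuous integrands. -/
lemma integral_mono_cont {f g : ℝ → ℝ} {a b : ℝ} (hab : a ≤ b) (hf : Continuous f)
    (hg : Continuous g) (h : ∀ x ∈ Icc a b, f x ≤ g x) :
    ∫ x in a..b, f x ≤ ∫ x in a..b, g x :=
  intervalIntegral.integral_mono_on hab (hf.intervalIntegrable _ _) (hg.intervalIntegrable _ _) h

lemma integral_mono_subinterval {f : ℝ → ℝ} {a b c d : ℝ} (hca : c ≤ a) (hab : a ≤ b)
    (hbd : b ≤ d) (hf : Continuous f) (h0 : ∀ x ∈ Icc c d, 0 ≤ f x) :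
    ∫ x in a..b, f x ≤ ∫ x in c..d, f x := by
  apply intervalIntegral.integral_mono_interval hca hab hbd _ (hf.intervalIntegrable _ _)
  filter_upwards [ae_restrict_mem measurableSet_Ioc] with x hx
  exact h0 x ⟨hx.1.le, hx.2⟩

lemma ftc_cont {f f' : ℝ → ℝ} {a b : ℝ} (hd : ∀ x, HasDerivAt f (f' x) x) (hf' : Continuous f') :
    ∫ x in a..b, f' x = f b - f a :=
  intervalIntegral.integral_eq_sub_of_hasDerivAt (fun x _ => hd x) (hf'.intervalIntegrable _ _)

/-- The value of a `C¹` function is controlled by its value anywhere in a unit interval. -/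
lemma le_add_integral_abs_deriv {f f' : ℝ → ℝ} {a y : ℝ} (hd : ∀ x, HasDerivAt f (f' x) x)
    (hf' : Continuous f') (hy : y ∈ Icc a (a + 1)) :
    f a ≤ f y + ∫ x in a..(a + 1), |f' x| := by
  have h1 := ftc_cont (a := a) (b := y) hd hf'
  have h2 : -∫ x in a..y, f' x ≤ ∫ x in a..y, |f' x| :=
    (neg_le_abs _).trans (intervalIntegral.abs_integral_le_integral_abs hy.1)
  have h3 : ∫ x in a..y, |f' x| ≤ ∫ x in a..(a + 1), |f' x| :=
    integral_mono_subinterval le_rfl hy.1 hy.2 hf'.abs fun _ _ => abs_nonneg _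
  linarith

lemma sq_integral_mul_le {f g : ℝ → ℝ} {a b : ℝ} (hab : a ≤ b) (hf : Continuous f)
    (hg : Continuous g) :
    (∫ x in a..b, f x * g x) ^ 2 ≤ (∫ x in a..b, f x ^ 2) * ∫ x in a..b, g x ^ 2 := by
  have h : ∀ l : ℝ, 0 ≤ (∫ x in a..b, f x ^ 2) * (l * l) + (2 * ∫ x in a..b, f x * g x) * l
      + ∫ x in a..b, g x ^ 2 := by
    intro l
    have h0 : 0 ≤ ∫ x in a..b, (l * f x + g x) ^ 2 :=
      intervalIntegral.integral_nonneg hab fun x _ => sq_nonneg _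
    have h1 : ∫ x in a..b, (l * f x + g x) ^ 2
        = ∫ x in a..b, (l * l * f x ^ 2 + (2 * l) * (f x * g x)) + g x ^ 2 := by
      congr 1; ext x; ring
    rw [h1, intervalIntegral.integral_add, intervalIntegral.integral_add,
      intervalIntegral.integral_const_mul, intervalIntegral.integral_const_mul] at h0
    · linarith
    all_goals exact Continuous.intervalIntegrable (by fun_prop) _ _
  have := discrim_le_zero h
  unfold discrim at this
  nlinarith

/-- The relative entropy `z - 1 - log z`. -/
def relEnt (z : ℝ) : ℝ := z - 1 - Real.log z

lemma relEnt_nonneg {z : ℝ} (hz : 0 < z) : 0 ≤ relEnt z := by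
  have := Real.log_le_sub_one_of_pos hz
  unfold relEnt; linarith

lemma relEnt_le {z : ℝ} (hz : 0 < z) : relEnt z ≤ (z - 1) ^ 2 / z := by
  have h := Real.log_le_sub_one_of_pos (inv_pos.2 hz)
  rw [Real.log_inv] at h
  have : (z - 1) ^ 2 / z = z - 2 + z⁻¹ := by field_simp; ring
  unfold relEnt; linarith

lemma sq_le_relEnt {z : ℝ} (hz : 0 < z) : (z - 1) ^ 2 ≤ 2 * (1 + z) * relEnt z := by
  have h := Real.log_le_sub_one_of_pos (Real.sqrt_pos.2 hz)
  rw [Real.log_sqrt hz.le] at h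
  set r := Real.sqrt z with hr
  have hr0 : 0 ≤ r := Real.sqrt_nonneg z
  have hzr : z = r ^ 2 := (Real.sq_sqrt hz.le).symm
  have h1 : (r - 1) ^ 2 ≤ relEnt z := by unfold relEnt; nlinarith
  have h2 : (z - 1) ^ 2 = (r - 1) ^ 2 * (r + 1) ^ 2 := by rw [hzr]; ring
  have h3 : (r + 1) ^ 2 ≤ 2 * (1 + z) := by rw [hzr]; nlinarith [sq_nonneg (r - 1)]
  rw [h2, mul_comm]
  exact mul_le_mul h3 h1 (sq_nonneg _) (by positivity)

lemma le_two_mul_relEnt {z : ℝ} (hz : 0 < z) : z ≤ 2 * relEnt z + 2 := by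
  have h := Real.log_le_sub_one_of_pos (half_pos hz)
  rw [Real.log_div hz.ne' (by norm_num)] at h
  have := Real.log_two_lt_d9
  unfold relEnt; linarith

lemma exp_le_of_relEnt_le {z N : ℝ} (hz : 0 < z) (h : relEnt z ≤ N) :
    Real.exp (-N - 1) ≤ z := by
  rw [← Real.le_log_iff_exp_le hz]
  unfold relEnt at h; linarith

/-- A smooth positive solution of the MHD system written in components, with its partial
derivatives as data. Functions are defined for all times (outside `[0, T]` they are meant to be
extended by their values at the end points), so that joint continuity holds on the whole plane. -/
structure MHDFlow (α β T : ℝ) where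
  (v u θ w₁ w₂ b₁ b₂ : ℝ → ℝ → ℝ)
  (vx ux θx w₁x w₂x b₁x b₂x : ℝ → ℝ → ℝ)
  (uxx θxx : ℝ → ℝ → ℝ)
  (ut θt w₁t w₂t b₁t b₂t : ℝ → ℝ → ℝ)
  cv : Continuous (Function.uncurry v)
  cu : Continuous (Function.uncurry u)
  cθ : Continuous (Function.uncurry θ)
  cw₁ : Continuous (Function.uncurry w₁)
  cw₂ : Continuous (Function.uncurry w₂)
  cb₁ : Continuous (Function.uncurry b₁)
  cb₂ : Continuous (Function.uncurry b₂)
  cvx : Continuous (Function.uncurry vx)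
  cux : Continuous (Function.uncurry ux)
  cθx : Continuous (Function.uncurry θx)
  cw₁x : Continuous (Function.uncurry w₁x)
  cw₂x : Continuous (Function.uncurry w₂x)
  cb₁x : Continuous (Function.uncurry b₁x)
  cb₂x : Continuous (Function.uncurry b₂x)
  cuxx : Continuous (Function.uncurry uxx)
  cθxx : Continuous (Function.uncurry θxx)
  cut : Continuous (Function.uncurry ut)
  cθt : Continuous (Function.uncurry θt)
  cw₁t : Continuous (Function.uncurry w₁t)
  cw₂t : Continuous (Function.uncurry w₂t)
  cb₁t : Continuous (Function.uncurry b₁t)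
  cb₂t : Continuous (Function.uncurry b₂t)
  v_pos : ∀ x t, 0 < v x t
  θ_pos : ∀ x t, 0 < θ x t
  dvx : ∀ x t, HasDerivAt (fun y => v y t) (vx x t) x
  dux : ∀ x t, HasDerivAt (fun y => u y t) (ux x t) x
  dθx : ∀ x t, HasDerivAt (fun y => θ y t) (θx x t) x
  dw₁x : ∀ x t, HasDerivAt (fun y => w₁ y t) (w₁x x t) x
  dw₂x : ∀ x t, HasDerivAt (fun y => w₂ y t) (w₂x x t) x
  db₁x : ∀ x t, HasDerivAt (fun y => b₁ y t) (b₁x x t) x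
  db₂x : ∀ x t, HasDerivAt (fun y => b₂ y t) (b₂x x t) x
  duxx : ∀ x t, HasDerivAt (fun y => ux y t) (uxx x t) x
  dθxx : ∀ x t, HasDerivAt (fun y => θx y t) (θxx x t) x
  dvt : ∀ x, ∀ t ∈ Icc 0 T, HasDerivWithinAt (v x) (ux x t) (Icc 0 T) t
  dut : ∀ x, ∀ t ∈ Icc 0 T, HasDerivWithinAt (u x) (ut x t) (Icc 0 T) t
  dθt : ∀ x, ∀ t ∈ Icc 0 T, HasDerivWithinAt (θ x) (θt x t) (Icc 0 T) t
  dw₁t : ∀ x, ∀ t ∈ Icc 0 T, HasDerivWithinAt (w₁ x) (w₁t x t) (Icc 0 T) t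
  dw₂t : ∀ x, ∀ t ∈ Icc 0 T, HasDerivWithinAt (w₂ x) (w₂t x t) (Icc 0 T) t
  db₁t : ∀ x, ∀ t ∈ Icc 0 T, HasDerivWithinAt (b₁ x) (b₁t x t) (Icc 0 T) t
  db₂t : ∀ x, ∀ t ∈ Icc 0 T, HasDerivWithinAt (b₂ x) (b₂t x t) (Icc 0 T) t
  mom : ∀ x t, HasDerivAt (fun y => visc α (v y t) * ux y t / v y t)
    (ut x t + (θx x t / v x t - θ x t * vx x t / v x t ^ 2
      + b₁ x t * b₁x x t + b₂ x t * b₂x x t)) x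
  w₁eq : ∀ x t, HasDerivAt (fun y => w₁x y t / v y t) (w₁t x t - b₁x x t) x
  w₂eq : ∀ x t, HasDerivAt (fun y => w₂x y t / v y t) (w₂t x t - b₂x x t) x
  b₁eq : ∀ x t, HasDerivAt (fun y => b₁x y t / v y t)
    (ux x t * b₁ x t + v x t * b₁t x t - w₁x x t) x
  b₂eq : ∀ x t, HasDerivAt (fun y => b₂x y t / v y t)
    (ux x t * b₂ x t + v x t * b₂t x t - w₂x x t) x
  temp : ∀ x t, HasDerivAt (fun y => θ y t ^ β * θx y t / v y t)
    (θt x t + θ x t / v x t * ux x t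
      - (visc α (v x t) * ux x t ^ 2 + w₁x x t ^ 2 + w₂x x t ^ 2
        + b₁x x t ^ 2 + b₂x x t ^ 2) / v x t) x
  far : ∀ ε > (0 : ℝ), ∃ M : ℝ, ∀ x t, M ≤ |x| →
    |v x t - 1| < ε ∧ |u x t| < ε ∧ |θ x t - 1| < ε ∧
    |w₁ x t| < ε ∧ |w₂ x t| < ε ∧ |b₁ x t| < ε ∧ |b₂ x t| < ε
  clamp : ∀ x t, ∃ s ∈ Icc 0 T, v x t = v x s ∧ u x t = u x s ∧ θ x t = θ x s ∧
    w₁ x t = w₁ x s ∧ w₂ x t = w₂ x s ∧ b₁ x t = b₁ x s ∧ b₂ x t = b₂ x s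

attribute [fun_prop] MHDFlow.cv MHDFlow.cu MHDFlow.cθ MHDFlow.cw₁ MHDFlow.cw₂ MHDFlow.cb₁
  MHDFlow.cb₂ MHDFlow.cvx MHDFlow.cux MHDFlow.cθx MHDFlow.cw₁x MHDFlow.cw₂x MHDFlow.cb₁x
  MHDFlow.cb₂x MHDFlow.cuxx MHDFlow.cθxx MHDFlow.cut MHDFlow.cθt MHDFlow.cw₁t MHDFlow.cw₂t
  MHDFlow.cb₁t MHDFlow.cb₂t

lemma visc_ge_one {α z : ℝ} (hα : 0 ≤ α) (hz : 0 < z) : 1 ≤ visc α z := by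
  unfold visc
  have := mul_nonneg hα (Real.rpow_nonneg hz.le (-α))
  linarith

namespace MHDFlow

variable {α β T : ℝ} (S : MHDFlow α β T)

@[simp] lemma v_ne (x t : ℝ) : S.v x t ≠ 0 := (S.v_pos x t).ne'

@[simp] lemma θ_ne (x t : ℝ) : S.θ x t ≠ 0 := (S.θ_pos x t).ne'

lemma exists_bounds : ∃ M : ℝ, 1 ≤ M ∧ ∀ x t, S.v x t ≤ M ∧ M⁻¹ ≤ S.v x t ∧
    S.θ x t ≤ M ∧ M⁻¹ ≤ S.θ x t ∧ |S.u x t| ≤ M ∧ |S.w₁ x t| ≤ M ∧ |S.w₂ x t| ≤ M ∧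
    |S.b₁ x t| ≤ M ∧ |S.b₂ x t| ≤ M := by
  obtain ⟨R, hR⟩ := S.far (1 / 2) (by norm_num)
  let g : ℝ → ℝ → ℝ := fun x t => S.v x t + (S.v x t)⁻¹ + S.θ x t + (S.θ x t)⁻¹ + |S.u x t|
    + |S.w₁ x t| + |S.w₂ x t| + |S.b₁ x t| + |S.b₂ x t|
  have hg : Continuous fun z : ℝ × ℝ => g z.1 z.2 := by
    simp only [g]
    fun_prop (disch := simp)
  obtain ⟨M₀, hM₀⟩ := (((isCompact_Icc (a := -R) (b := R)).prod
    (isCompact_Icc (a := 0) (b := T))).image hg).isBounded.bddAbove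
  have hinside : ∀ x t, |x| ≤ R → g x t ≤ M₀ := by
    intro x t hx
    obtain ⟨s, hs, h1, h2, h3, h4, h5, h6, h7⟩ := S.clamp x t
    have : g x t = g x s := by simp only [g, h1, h2, h3, h4, h5, h6, h7]
    rw [this]
    exact hM₀ ⟨(x, s), ⟨abs_le.1 hx, hs⟩, rfl⟩
  have hg_le : ∀ x t, g x t ≤ max M₀ 20 := by
    intro x t
    rcases le_total |x| R with h | h
    · exact (hinside x t h).trans (le_max_left _ _)
    · refine le_trans ?_ (le_max_right _ _)
      obtain ⟨h1, h2, h3, h4, h5, h6, h7⟩ := hR x t h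
      rw [abs_lt] at h1 h3
      have h8 : (S.v x t)⁻¹ ≤ 2 := by
        rw [inv_le_comm₀ (S.v_pos x t) (by norm_num)]; norm_num; linarith
      have h9 : (S.θ x t)⁻¹ ≤ 2 := by
        rw [inv_le_comm₀ (S.θ_pos x t) (by norm_num)]; norm_num; linarith
      simp only [g]
      linarith
  set M := max M₀ 20
  have hM : 20 ≤ M := le_max_right _ _
  refine ⟨M, by linarith, fun x t => ?_⟩
  have h := hg_le x t
  simp only [g] at h
  have h1 := S.v_pos x t
  have h2 := S.θ_pos x t
  have h3 := inv_pos.2 h1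
  have h4 := inv_pos.2 h2
  have h5 := abs_nonneg (S.u x t)
  have h6 := abs_nonneg (S.w₁ x t)
  have h7 := abs_nonneg (S.w₂ x t)
  have h8 := abs_nonneg (S.b₁ x t)
  have h9 := abs_nonneg (S.b₂ x t)
  refine ⟨by linarith, ?_, by linarith, ?_, by linarith, by linarith, by linarith, by linarith,
    by linarith⟩
  · rw [inv_le_comm₀ (by linarith) h1]; linarith
  · rw [inv_le_comm₀ (by linarith) h2]; linarith

lemma exists_bound_comp {h : ℝ → ℝ → ℝ}
    (hh : ∀ a > 0, ∀ b > 0, ContinuousAt (Function.uncurry h) (a, b)) :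
    ∃ B : ℝ, 1 ≤ B ∧ ∀ x t, |h (S.v x t) (S.θ x t)| ≤ B := by
  obtain ⟨M, hM, hb⟩ := S.exists_bounds
  have hM0 : 0 < M⁻¹ := inv_pos.2 (by linarith)
  obtain ⟨B, hB⟩ := ((isCompact_Icc (a := M⁻¹) (b := M)).prod
    (isCompact_Icc (a := M⁻¹) (b := M))).exists_bound_of_continuousOn
    (f := Function.uncurry h) (fun z hz => (hh z.1 (hM0.trans_le hz.1.1) z.2
      (hM0.trans_le hz.2.1)).continuousWithinAt)
  refine ⟨max B 1, le_max_right _ _, fun x t => ?_⟩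
  obtain ⟨h1, h2, h3, h4, -⟩ := hb x t
  exact (hB (S.v x t, S.θ x t) ⟨⟨h2, h1⟩, ⟨h4, h3⟩⟩).trans (le_max_left _ _)

end MHDFlow

/-- The weight `(1 - x² / L²)²`, which vanishes at `±L`. -/
def bump (L x : ℝ) : ℝ := (1 - x ^ 2 / L ^ 2) ^ 2

@[fun_prop]
lemma continuous_bump (L : ℝ) : Continuous (bump L) := by
  unfold bump; fun_prop

lemma bump_nonneg (L x : ℝ) : 0 ≤ bump L x := sq_nonneg _

lemma sq_div_sq_le_one {L x : ℝ} (hL : 0 < L) (hx : x ∈ Icc (-L) L) : x ^ 2 / L ^ 2 ≤ 1 := by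
  rw [div_le_one (by positivity)]
  exact sq_le_sq' hx.1 hx.2

lemma bump_le_one {L x : ℝ} (hL : 0 < L) (hx : x ∈ Icc (-L) L) : bump L x ≤ 1 := by
  have h1 := sq_div_sq_le_one hL hx
  have h2 : 0 ≤ x ^ 2 / L ^ 2 := by positivity
  unfold bump; nlinarith

lemma half_le_bump {L x : ℝ} (hL : 0 < L) (hx : |x| ≤ L / 2) : 1 / 2 ≤ bump L x := by
  have h1 : x ^ 2 / L ^ 2 ≤ 1 / 4 := by
    rw [div_le_iff₀ (by positivity)]
    have := sq_le_sq' (by linarith [(abs_le.1 hx).1]) (abs_le.1 hx).2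
    linarith
  unfold bump; nlinarith

lemma hasDerivAt_bump (L x : ℝ) :
    HasDerivAt (bump L) (-(4 * x / L ^ 2 * (1 - x ^ 2 / L ^ 2))) x := by
  have h := (((hasDerivAt_pow 2 x).div_const (L ^ 2)).const_sub 1).pow 2
  refine h.congr_deriv ?_
  norm_num
  ring

lemma absorb_flux_term {L ψ d a e z : ℝ} (hL : 0 < L) (he : 0 < e) (hd : |d| ≤ 4 / L * ψ) :
    d * (a * z) ≤ ψ ^ 2 * (e * z ^ 2 / 2) + 8 / L ^ 2 * (a ^ 2 / e) := by
  have h1 : d * (a * z) ≤ (4 / L * ψ) * |a * z| := by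
    calc d * (a * z) ≤ |d * (a * z)| := le_abs_self _
      _ = |d| * |a * z| := abs_mul _ _
      _ ≤ _ := mul_le_mul_of_nonneg_right hd (abs_nonneg _)
  have h2 : ψ ^ 2 * (e * z ^ 2 / 2) + 8 / L ^ 2 * (a ^ 2 / e) - (4 / L * ψ) * |a * z|
      = (ψ * e * |z| - 4 / L * |a|) ^ 2 / (2 * e) := by
    rw [abs_mul, ← sq_abs z, ← sq_abs a]
    field_simp
    ring
  have h3 : 0 ≤ (ψ * e * |z| - 4 / L * |a|) ^ 2 / (2 * e) := by positivity
  linarith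

lemma abs_mul_le_flux {L ψ d a M : ℝ} (hL : 0 < L) (hψ : ψ ≤ 1) (hd : |d| ≤ 4 / L * ψ)
    {k : ℝ} (hk : |k| ≤ M) : d * (a * k) ≤ 4 / L * (M * |a|) := by
  have h4 : 0 < 4 / L := by positivity
  calc d * (a * k) ≤ |d * (a * k)| := le_abs_self _
    _ = |d| * (|k| * |a|) := by rw [abs_mul, abs_mul, mul_comm |a|]
    _ ≤ (4 / L) * (M * |a|) := by
        refine mul_le_mul ?_ (mul_le_mul_of_nonneg_right hk (abs_nonneg _)) (by positivity)
          h4.le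
        nlinarith

namespace MHDFlow

variable {α β T : ℝ} (S : MHDFlow α β T)

@[fun_prop]
lemma continuous_θ_rpow (q : ℝ) : Continuous (Function.uncurry fun x t => S.θ x t ^ q) := by
  unfold Function.uncurry
  exact Continuous.rpow_const (by fun_prop) fun z => Or.inl (S.θ_ne _ _)

@[fun_prop]
lemma continuous_visc_v : Continuous (Function.uncurry fun x t => visc α (S.v x t)) := by
  unfold Function.uncurry visc
  exact continuous_const.add (continuous_const.mul
    (Continuous.rpow_const (by fun_prop) fun z => Or.inl (S.v_ne _ _)))

/-- Dissipation density produced by testing the temperature equation with `1 - θ ^ (-p)`. -/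
def diss (p x t : ℝ) : ℝ :=
  S.θ x t ^ (-p) * (p * S.θ x t ^ β * S.θx x t ^ 2 / S.θ x t + visc α (S.v x t) * S.ux x t ^ 2
    + S.w₁x x t ^ 2 + S.w₂x x t ^ 2 + S.b₁x x t ^ 2 + S.b₂x x t ^ 2) / S.v x t

/-- Energy density with thermal part `H θ`. -/
def energy (H : ℝ → ℝ) (x t : ℝ) : ℝ :=
  (S.u x t ^ 2 + S.w₁ x t ^ 2 + S.w₂ x t ^ 2 + S.v x t * (S.b₁ x t ^ 2 + S.b₂ x t ^ 2)) / 2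
    + H (S.θ x t) + relEnt (S.v x t)

/-- Time derivative of `energy`, for `H' z = 1 - z ^ (-p)`. -/
def energyRate (p x t : ℝ) : ℝ :=
  S.u x t * S.ut x t + S.w₁ x t * S.w₁t x t + S.w₂ x t * S.w₂t x t
    + S.ux x t * (S.b₁ x t ^ 2 + S.b₂ x t ^ 2) / 2
    + S.v x t * (S.b₁ x t * S.b₁t x t + S.b₂ x t * S.b₂t x t)
    + (1 - S.θ x t ^ (-p)) * S.θt x t + (S.ux x t - S.ux x t / S.v x t)

/-- Energy flux matching `energyRate`. -/
def flux (p x t : ℝ) : ℝ :=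
  S.u x t * (visc α (S.v x t) * S.ux x t / S.v x t)
    - S.u x t * (S.θ x t / S.v x t + (S.b₁ x t ^ 2 + S.b₂ x t ^ 2) / 2 - 1)
    + (S.w₁ x t * S.b₁ x t + S.w₂ x t * S.b₂ x t)
    + (S.w₁ x t * (S.w₁x x t / S.v x t) + S.w₂ x t * (S.w₂x x t / S.v x t))
    + (S.b₁ x t * (S.b₁x x t / S.v x t) + S.b₂ x t * (S.b₂x x t / S.v x t))
    + (1 - S.θ x t ^ (-p)) * (S.θ x t ^ β * S.θx x t / S.v x t)

/-- The part of the energy balance without a sign; it vanishes for `p = 1`. -/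
def source (p x t : ℝ) : ℝ := (S.θ x t * S.θ x t ^ (-p) - 1) * S.ux x t / S.v x t

@[fun_prop]
lemma continuous_diss (p : ℝ) : Continuous (Function.uncurry fun x t => S.diss p x t) := by
  unfold Function.uncurry diss
  fun_prop (disch := simp)

@[fun_prop]
lemma continuous_source (p : ℝ) : Continuous (Function.uncurry fun x t => S.source p x t) := by
  unfold Function.uncurry source
  fun_prop (disch := simp)

@[fun_prop]
lemma continuous_flux (p : ℝ) : Continuous (Function.uncurry fun x t => S.flux p x t) := by
  unfold Function.uncurry flux
  fun_prop (disch := simp)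

@[fun_prop]
lemma continuous_energyRate (p : ℝ) :
    Continuous (Function.uncurry fun x t => S.energyRate p x t) := by
  unfold Function.uncurry energyRate
  fun_prop (disch := simp)

lemma continuous_energy {H : ℝ → ℝ} (hH : ∀ z > 0, ContinuousAt H z) :
    Continuous (Function.uncurry fun x t => S.energy H x t) := by
  have h : Continuous fun z : ℝ × ℝ => H (S.θ z.1 z.2) := by
    rw [continuous_iff_continuousAt]
    intro z
    exact ContinuousAt.comp (f := fun z : ℝ × ℝ => S.θ z.1 z.2) (hH _ (S.θ_pos _ _))
      (Continuous.continuousAt (by fun_prop))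
  unfold Function.uncurry energy relEnt
  refine Continuous.add (Continuous.add ?_ h) ?_ <;> fun_prop (disch := simp)

lemma diss_nonneg (hα : 0 ≤ α) {p : ℝ} (hp : 0 ≤ p) (x t : ℝ) : 0 ≤ S.diss p x t := by
  have h1 := S.v_pos x t
  have h2 := S.θ_pos x t
  have h3 := visc_ge_one hα h1
  unfold diss
  positivity

lemma hasDerivWithinAt_energy {p : ℝ} {H : ℝ → ℝ}
    (hH : ∀ z > 0, HasDerivAt H (1 - z ^ (-p)) z) (x : ℝ) {t : ℝ} (ht : t ∈ Icc 0 T) :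
    HasDerivWithinAt (S.energy H x) (S.energyRate p x t) (Icc 0 T) t := by
  have h1 := ((S.dut x t ht).pow 2).add ((S.dw₁t x t ht).pow 2) |>.add ((S.dw₂t x t ht).pow 2)
  have h2 := (S.dvt x t ht).mul (((S.db₁t x t ht).pow 2).add ((S.db₂t x t ht).pow 2))
  have h3 := (hH _ (S.θ_pos x t)).comp_hasDerivWithinAt t (S.dθt x t ht)
  have h4 := ((S.dvt x t ht).sub_const 1).sub ((S.dvt x t ht).log (S.v_ne x t))
  refine ((((h1.add h2).div_const 2).add h3).add h4).congr_deriv ?_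
  unfold energyRate
  simp only [Pi.add_apply, Pi.pow_apply]
  norm_num
  ring

lemma hasDerivAt_flux (p x t : ℝ) :
    HasDerivAt (fun y => S.flux p y t)
      (S.energyRate p x t + S.diss p x t - S.source p x t) x := by
  have hv := S.v_pos x t
  have hθ := S.θ_pos x t
  have h1 := (S.dux x t).mul (S.mom x t)
  have h2 := (S.dux x t).mul ((((S.dθx x t).div (S.dvx x t) hv.ne').add
    ((((S.db₁x x t).pow 2).add ((S.db₂x x t).pow 2)).div_const 2)).sub_const 1)
  have h3 := ((S.dw₁x x t).mul (S.db₁x x t)).add ((S.dw₂x x t).mul (S.db₂x x t))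
  have h4 := ((S.dw₁x x t).mul (S.w₁eq x t)).add ((S.dw₂x x t).mul (S.w₂eq x t))
  have h5 := ((S.db₁x x t).mul (S.b₁eq x t)).add ((S.db₂x x t).mul (S.b₂eq x t))
  have h6 := (((S.dθx x t).rpow_const (p := -p) (Or.inl hθ.ne')).const_sub 1).mul (S.temp x t)
  refine (((((h1.sub h2).add h3).add h4).add h5).add h6).congr_deriv ?_
  have h7 : S.θ x t ^ (-p - 1) = S.θ x t ^ (-p) / S.θ x t := by
    rw [Real.rpow_sub_one hθ.ne']
  simp only [energyRate, diss, source, h7, Pi.add_apply, Pi.pow_apply, Pi.div_apply]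
  generalize S.θ x t ^ (-p) = e
  generalize S.θ x t ^ β = c
  have hv' := hv.ne'
  have hθ' := hθ.ne'
  field_simp
  ring

lemma flux_le {L ψ d p M B : ℝ} (hα : 0 ≤ α) (hp : 0 < p) (hL : 0 < L) (hψ : ψ ≤ 1)
    (hd : |d| ≤ 4 / L * ψ) {x t : ℝ} (hM : 1 ≤ M) (hB : 1 ≤ B)
    (hu : |S.u x t| ≤ M) (hw₁ : |S.w₁ x t| ≤ M) (hw₂ : |S.w₂ x t| ≤ M)
    (hb₁ : |S.b₁ x t| ≤ M) (hb₂ : |S.b₂ x t| ≤ M)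
    (h1 : visc α (S.v x t) / (S.v x t * S.θ x t ^ (-p)) ≤ B)
    (h2 : 1 / (S.v x t * S.θ x t ^ (-p)) ≤ B)
    (h3 : (1 - S.θ x t ^ (-p)) ^ 2 * S.θ x t ^ β * S.θ x t / (S.v x t * S.θ x t ^ (-p) * p) ≤ B)
    (h4 : S.θ x t / S.v x t ≤ B) :
    d * S.flux p x t ≤ ψ ^ 2 * (S.diss p x t / 2) + 48 * B * M ^ 2 / L ^ 2
      + 48 * B * M ^ 2 / L * (|S.u x t| + |S.w₁ x t| + |S.w₂ x t|) := by
  have hv := S.v_pos x t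
  have hθ := S.θ_pos x t
  have hm := visc_ge_one hα hv
  have he : 0 < S.θ x t ^ (-p) := Real.rpow_pos_of_pos hθ _
  have hc : 0 < S.θ x t ^ β := Real.rpow_pos_of_pos hθ _
  have hsq : ∀ z : ℝ, |z| ≤ M → z ^ 2 ≤ M ^ 2 := fun z hz =>
    sq_le_sq' (abs_le.1 hz).1 (abs_le.1 hz).2
  have hM2 : M ≤ M ^ 2 := le_self_pow₀ hM two_ne_zero
  have k1 : M ^ 2 ≤ B * M ^ 2 := le_mul_of_one_le_left (by positivity) hB
  have k2 : B ≤ B * M ^ 2 := le_mul_of_one_le_right (by linarith) (one_le_pow₀ hM)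
  have hP : |S.θ x t / S.v x t + (S.b₁ x t ^ 2 + S.b₂ x t ^ 2) / 2 - 1| ≤ B + M ^ 2 + 1 := by
    have := hsq _ hb₁
    have := hsq _ hb₂
    have : 0 < S.θ x t / S.v x t := div_pos hθ hv
    rw [abs_le]
    constructor <;> nlinarith [sq_nonneg (S.b₁ x t), sq_nonneg (S.b₂ x t)]
  unfold flux diss
  generalize S.θ x t ^ (-p) = e at *
  generalize S.θ x t ^ β = c at *
  generalize visc α (S.v x t) = m at *
  have a1 := absorb_flux_term (a := S.u x t * (m / S.v x t)) (z := S.ux x t) hL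
    (by positivity : 0 < e * m / S.v x t) hd
  have a2 := absorb_flux_term (a := S.w₁ x t / S.v x t) (z := S.w₁x x t) hL
    (by positivity : 0 < e / S.v x t) hd
  have a3 := absorb_flux_term (a := S.w₂ x t / S.v x t) (z := S.w₂x x t) hL
    (by positivity : 0 < e / S.v x t) hd
  have a4 := absorb_flux_term (a := S.b₁ x t / S.v x t) (z := S.b₁x x t) hL
    (by positivity : 0 < e / S.v x t) hd
  have a5 := absorb_flux_term (a := S.b₂ x t / S.v x t) (z := S.b₂x x t) hL
    (by positivity : 0 < e / S.v x t) hd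
  have a6 := absorb_flux_term (a := (1 - e) * c / S.v x t) (z := S.θx x t) hL
    (by positivity : 0 < e * p * c / (S.θ x t * S.v x t)) hd
  have b1 := abs_mul_le_flux (d := -d) (a := S.u x t) hL hψ (by rwa [abs_neg]) hP
  have b2 := abs_mul_le_flux (a := S.w₁ x t) hL hψ hd hb₁
  have b3 := abs_mul_le_flux (a := S.w₂ x t) hL hψ hd hb₂
  have e1 : (S.u x t * (m / S.v x t)) ^ 2 / (e * m / S.v x t) ≤ M ^ 2 * B := by
    have : (S.u x t * (m / S.v x t)) ^ 2 / (e * m / S.v x t)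
        = S.u x t ^ 2 * (m / (S.v x t * e)) := by field_simp
    rw [this]
    exact mul_le_mul (hsq _ hu) h1 (by positivity) (by positivity)
  have e2 : ∀ z, |z| ≤ M → (z / S.v x t) ^ 2 / (e / S.v x t) ≤ M ^ 2 * B := by
    intro z hz
    have : (z / S.v x t) ^ 2 / (e / S.v x t) = z ^ 2 * (1 / (S.v x t * e)) := by field_simp
    rw [this]
    exact mul_le_mul (hsq _ hz) h2 (by positivity) (by positivity)
  have e3 : ((1 - e) * c / S.v x t) ^ 2 / (e * p * c / (S.θ x t * S.v x t)) ≤ M ^ 2 * B := by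
    have : ((1 - e) * c / S.v x t) ^ 2 / (e * p * c / (S.θ x t * S.v x t))
        = (1 - e) ^ 2 * c * S.θ x t / (S.v x t * e * p) := by field_simp
    rw [this]
    exact h3.trans (le_mul_of_one_le_left (by linarith) (one_le_pow₀ hM))
  have hL2 : 0 < 8 / L ^ 2 := by positivity
  have f1 := mul_le_mul_of_nonneg_left e1 hL2.le
  have f2 := mul_le_mul_of_nonneg_left (e2 _ hw₁) hL2.le
  have f3 := mul_le_mul_of_nonneg_left (e2 _ hw₂) hL2.le
  have f4 := mul_le_mul_of_nonneg_left (e2 _ hb₁) hL2.le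
  have f5 := mul_le_mul_of_nonneg_left (e2 _ hb₂) hL2.le
  have f6 := mul_le_mul_of_nonneg_left e3 hL2.le
  have g1 : 4 / L * ((B + M ^ 2 + 1) * |S.u x t|) ≤ 48 * B * M ^ 2 / L * |S.u x t| := by
    rw [show 4 / L * ((B + M ^ 2 + 1) * |S.u x t|) = 4 * (B + M ^ 2 + 1) / L * |S.u x t| by ring]
    refine mul_le_mul_of_nonneg_right (div_le_div_of_nonneg_right ?_ hL.le) (abs_nonneg _)
    linarith
  have g2 : ∀ z : ℝ, 4 / L * (M * |z|) ≤ 48 * B * M ^ 2 / L * |z| := by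
    intro z
    rw [show 4 / L * (M * |z|) = 4 * M / L * |z| by ring]
    refine mul_le_mul_of_nonneg_right (div_le_div_of_nonneg_right ?_ hL.le) (abs_nonneg _)
    linarith
  have g3 := g2 (S.w₁ x t)
  have g4 := g2 (S.w₂ x t)
  have h48 : 48 * B * M ^ 2 / L ^ 2 = 6 * (8 / L ^ 2 * (M ^ 2 * B)) := by ring
  have hsum : ψ ^ 2 * (e * (p * c * S.θx x t ^ 2 / S.θ x t + m * S.ux x t ^ 2 + S.w₁x x t ^ 2
      + S.w₂x x t ^ 2 + S.b₁x x t ^ 2 + S.b₂x x t ^ 2) / S.v x t / 2)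
      = ψ ^ 2 * (e * m / S.v x t * S.ux x t ^ 2 / 2) + ψ ^ 2 * (e / S.v x t * S.w₁x x t ^ 2 / 2)
        + ψ ^ 2 * (e / S.v x t * S.w₂x x t ^ 2 / 2) + ψ ^ 2 * (e / S.v x t * S.b₁x x t ^ 2 / 2)
        + ψ ^ 2 * (e / S.v x t * S.b₂x x t ^ 2 / 2)
        + ψ ^ 2 * (e * p * c / (S.θ x t * S.v x t) * S.θx x t ^ 2 / 2) := by
    field_simp
    ring
  rw [hsum, h48]
  linear_combination a1 + a2 + a3 + a4 + a5 + a6 + b1 + b2 + b3 + f1 + f2 + f3 + f4 + f5 + f6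
    + g1 + g3 + g4

end MHDFlow

namespace MHDFlow

variable {α β T : ℝ} (S : MHDFlow α β T)

lemma flux_error_small {N : ℝ} (hN : 0 < N) : ∃ L₀ : ℝ, 1 ≤ L₀ ∧ ∀ L ≥ L₀, ∀ t,
    ∫ x in (-L)..L, (N / L ^ 2 + N / L * (|S.u x t| + |S.w₁ x t| + |S.w₂ x t|)) ≤ 1 := by
  obtain ⟨M, hM, hb⟩ := S.exists_bounds
  obtain ⟨R, hR⟩ := S.far (1 / (12 * N)) (by positivity)
  set A := 3 * M * (1 + R ^ 2) with hA
  have hA0 : 0 < A := by positivity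
  have hpt : ∀ x t, |S.u x t| + |S.w₁ x t| + |S.w₂ x t| ≤ 1 / (4 * N) + A * (1 + x ^ 2)⁻¹ := by
    intro x t
    have h4N : 1 / (4 * N) = 3 * (1 / (12 * N)) := by field_simp; norm_num
    rcases le_or_gt R |x| with h | h
    · obtain ⟨-, h2, -, h4, h5, -⟩ := hR x t h
      have : 0 < A * (1 + x ^ 2)⁻¹ := by positivity
      linarith
    · obtain ⟨-, -, -, -, h1, h2, h3, -⟩ := hb x t
      have h5 : x ^ 2 ≤ R ^ 2 := by
        rw [← sq_abs x]; exact pow_le_pow_left₀ (abs_nonneg _) h.le 2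
      have h6 : 3 * M ≤ A * (1 + x ^ 2)⁻¹ := by
        rw [← div_eq_mul_inv, le_div_iff₀ (by positivity), hA]
        exact mul_le_mul_of_nonneg_left (by linarith) (by linarith)
      have : 0 < 1 / (4 * N) := by positivity
      linarith
  refine ⟨max 1 (4 * N + 8 * N * A), le_max_left _ _, fun L hL t => ?_⟩
  have hL1 : 1 ≤ L := (le_max_left _ _).trans hL
  have hL2 : 4 * N + 8 * N * A ≤ L := (le_max_right _ _).trans hL
  have hL0 : 0 < L := by linarith
  have hcont : Continuous fun x : ℝ => (1 + x ^ 2)⁻¹ :=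
    Continuous.inv₀ (by fun_prop) fun x => by positivity
  calc ∫ x in (-L)..L, (N / L ^ 2 + N / L * (|S.u x t| + |S.w₁ x t| + |S.w₂ x t|))
      ≤ ∫ x in (-L)..L, ((N / L ^ 2 + 1 / (4 * L)) + N / L * A * (1 + x ^ 2)⁻¹) := by
        refine integral_mono_cont (by linarith) (by fun_prop) (by fun_prop) fun x _ => ?_
        have h := mul_le_mul_of_nonneg_left (hpt x t) (by positivity : 0 ≤ N / L)
        have h2 : N / L * (1 / (4 * N) + A * (1 + x ^ 2)⁻¹)
            = 1 / (4 * L) + N / L * A * (1 + x ^ 2)⁻¹ := by field_simp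
        linarith
    _ = (N / L ^ 2 + 1 / (4 * L)) * (2 * L)
        + N / L * A * (Real.arctan L - Real.arctan (-L)) := by
        rw [intervalIntegral.integral_add (by simp)
          (Continuous.intervalIntegrable (by fun_prop) _ _),
          intervalIntegral.integral_const_mul, integral_inv_one_add_sq]
        simp
        ring
    _ ≤ (N / L ^ 2 + 1 / (4 * L)) * (2 * L) + N / L * A * 4 := by
        have h1 := Real.arctan_lt_pi_div_two L
        have h2 := Real.neg_pi_div_two_lt_arctan (-L)
        have h3 := Real.pi_lt_four
        have h4 : Real.arctan L - Real.arctan (-L) ≤ 4 := by linarith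
        have := mul_le_mul_of_nonneg_left h4 (by positivity : 0 ≤ N / L * A)
        linarith
    _ = 1 / 2 + (2 * N + 4 * N * A) / L := by field_simp; ring
    _ ≤ 1 := by
        have : (2 * N + 4 * N * A) / L ≤ 1 / 2 := by
          rw [div_le_iff₀ hL0]; linarith
        linarith

lemma exists_flux_le (hα : 0 ≤ α) {p : ℝ} (hp : 0 < p) : ∃ N : ℝ, 0 < N ∧
    ∀ L > 0, ∀ ψ ≤ 1, ∀ d, |d| ≤ 4 / L * ψ → ∀ x t,
    d * S.flux p x t ≤ ψ ^ 2 * (S.diss p x t / 2)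
      + (N / L ^ 2 + N / L * (|S.u x t| + |S.w₁ x t| + |S.w₂ x t|)) := by
  obtain ⟨M, hM, hb⟩ := S.exists_bounds
  have hrp : ∀ q : ℝ, ∀ a > (0 : ℝ), ∀ b > (0 : ℝ),
      ContinuousAt (fun z : ℝ × ℝ => z.2 ^ q) (a, b) :=
    fun q a _ b hb => ContinuousAt.rpow_const continuousAt_snd (Or.inl hb.ne')
  have hvs : ∀ a > (0 : ℝ), ∀ b > (0 : ℝ),
      ContinuousAt (fun z : ℝ × ℝ => visc α z.1) (a, b) :=
    fun a ha b _ => continuousAt_const.add (continuousAt_const.mul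
      (ContinuousAt.rpow_const continuousAt_fst (Or.inl ha.ne')))
  have hne : ∀ a > (0 : ℝ), ∀ b > (0 : ℝ), a * b ^ (-p) ≠ 0 := fun a ha b hb =>
    (mul_pos ha (Real.rpow_pos_of_pos hb _)).ne'
  obtain ⟨B₁, hB₁, h1⟩ := S.exists_bound_comp (h := fun v θ => visc α v / (v * θ ^ (-p)))
    fun a ha b hb => (hvs a ha b hb).div (continuousAt_fst.mul (hrp _ a ha b hb)) (hne a ha b hb)
  obtain ⟨B₂, hB₂, h2⟩ := S.exists_bound_comp (h := fun v θ => 1 / (v * θ ^ (-p)))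
    fun a ha b hb => continuousAt_const.div (continuousAt_fst.mul (hrp _ a ha b hb))
      (hne a ha b hb)
  obtain ⟨B₃, hB₃, h3⟩ := S.exists_bound_comp
    (h := fun v θ => (1 - θ ^ (-p)) ^ 2 * θ ^ β * θ / (v * θ ^ (-p) * p))
    fun a ha b hb => by
      have hn : ContinuousAt (fun z : ℝ × ℝ => (1 - z.2 ^ (-p)) ^ 2 * z.2 ^ β * z.2) (a, b) :=
        (((continuousAt_const.sub (hrp (-p) a ha b hb)).pow 2).mul
          (hrp β a ha b hb)).mul continuousAt_snd
      exact hn.div ((continuousAt_fst.mul (hrp (-p) a ha b hb)).mul continuousAt_const)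
        (mul_ne_zero (hne a ha b hb) hp.ne')
  obtain ⟨B₄, hB₄, h4⟩ := S.exists_bound_comp (h := fun v θ => θ / v)
    fun a ha b hb => continuousAt_snd.div continuousAt_fst ha.ne'
  set B := B₁ + B₂ + B₃ + B₄
  refine ⟨48 * B * M ^ 2, by positivity, fun L hL ψ hψ d hd x t => ?_⟩
  obtain ⟨-, -, -, -, a1, a2, a3, a4, a5⟩ := hb x t
  rw [← add_assoc]
  refine S.flux_le hα hp hL hψ hd hM (by linarith) a1 a2 a3 a4 a5 ?_ ?_ ?_ ?_
  · exact (le_abs_self _).trans ((h1 x t).trans (by linarith))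
  · exact (le_abs_self _).trans ((h2 x t).trans (by linarith))
  · exact (le_abs_self _).trans ((h3 x t).trans (by linarith))
  · exact (le_abs_self _).trans ((h4 x t).trans (by linarith))

/-- Localized energy inequality: for all sufficiently large `L` (depending on the solution) the
flux through the weight is at most `1` per unit of time. -/
lemma local_energy (hα : 0 ≤ α) {p : ℝ} (hp : 0 < p) {H : ℝ → ℝ}
    (hH : ∀ z > 0, HasDerivAt H (1 - z ^ (-p)) z) :
    ∃ L₀ : ℝ, 1 ≤ L₀ ∧ ∀ L ≥ L₀, ∀ t ∈ Icc 0 T,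
    (∫ x in (-L)..L, bump L x * S.energy H x t)
      + ∫ s in 0..t, ∫ x in (-L)..L, bump L x * (S.diss p x s / 2)
    ≤ (∫ x in (-L)..L, bump L x * S.energy H x 0)
      + ∫ s in 0..t, (1 + ∫ x in (-L)..L, bump L x * S.source p x s) := by
  obtain ⟨N, hN, hflux⟩ := S.exists_flux_le hα hp
  obtain ⟨L₀, hL₀, herr⟩ := S.flux_error_small hN
  refine ⟨L₀, hL₀, fun L hL t ht => ?_⟩
  have hLpos : 0 < L := by linarith
  have hE := S.continuous_energy fun z hz => (hH z hz).continuousAt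
  have hrate : ∀ s, ∫ x in (-L)..L, bump L x * S.energyRate p x s
      ≤ (1 + ∫ x in (-L)..L, bump L x * S.source p x s)
        - ∫ x in (-L)..L, bump L x * (S.diss p x s / 2) := by
    intro s
    have hd : ∀ x, HasDerivAt (fun y => bump L y * S.flux p y s)
        (-(4 * x / L ^ 2 * (1 - x ^ 2 / L ^ 2)) * S.flux p x s
          + bump L x * (S.energyRate p x s + S.diss p x s - S.source p x s)) x :=
      fun x => (hasDerivAt_bump L x).mul (S.hasDerivAt_flux p x s)
    have h0 := ftc_cont (a := -L) (b := L) hd (by fun_prop)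
    have hbL : bump L L = 0 := by unfold bump; field_simp; ring
    have hbL' : bump L (-L) = 0 := by unfold bump; field_simp; ring
    rw [hbL, hbL', zero_mul, zero_mul, sub_zero] at h0
    have h1 : ∫ x in (-L)..L, bump L x * S.energyRate p x s
        = ∫ x in (-L)..L, (bump L x * S.energyRate p x s
          - (-(4 * x / L ^ 2 * (1 - x ^ 2 / L ^ 2)) * S.flux p x s
          + bump L x * (S.energyRate p x s + S.diss p x s - S.source p x s))) := by
      rw [intervalIntegral.integral_sub, h0, sub_zero] <;>
        exact Continuous.intervalIntegrable (by fun_prop) _ _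
    have h2 : ∫ x in (-L)..L, (bump L x * S.energyRate p x s
          - (-(4 * x / L ^ 2 * (1 - x ^ 2 / L ^ 2)) * S.flux p x s
          + bump L x * (S.energyRate p x s + S.diss p x s - S.source p x s)))
        ≤ ∫ x in (-L)..L, ((N / L ^ 2 + N / L * (|S.u x s| + |S.w₁ x s| + |S.w₂ x s|)
          + bump L x * S.source p x s) - bump L x * (S.diss p x s / 2)) := by
      refine integral_mono_cont (by linarith) (by fun_prop) (by fun_prop) fun x hx => ?_
      have hx1 := sq_div_sq_le_one hLpos hx
      have hx2 : 0 ≤ x ^ 2 / L ^ 2 := by positivity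
      have hψ : |4 * x / L ^ 2 * (1 - x ^ 2 / L ^ 2)| ≤ 4 / L * (1 - x ^ 2 / L ^ 2) := by
        rw [abs_mul, abs_of_nonneg (by linarith : 0 ≤ 1 - x ^ 2 / L ^ 2)]
        refine mul_le_mul_of_nonneg_right ?_ (by linarith)
        rw [abs_div, abs_mul, abs_of_pos (by positivity : 0 < L ^ 2),
          abs_of_pos (by norm_num : (0 : ℝ) < 4), div_le_div_iff₀ (by positivity) hLpos]
        have : |x| ≤ L := abs_le.2 hx
        nlinarith [mul_le_mul_of_nonneg_right this hLpos.le]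
      have h3 := hflux L hLpos (1 - x ^ 2 / L ^ 2) (by linarith) _ hψ x s
      change _ ≤ bump L x * _ + _ at h3
      linarith
    have h4 : ∫ x in (-L)..L, ((N / L ^ 2 + N / L * (|S.u x s| + |S.w₁ x s| + |S.w₂ x s|)
          + bump L x * S.source p x s) - bump L x * (S.diss p x s / 2))
        = (∫ x in (-L)..L, (N / L ^ 2 + N / L * (|S.u x s| + |S.w₁ x s| + |S.w₂ x s|)))
          + (∫ x in (-L)..L, bump L x * S.source p x s)
          - ∫ x in (-L)..L, bump L x * (S.diss p x s / 2) := by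
      rw [intervalIntegral.integral_sub, intervalIntegral.integral_add] <;>
        exact Continuous.intervalIntegrable (by fun_prop) _ _
    have h5 := herr L hL s
    linarith
  have hft := integral_param_ftc (f := fun x t => bump L x * S.energy H x t)
    (f' := fun x t => bump L x * S.energyRate p x t) (a := -L) (b := L) (lo := 0) (hi := T)
    (by unfold Function.uncurry; fun_prop) (by unfold Function.uncurry; fun_prop)
    (fun x s hs => (S.hasDerivWithinAt_energy hH x hs).const_mul _) ht
  have hmono := integral_mono_cont ht.1 (f := fun s => ∫ x in (-L)..L,
      bump L x * S.energyRate p x s)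
    (g := fun s => (1 + ∫ x in (-L)..L, bump L x * S.source p x s)
        - ∫ x in (-L)..L, bump L x * (S.diss p x s / 2))
    (by fun_prop) (by fun_prop) fun s _ => hrate s
  rw [intervalIntegral.integral_sub] at hmono
  · linarith
  all_goals exact Continuous.intervalIntegrable (by fun_prop) _ _

end MHDFlow

lemma hasDerivAt_relEnt {z : ℝ} (hz : 0 < z) : HasDerivAt relEnt (1 - z ^ (-1 : ℝ)) z := by
  have := ((hasDerivAt_id z).sub_const 1).sub (Real.hasDerivAt_log hz.ne')
  rw [Real.rpow_neg_one]
  exact this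

namespace MHDFlow

variable {α β T : ℝ} (S : MHDFlow α β T)

/-- The part of the `H¹` density of the initial data that controls the energy and `vx`. -/
def initDensity (x : ℝ) : ℝ :=
  (S.v x 0 - 1) ^ 2 + S.u x 0 ^ 2 + (S.θ x 0 - 1) ^ 2 + S.w₁ x 0 ^ 2 + S.w₂ x 0 ^ 2
    + S.b₁ x 0 ^ 2 + S.b₂ x 0 ^ 2 + S.vx x 0 ^ 2

/-- The hypotheses on the initial data. -/
structure InitBound (K δ : ℝ) : Prop where
  int_le : ∀ a b, a ≤ b → ∫ x in a..b, S.initDensity x ≤ K ^ 2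
  v_ge : ∀ x, δ ≤ S.v x 0
  θ_ge : ∀ x, δ ≤ S.θ x 0

@[fun_prop]
lemma continuous_initDensity : Continuous S.initDensity := by
  unfold initDensity
  fun_prop

/-- The a priori bound for the energy. -/
def energyConst (K δ T : ℝ) : ℝ := 2 * ((1 + 2 * K + 1 / δ) * K ^ 2 + T)

lemma energyConst_pos {K δ T : ℝ} (hK : 0 < K) (hδ : 0 < δ) (hT : 0 ≤ T) :
    0 < energyConst K δ T := by
  unfold energyConst; positivity

@[fun_prop]
lemma continuous_energy_relEnt :
    Continuous (Function.uncurry fun x t => S.energy relEnt x t) :=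
  S.continuous_energy fun _ hz => (hasDerivAt_relEnt hz).continuousAt

lemma energy_nonneg {H : ℝ → ℝ} (hH : ∀ z > 0, 0 ≤ H z) (x t : ℝ) : 0 ≤ S.energy H x t := by
  have h1 := S.v_pos x t
  have h2 := hH _ (S.θ_pos x t)
  have h3 := relEnt_nonneg h1
  unfold energy
  positivity

variable {S} {K δ : ℝ}

lemma InitBound.v_le (hS : S.InitBound K δ) (hK : 0 < K) (x : ℝ) : S.v x 0 ≤ 1 + 2 * K := by
  obtain ⟨y, hy, hyle⟩ := exists_le_unit_integral S.continuous_initDensity x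
  have hd : ∀ z, HasDerivAt (fun z => (S.v z 0 - 1) ^ 2) (2 * (S.v z 0 - 1) * S.vx z 0) z := by
    intro z
    refine (((S.dvx z 0).sub_const 1).pow 2).congr_deriv ?_
    norm_num
  have h1 := le_add_integral_abs_deriv hd (by fun_prop) hy
  have h2 : ∫ z in x..(x + 1), |2 * (S.v z 0 - 1) * S.vx z 0| ≤ ∫ z in x..(x + 1),
      S.initDensity z := by
    refine integral_mono_cont (by linarith) (by fun_prop) (by fun_prop) fun z _ => ?_
    unfold initDensity
    have : |2 * (S.v z 0 - 1) * S.vx z 0| ≤ (S.v z 0 - 1) ^ 2 + S.vx z 0 ^ 2 := by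
      rw [abs_le]
      constructor
      · nlinarith [sq_nonneg (S.v z 0 - 1 + S.vx z 0)]
      · nlinarith [sq_nonneg (S.v z 0 - 1 - S.vx z 0)]
    refine this.trans ?_
    nlinarith [sq_nonneg (S.u z 0), sq_nonneg (S.θ z 0 - 1), sq_nonneg (S.w₁ z 0),
      sq_nonneg (S.w₂ z 0), sq_nonneg (S.b₁ z 0), sq_nonneg (S.b₂ z 0)]
  have h3 := hS.int_le x (x + 1) (by linarith)
  have h4 : (S.v y 0 - 1) ^ 2 ≤ S.initDensity y := by
    unfold initDensity
    nlinarith [sq_nonneg (S.u y 0), sq_nonneg (S.θ y 0 - 1), sq_nonneg (S.w₁ y 0),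
      sq_nonneg (S.w₂ y 0), sq_nonneg (S.b₁ y 0), sq_nonneg (S.b₂ y 0), sq_nonneg (S.vx y 0)]
  nlinarith

lemma InitBound.energy_le (hS : S.InitBound K δ) (hK : 0 < K) (hδ : 0 < δ) (x : ℝ) :
    S.energy relEnt x 0 ≤ (1 + 2 * K + 1 / δ) * S.initDensity x := by
  have hδv := hS.v_ge x
  have hδθ := hS.θ_ge x
  have h1 : relEnt (S.v x 0) ≤ 1 / δ * (S.v x 0 - 1) ^ 2 := by
    refine (relEnt_le (S.v_pos x 0)).trans ?_
    rw [one_div_mul_eq_div]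
    gcongr
  have h2 : relEnt (S.θ x 0) ≤ 1 / δ * (S.θ x 0 - 1) ^ 2 := by
    refine (relEnt_le (S.θ_pos x 0)).trans ?_
    rw [one_div_mul_eq_div]
    gcongr
  have h3 := mul_le_mul_of_nonneg_right (hS.v_le hK x)
    (by positivity : 0 ≤ S.b₁ x 0 ^ 2 + S.b₂ x 0 ^ 2)
  have h4 : 0 < 1 / δ := by positivity
  unfold energy initDensity
  have e : 0 ≤ (1 + 2 * K) * ((S.v x 0 - 1) ^ 2 + (S.θ x 0 - 1) ^ 2 + S.vx x 0 ^ 2)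
      + 1 / δ * (S.u x 0 ^ 2 + S.w₁ x 0 ^ 2 + S.w₂ x 0 ^ 2 + S.b₁ x 0 ^ 2 + S.b₂ x 0 ^ 2
        + S.vx x 0 ^ 2)
      + (1 + 2 * K) * ((S.b₁ x 0 ^ 2 + S.b₂ x 0 ^ 2)) / 2
      + 2 * K * (S.u x 0 ^ 2 + S.w₁ x 0 ^ 2 + S.w₂ x 0 ^ 2)
      + (S.u x 0 ^ 2 + S.w₁ x 0 ^ 2 + S.w₂ x 0 ^ 2) / 2 := by positivity
  linarith

lemma InitBound.bump_energy_le (hS : S.InitBound K δ) (hK : 0 < K) (hδ : 0 < δ) {H : ℝ → ℝ}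
    (hHc : ∀ z > 0, ContinuousAt H z) (hH0 : ∀ z > 0, 0 ≤ H z) (hH : ∀ z > 0, H z ≤ relEnt z)
    {L : ℝ} (hL : 0 < L) :
    ∫ x in (-L)..L, bump L x * S.energy H x 0 ≤ (1 + 2 * K + 1 / δ) * K ^ 2 := by
  have hc := S.continuous_energy hHc
  have hA : 0 < 1 + 2 * K + 1 / δ := by positivity
  calc ∫ x in (-L)..L, bump L x * S.energy H x 0
      ≤ ∫ x in (-L)..L, (1 + 2 * K + 1 / δ) * S.initDensity x := by
        refine integral_mono_cont (by linarith) (by fun_prop) (by fun_prop) fun x hx => ?_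
        have h1 : S.energy H x 0 ≤ S.energy relEnt x 0 := by
          unfold energy
          have := hH _ (S.θ_pos x 0)
          linarith
        exact (mul_le_of_le_one_left (S.energy_nonneg hH0 x 0) (bump_le_one hL hx)).trans
          (h1.trans (hS.energy_le hK hδ x))
    _ ≤ _ := by
        rw [intervalIntegral.integral_const_mul]
        exact mul_le_mul_of_nonneg_left (hS.int_le _ _ (by linarith)) hA.le

lemma source_one (x t : ℝ) : S.source 1 x t = 0 := by
  unfold source
  rw [Real.rpow_neg_one, mul_inv_cancel₀ (S.θ_ne x t)]
  simp

/-- The basic energy estimate. -/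
lemma InitBound.energy_bound (hS : S.InitBound K δ) (hα : 0 ≤ α) (hK : 0 < K) (hδ : 0 < δ)
    {t : ℝ} (ht : t ∈ Icc 0 T) {a b : ℝ} (hab : a ≤ b) :
    ∫ x in a..b, S.energy relEnt x t ≤ energyConst K δ T := by
  obtain ⟨L₀, hL₀, h⟩ := S.local_energy hα one_pos fun z hz => hasDerivAt_relEnt hz
  set L := max L₀ (2 * max |a| |b|) with hLdef
  have hL1 : L₀ ≤ L := le_max_left _ _
  have hL2 : 2 * max |a| |b| ≤ L := le_max_right _ _
  have hL : 0 < L := by linarith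
  have ha : |a| ≤ L / 2 := by linarith [le_max_left |a| |b|]
  have hb : |b| ≤ L / 2 := by linarith [le_max_right |a| |b|]
  have h1 := h L hL1 t ht
  have h2 := hS.bump_energy_le hK hδ (H := relEnt)
    (fun z hz => (hasDerivAt_relEnt hz).continuousAt)
    (fun z hz => relEnt_nonneg hz) (fun z _ => le_rfl) hL
  have h3 : 0 ≤ ∫ s in 0..t, ∫ x in (-L)..L, bump L x * (S.diss 1 x s / 2) :=
    intervalIntegral.integral_nonneg ht.1 fun s _ =>
      intervalIntegral.integral_nonneg (by linarith) fun x _ =>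
        mul_nonneg (bump_nonneg _ _) (div_nonneg (S.diss_nonneg hα zero_le_one x s) zero_le_two)
  simp only [source_one, mul_zero, intervalIntegral.integral_zero, add_zero,
    intervalIntegral.integral_const, sub_zero, smul_eq_mul, mul_one] at h1
  have h4 : ∫ x in a..b, S.energy relEnt x t
      ≤ 2 * ∫ x in (-L)..L, bump L x * S.energy relEnt x t := by
    rw [← intervalIntegral.integral_const_mul]
    have hpos := S.energy_nonneg fun z hz => relEnt_nonneg hz
    calc ∫ x in a..b, S.energy relEnt x t
        ≤ ∫ x in a..b, 2 * (bump L x * S.energy relEnt x t) := by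
          refine integral_mono_cont hab (by fun_prop) (by fun_prop) fun x hx => ?_
          have hx' : |x| ≤ L / 2 := by
            rw [abs_le] at ha hb ⊢
            exact ⟨by linarith [hx.1], by linarith [hx.2]⟩
          nlinarith [half_le_bump hL hx', hpos x t]
      _ ≤ _ := by
          refine integral_mono_subinterval ?_ hab ?_ (by fun_prop) fun x _ => ?_
          · linarith [(abs_le.1 ha).1]
          · linarith [(abs_le.1 hb).2]
          · exact mul_nonneg zero_le_two (mul_nonneg (bump_nonneg _ _) (hpos x t))
  unfold energyConst
  linarith [ht.2]

end MHDFlow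

/-- A primitive of `z ↦ visc α z / z`. -/
def logVisc (α z : ℝ) : ℝ := Real.log z - z ^ (-α)

lemma hasDerivAt_logVisc {α z : ℝ} (hz : 0 < z) : HasDerivAt (logVisc α) (visc α z / z) z := by
  refine ((Real.hasDerivAt_log hz.ne').sub
    (Real.hasDerivAt_rpow_const (p := -α) (Or.inl hz.ne'))).congr_deriv ?_
  rw [Real.rpow_sub_one hz.ne']
  unfold visc
  field_simp
  ring

lemma logVisc_le_log {α z : ℝ} (hz : 0 < z) : logVisc α z ≤ Real.log z := by
  have := Real.rpow_pos_of_pos hz (-α)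
  unfold logVisc; linarith

lemma log_le_logVisc {α z : ℝ} (hα : 0 ≤ α) (hz : 1 ≤ z) : Real.log z ≤ logVisc α z + 1 := by
  have := Real.rpow_le_one_of_one_le_of_nonpos hz (neg_nonpos.2 hα)
  unfold logVisc; linarith

lemma exp_logVisc_le {α z : ℝ} (hz : 0 < z) : Real.exp (logVisc α z) ≤ z := by
  rw [← Real.le_log_iff_exp_le hz]
  exact logVisc_le_log hz

lemma logVisc_mono {α y z : ℝ} (hα : 0 ≤ α) (hy : 0 < y) (hyz : y ≤ z) :
    logVisc α y ≤ logVisc α z := by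
  have h1 := Real.log_le_log hy hyz
  have h2 := Real.rpow_le_rpow_of_nonpos hy hyz (neg_nonpos.2 hα)
  unfold logVisc; linarith

@[fun_prop]
lemma continuous_visc_comp {X : Type*} [TopologicalSpace X] {α : ℝ} {f : X → ℝ}
    (hf : Continuous f) (h : ∀ x, f x ≠ 0) : Continuous fun x => visc α (f x) :=
  continuous_const.add (continuous_const.mul (hf.rpow_const fun x => Or.inl (h x)))

@[fun_prop]
lemma continuous_logVisc_comp {X : Type*} [TopologicalSpace X] {α : ℝ} {f : X → ℝ}
    (hf : Continuous f) (h : ∀ x, f x ≠ 0) : Continuous fun x => logVisc α (f x) :=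
  (hf.log h).sub (hf.rpow_const fun x => Or.inl (h x))

/-- Pointwise lower bound used for averaging `exp (logVisc v)` over a unit interval. -/
lemma le_exp_logVisc {α N z : ℝ} (hα : 0 ≤ α) (hN : 0 < N) (hz : 0 < z) :
    Real.exp (logVisc α (Real.exp (-N - 1))) / N * (N - relEnt z) ≤ Real.exp (logVisc α z) := by
  rcases le_total N (relEnt z) with h | h
  · exact (mul_nonpos_of_nonneg_of_nonpos (by positivity) (by linarith)).trans
      (Real.exp_pos _).le
  · have h1 := Real.exp_le_exp.2 (logVisc_mono hα (Real.exp_pos _) (exp_le_of_relEnt_le hz h))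
    refine le_trans ?_ h1
    rw [div_mul_eq_mul_div, div_le_iff₀ hN]
    have := relEnt_nonneg hz
    exact mul_le_mul_of_nonneg_left (by linarith) (Real.exp_pos _).le

namespace MHDFlow

variable {α β T : ℝ} (S : MHDFlow α β T)

/-- Total (thermal and magnetic) pressure. -/
def press (x t : ℝ) : ℝ := S.θ x t / S.v x t + (S.b₁ x t ^ 2 + S.b₂ x t ^ 2) / 2

/-- Time integral of the total pressure. -/
def pressInt (x t : ℝ) : ℝ := ∫ s in 0..t, S.press x s

@[fun_prop]
lemma continuous_press : Continuous (Function.uncurry fun x t => S.press x t) := by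
  unfold Function.uncurry press
  fun_prop (disch := simp)

@[fun_prop]
lemma continuous_pressInt : Continuous (Function.uncurry fun x t => S.pressInt x t) := by
  unfold Function.uncurry pressInt
  exact intervalIntegral.continuous_parametric_intervalIntegral_of_continuous
    (f := fun (z : ℝ × ℝ) s => S.press z.1 s) (by unfold Function.uncurry; fun_prop)
    continuous_snd

lemma press_pos (x t : ℝ) : 0 < S.press x t := by
  have := S.v_pos x t
  have := S.θ_pos x t
  unfold press
  positivity

lemma pressInt_nonneg (x : ℝ) {t : ℝ} (ht : 0 ≤ t) : 0 ≤ S.pressInt x t :=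
  intervalIntegral.integral_nonneg ht fun s _ => (S.press_pos x s).le

lemma hasDerivAt_pressInt (x t : ℝ) : HasDerivAt (S.pressInt x) (S.press x t) t :=
  (Continuous.integral_hasStrictDerivAt (f := S.press x) (by fun_prop) 0 t).hasDerivAt

lemma hasDerivAt_momFlux (x t : ℝ) :
    HasDerivAt (fun y => visc α (S.v y t) * S.ux y t / S.v y t - S.press y t) (S.ut x t) x := by
  have h := ((S.dθx x t).div (S.dvx x t) (S.v_ne x t)).add
    ((((S.db₁x x t).pow 2).add ((S.db₂x x t).pow 2)).div_const 2)
  refine ((S.mom x t).sub h).congr_deriv ?_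
  have := S.v_ne x t
  norm_num
  field_simp
  ring

lemma logVisc_eq (x : ℝ) {t : ℝ} (ht : t ∈ Icc 0 T) :
    logVisc α (S.v x t) = logVisc α (S.v x 0)
      + ∫ s in 0..t, visc α (S.v x s) * S.ux x s / S.v x s := by
  have h := intervalIntegral.integral_eq_sub_of_hasDerivAt_of_le
    (f := fun s => logVisc α (S.v x s))
    (f' := fun s => visc α (S.v x s) * S.ux x s / S.v x s) ht.1
    (Continuous.continuousOn (by fun_prop (disch := simp))) (fun s hs => ?_)
    (Continuous.intervalIntegrable (by fun_prop (disch := simp)) _ _)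
  · rw [h]; ring
  · have hs' : s ∈ Icc 0 T := ⟨hs.1.le, hs.2.le.trans ht.2⟩
    have h1 := (S.dvt x s hs').hasDerivAt (Icc_mem_nhds hs.1 (hs.2.trans_le ht.2))
    refine ((hasDerivAt_logVisc (S.v_pos x s)).comp s h1).congr_deriv ?_
    ring

/-- The momentum equation, integrated in space and time. -/
lemma logVisc_sub_pressInt (a y : ℝ) {t : ℝ} (ht : t ∈ Icc 0 T) :
    logVisc α (S.v y t) - S.pressInt y t = logVisc α (S.v a t) - S.pressInt a t
      + (logVisc α (S.v y 0) - logVisc α (S.v a 0))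
      + ((∫ x in a..y, S.u x t) - ∫ x in a..y, S.u x 0) := by
  have h1 := integral_param_ftc (a := a) (b := y) S.cu S.cut S.dut ht
  have h2 : ∀ s, ∫ x in a..y, S.ut x s
      = (visc α (S.v y s) * S.ux y s / S.v y s - S.press y s)
        - (visc α (S.v a s) * S.ux a s / S.v a s - S.press a s) :=
    fun s => ftc_cont (fun x => S.hasDerivAt_momFlux x s) (by fun_prop)
  simp only [h2] at h1
  rw [intervalIntegral.integral_sub, intervalIntegral.integral_sub,
    intervalIntegral.integral_sub] at h1
  · rw [S.logVisc_eq y ht, S.logVisc_eq a ht]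
    unfold pressInt
    linarith
  all_goals exact Continuous.intervalIntegrable (by fun_prop (disch := simp)) _ _

end MHDFlow

namespace MHDFlow

variable {α β T : ℝ} {S : MHDFlow α β T} {K δ : ℝ}

/-- Oscillation bound for `logVisc v - pressInt` in a unit interval. -/
def cellConst (α K δ T : ℝ) : ℝ :=
  logVisc α (1 + 2 * K) - logVisc α δ + (1 + 2 * energyConst K δ T)

lemma u_sq_le_energy (x t : ℝ) : S.u x t ^ 2 / 2 ≤ S.energy relEnt x t := by
  have h1 := S.v_pos x t
  have h2 := relEnt_nonneg (S.θ_pos x t)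
  have h3 := relEnt_nonneg h1
  unfold energy
  have : 0 ≤ S.v x t * (S.b₁ x t ^ 2 + S.b₂ x t ^ 2) := by positivity
  linarith [sq_nonneg (S.w₁ x t), sq_nonneg (S.w₂ x t)]

lemma relEnt_v_le_energy (x t : ℝ) : relEnt (S.v x t) ≤ S.energy relEnt x t := by
  have h1 := S.v_pos x t
  have h2 := relEnt_nonneg (S.θ_pos x t)
  unfold energy
  have : 0 ≤ S.v x t * (S.b₁ x t ^ 2 + S.b₂ x t ^ 2) := by positivity
  linarith [sq_nonneg (S.u x t), sq_nonneg (S.w₁ x t), sq_nonneg (S.w₂ x t)]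

lemma relEnt_θ_add_le_energy (x t : ℝ) :
    relEnt (S.θ x t) + S.v x t * (S.b₁ x t ^ 2 + S.b₂ x t ^ 2) / 2 ≤ S.energy relEnt x t := by
  have h3 := relEnt_nonneg (S.v_pos x t)
  unfold energy
  linarith [sq_nonneg (S.u x t), sq_nonneg (S.w₁ x t), sq_nonneg (S.w₂ x t)]

namespace InitBound

lemma abs_integral_u_le (hS : S.InitBound K δ) (hα : 0 ≤ α) (hK : 0 < K) (hδ : 0 < δ)
    {t : ℝ} (ht : t ∈ Icc 0 T) {a y : ℝ} (hy : y ∈ Icc a (a + 1)) :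
    |∫ x in a..y, S.u x t| ≤ 1 / 2 + energyConst K δ T := by
  calc |∫ x in a..y, S.u x t| ≤ ∫ x in a..y, |S.u x t| :=
        intervalIntegral.abs_integral_le_integral_abs hy.1
    _ ≤ ∫ x in a..(a + 1), |S.u x t| :=
        integral_mono_subinterval le_rfl hy.1 hy.2 (by fun_prop) fun _ _ => abs_nonneg _
    _ ≤ ∫ x in a..(a + 1), (1 / 2 + S.energy relEnt x t) := by
        refine integral_mono_cont (by linarith) (by fun_prop) (by fun_prop) fun x _ => ?_
        have := S.u_sq_le_energy x t
        nlinarith [sq_nonneg (|S.u x t| - 1), sq_abs (S.u x t)]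
    _ ≤ _ := by
        rw [intervalIntegral.integral_add (by simp)
          (Continuous.intervalIntegrable (by fun_prop) _ _)]
        have := hS.energy_bound hα hK hδ ht (show a ≤ a + 1 by linarith)
        simpa using this

lemma cell_bound (hS : S.InitBound K δ) (hα : 0 ≤ α) (hT : 0 ≤ T) (hK : 0 < K) (hδ : 0 < δ)
    {t : ℝ} (ht : t ∈ Icc 0 T) {a y : ℝ} (hy : y ∈ Icc a (a + 1)) :
    |logVisc α (S.v y t) - S.pressInt y t - (logVisc α (S.v a t) - S.pressInt a t)|
      ≤ cellConst α K δ T := by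
  have h0 : (0 : ℝ) ∈ Icc 0 T := ⟨le_rfl, hT⟩
  have h1 := abs_le.1 (hS.abs_integral_u_le hα hK hδ ht hy)
  have h2 := abs_le.1 (hS.abs_integral_u_le hα hK hδ h0 hy)
  have h3 := logVisc_mono hα hδ (hS.v_ge y)
  have h4 := logVisc_mono hα hδ (hS.v_ge a)
  have h5 := logVisc_mono hα (S.v_pos y 0) (hS.v_le hK y)
  have h6 := logVisc_mono hα (S.v_pos a 0) (hS.v_le hK a)
  rw [S.logVisc_sub_pressInt a y ht, abs_le]
  unfold cellConst
  constructor <;> linarith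

lemma integral_press_weight_le (hS : S.InitBound K δ) (hα : 0 ≤ α) (hK : 0 < K) (hδ : 0 < δ)
    {t : ℝ} (ht : t ∈ Icc 0 T) (a : ℝ) :
    ∫ x in a..(a + 1), S.press x t * S.v x t ≤ 2 * energyConst K δ T + 2 := by
  calc ∫ x in a..(a + 1), S.press x t * S.v x t
      ≤ ∫ x in a..(a + 1), (2 * S.energy relEnt x t + 2) := by
        refine integral_mono_cont (by linarith) (by fun_prop) (by fun_prop) fun x _ => ?_
        have h1 := S.relEnt_θ_add_le_energy x t
        have h2 := le_two_mul_relEnt (S.θ_pos x t)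
        have h3 := S.v_pos x t
        have h4 : 0 ≤ S.v x t * (S.b₁ x t ^ 2 + S.b₂ x t ^ 2) := by positivity
        have h5 : S.press x t * S.v x t
            = S.θ x t + S.v x t * (S.b₁ x t ^ 2 + S.b₂ x t ^ 2) / 2 := by
          unfold press; field_simp
        rw [h5]
        linarith
    _ ≤ _ := by
        rw [intervalIntegral.integral_add (Continuous.intervalIntegrable (by fun_prop) _ _)
          (by simp), intervalIntegral.integral_const_mul]
        have := hS.energy_bound hα hK hδ ht (show a ≤ a + 1 by linarith)
        simpa using this

lemma integral_v_le (hS : S.InitBound K δ) (hα : 0 ≤ α) (hK : 0 < K) (hδ : 0 < δ)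
    {t : ℝ} (ht : t ∈ Icc 0 T) (a : ℝ) :
    ∫ x in a..(a + 1), S.v x t ≤ 2 * energyConst K δ T + 2 := by
  calc ∫ x in a..(a + 1), S.v x t ≤ ∫ x in a..(a + 1), (2 * S.energy relEnt x t + 2) := by
        refine integral_mono_cont (by linarith) (by fun_prop) (by fun_prop) fun x _ => ?_
        have h1 := S.relEnt_v_le_energy x t
        have h2 := le_two_mul_relEnt (S.v_pos x t)
        linarith
    _ ≤ _ := by
        rw [intervalIntegral.integral_add (Continuous.intervalIntegrable (by fun_prop) _ _)
          (by simp), intervalIntegral.integral_const_mul]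
        have := hS.energy_bound hα hK hδ ht (show a ≤ a + 1 by linarith)
        simpa using this

lemma le_integral_exp_logVisc (hS : S.InitBound K δ) (hα : 0 ≤ α) (hK : 0 < K) (hδ : 0 < δ)
    {t : ℝ} (ht : t ∈ Icc 0 T) (a : ℝ) {N : ℝ} (hN : N = energyConst K δ T + 1) (hN0 : 0 < N) :
    Real.exp (logVisc α (Real.exp (-N - 1))) / N
      ≤ ∫ x in a..(a + 1), Real.exp (logVisc α (S.v x t)) := by
  set A := Real.exp (logVisc α (Real.exp (-N - 1))) / N
  have hA : 0 < A := by positivity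
  calc A ≤ A * (N - ∫ x in a..(a + 1), S.energy relEnt x t) := by
        have := hS.energy_bound hα hK hδ ht (show a ≤ a + 1 by linarith)
        exact le_mul_of_one_le_right hA.le (by linarith)
    _ = ∫ x in a..(a + 1), A * (N - S.energy relEnt x t) := by
        rw [intervalIntegral.integral_const_mul, intervalIntegral.integral_sub (by simp)
          (Continuous.intervalIntegrable (by fun_prop) _ _)]
        simp
    _ ≤ _ := by
        refine integral_mono_cont (by linarith) (by fun_prop) (by fun_prop (disch := simp))
          fun x _ => ?_
        refine le_trans ?_ (le_exp_logVisc hα hN0 (S.v_pos x t))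
        exact mul_le_mul_of_nonneg_left (by linarith [S.relEnt_v_le_energy x t]) hA.le

/-- Upper bound for `exp (-Z)`, where `Z = logVisc v - pressInt` at a given point. -/
lemma exp_neg_le (hS : S.InitBound K δ) (hα : 0 ≤ α) (hT : 0 ≤ T) (hK : 0 < K) (hδ : 0 < δ)
    (a : ℝ) {N A B k : ℝ} (hN : N = energyConst K δ T + 1)
    (hA : A = Real.exp (logVisc α (Real.exp (-N - 1))) / N)
    (hB : B = Real.exp (cellConst α K δ T)) (hk : k = B / A * (B * (2 * N))) :
    ∀ t ∈ Icc 0 T, Real.exp (-(logVisc α (S.v a t) - S.pressInt a t))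
      ≤ B / A * Real.exp (k * T) := by
  have hN0 : 0 < N := by linarith [energyConst_pos hK hδ hT]
  have hA0 : 0 < A := by rw [hA]; positivity
  have hB0 : 0 < B := by rw [hB]; positivity
  have hk0 : 0 ≤ k := by rw [hk]; positivity
  set ζ : ℝ → ℝ := fun t => Real.exp (-(logVisc α (S.v a t) - S.pressInt a t)) with hζ
  have hζc : Continuous ζ := by simp only [hζ]; fun_prop (disch := simp)
  have hup : ∀ s ∈ Icc 0 T, ∀ y ∈ Icc a (a + 1),
      Real.exp (S.pressInt y s) ≤ B * ζ s * Real.exp (logVisc α (S.v y s)) := by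
    intro s hs y hy
    have := (abs_le.1 (hS.cell_bound hα hT hK hδ hs hy)).1
    simp only [hζ]
    rw [hB, ← Real.exp_add, ← Real.exp_add, Real.exp_le_exp]
    linarith
  have hlow : ∀ s ∈ Icc 0 T, ∀ y ∈ Icc a (a + 1),
      ζ s * Real.exp (logVisc α (S.v y s)) ≤ B * Real.exp (S.pressInt y s) := by
    intro s hs y hy
    have := (abs_le.1 (hS.cell_bound hα hT hK hδ hs hy)).2
    simp only [hζ]
    rw [hB, ← Real.exp_add, ← Real.exp_add, Real.exp_le_exp]
    linarith
  have hmain : ∀ t ∈ Icc 0 T, ζ t ≤ B / A + ∫ s in 0..t, k * ζ s := by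
    intro t ht
    have hd : ∀ x, ∀ t ∈ Icc 0 T, HasDerivWithinAt (fun t => Real.exp (S.pressInt x t))
        (Real.exp (S.pressInt x t) * S.press x t) (Icc 0 T) t :=
      fun x t _ => (S.hasDerivAt_pressInt x t).exp.hasDerivWithinAt
    have h1 := integral_param_ftc (a := a) (b := a + 1) (f := fun x t => Real.exp (S.pressInt x t))
      (f' := fun x t => Real.exp (S.pressInt x t) * S.press x t)
      (by unfold Function.uncurry; fun_prop) (by unfold Function.uncurry; fun_prop) hd ht
    have h2 : ∫ x in a..(a + 1), Real.exp (S.pressInt x 0) = 1 := by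
      simp [pressInt]
    have h3 : ∫ s in 0..t, ∫ x in a..(a + 1), Real.exp (S.pressInt x s) * S.press x s
        ≤ ∫ s in 0..t, B * ζ s * (2 * N) := by
      refine integral_mono_cont ht.1 ?_ (by fun_prop) fun s hs => ?_
      · exact intervalIntegral.continuous_parametric_intervalIntegral_of_continuous'
          (f := fun s x => Real.exp (S.pressInt x s) * S.press x s)
          (by unfold Function.uncurry; fun_prop) _ _
      · have hs' : s ∈ Icc 0 T := ⟨hs.1, hs.2.trans ht.2⟩
        have hζ0 : 0 < ζ s := Real.exp_pos _
        calc ∫ x in a..(a + 1), Real.exp (S.pressInt x s) * S.press x s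
            ≤ ∫ x in a..(a + 1), B * ζ s * (S.press x s * S.v x s) := by
              refine integral_mono_cont (by linarith) (by fun_prop) (by fun_prop) fun x hx => ?_
              have e1 := hup s hs' x hx
              have e2 := mul_le_mul_of_nonneg_left (exp_logVisc_le (α := α) (S.v_pos x s))
                (by positivity : 0 ≤ B * ζ s)
              have e3 := mul_le_mul_of_nonneg_right (e1.trans e2) (S.press_pos x s).le
              linarith
          _ ≤ _ := by
              rw [intervalIntegral.integral_const_mul]
              refine mul_le_mul_of_nonneg_left ?_ (by positivity)
              have := hS.integral_press_weight_le hα hK hδ hs' a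
              rw [hN]; linarith
    have h4 : ζ t * A ≤ B * ∫ x in a..(a + 1), Real.exp (S.pressInt x t) := by
      have e1 := hS.le_integral_exp_logVisc hα hK hδ ht a hN hN0
      rw [← hA] at e1
      have hζ0 : 0 < ζ t := Real.exp_pos _
      refine (mul_le_mul_of_nonneg_left e1 hζ0.le).trans ?_
      rw [← intervalIntegral.integral_const_mul, ← intervalIntegral.integral_const_mul]
      exact integral_mono_cont (by linarith) (by fun_prop (disch := simp)) (by fun_prop)
        (hlow t ht)
    have h5 : ∫ s in 0..t, B * ζ s * (2 * N) = B * (2 * N) * ∫ s in 0..t, ζ s := by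
      rw [← intervalIntegral.integral_const_mul]; congr 1; ext s; ring
    rw [h2] at h1
    have h6 : ∫ x in a..(a + 1), Real.exp (S.pressInt x t)
        ≤ 1 + B * (2 * N) * ∫ s in 0..t, ζ s := by linarith
    rw [intervalIntegral.integral_const_mul, hk]
    have h7 := h4.trans (mul_le_mul_of_nonneg_left h6 hB0.le)
    rw [← le_div_iff₀ hA0] at h7
    refine h7.trans (le_of_eq ?_)
    field_simp
  intro t ht
  refine (gronwall_integral hζc continuous_const (fun _ => hk0) hmain t ht).trans ?_
  rw [intervalIntegral.integral_const, sub_zero, smul_eq_mul, mul_comm t k]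
  refine mul_le_mul_of_nonneg_left (Real.exp_le_exp.2 ?_) (by positivity)
  exact mul_le_mul_of_nonneg_left ht.2 hk0

lemma v_le_exp_pressInt (hS : S.InitBound K δ) (hα : 0 ≤ α) (hT : 0 ≤ T) (hK : 0 < K)
    (hδ : 0 < δ) (a : ℝ) {t : ℝ} (ht : t ∈ Icc 0 T) :
    S.v a t ≤ (1 + Real.exp 1 * (Real.exp (cellConst α K δ T) * (2 * energyConst K δ T + 2)))
      * Real.exp (S.pressInt a t) := by
  set B := Real.exp (cellConst α K δ T) with hB
  have hB0 : 0 < B := Real.exp_pos _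
  have hE := energyConst_pos hK hδ hT
  set ζ := Real.exp (logVisc α (S.v a t) - S.pressInt a t) with hζ
  have h1 : ζ ≤ B * (2 * energyConst K δ T + 2) := by
    have h2 := hS.integral_v_le hα hK hδ ht a
    have h3 : ∫ x in a..(a + 1), ζ ≤ ∫ x in a..(a + 1), B * S.v x t := by
      refine integral_mono_cont (by linarith) (by fun_prop) (by fun_prop) fun y hy => ?_
      have e1 := (abs_le.1 (hS.cell_bound hα hT hK hδ ht hy)).1
      have e2 := S.pressInt_nonneg y ht.1
      have e3 : ζ ≤ B * Real.exp (logVisc α (S.v y t)) := by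
        rw [hB, hζ, ← Real.exp_add, Real.exp_le_exp]; linarith
      exact e3.trans (mul_le_mul_of_nonneg_left (exp_logVisc_le (S.v_pos y t)) hB0.le)
    rw [intervalIntegral.integral_const_mul] at h3
    simp only [intervalIntegral.integral_const, add_sub_cancel_left, smul_eq_mul, one_mul] at h3
    exact h3.trans (mul_le_mul_of_nonneg_left h2 hB0.le)
  have hP : 1 ≤ Real.exp (S.pressInt a t) := Real.one_le_exp (S.pressInt_nonneg a ht.1)
  have hPos : 0 ≤ Real.exp 1 * (B * (2 * energyConst K δ T + 2)) := by positivity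
  rcases le_total (S.v a t) 1 with h | h
  · exact h.trans (one_le_mul_of_one_le_of_one_le (by linarith) hP)
  · have e1 := log_le_logVisc hα h
    have e2 : S.v a t ≤ Real.exp 1 * ζ * Real.exp (S.pressInt a t) := by
      rw [hζ, ← Real.exp_add, ← Real.exp_add, ← Real.log_le_iff_le_exp (S.v_pos a t)]
      linarith
    refine e2.trans (mul_le_mul_of_nonneg_right ?_ (Real.exp_pos _).le)
    have := mul_le_mul_of_nonneg_left h1 (Real.exp_pos 1).le
    linarith

end InitBound

lemma exists_v_bounds (hα : 0 ≤ α) (hT : 0 ≤ T) (hK : 0 < K) (hδ : 0 < δ) :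
    ∃ c > 0, ∃ C > 0, ∀ S : MHDFlow α β T, S.InitBound K δ → ∀ x, ∀ t ∈ Icc 0 T,
      c ≤ S.v x t ∧ S.v x t ≤ C * Real.exp (S.pressInt x t) := by
  have hE := energyConst_pos hK hδ hT
  set N := energyConst K δ T + 1 with hN
  set A := Real.exp (logVisc α (Real.exp (-N - 1))) / N with hA
  set B := Real.exp (cellConst α K δ T) with hB
  have hA0 : 0 < A := by positivity
  have hB0 : 0 < B := Real.exp_pos _
  set D := B / A * Real.exp (B / A * (B * (2 * N)) * T) with hD
  have hD0 : 0 < D := by positivity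
  refine ⟨D⁻¹, by positivity,
    1 + Real.exp 1 * (Real.exp (cellConst α K δ T) * (2 * energyConst K δ T + 2)),
    by positivity, fun S hS x t ht => ⟨?_, hS.v_le_exp_pressInt hα hT hK hδ x ht⟩⟩
  have h1 := hS.exp_neg_le hα hT hK hδ x hN hA hB rfl t ht
  rw [← hD, ← inv_inv (Real.exp _), ← Real.exp_neg, neg_neg] at h1
  have h2 := inv_le_of_inv_le₀ (Real.exp_pos _) h1
  refine h2.trans (le_trans ?_ (exp_logVisc_le (S.v_pos x t) (α := α)))
  exact Real.exp_le_exp.2 (by linarith [S.pressInt_nonneg x ht.1])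

end MHDFlow

lemma flux_deriv_nonneg_of_min {f f' m : ℝ → ℝ} {x D : ℝ} (hf : ∀ y, HasDerivAt f (f' y) y)
    (hm : ∀ y, 0 < m y) (hg : HasDerivAt (fun y => m y * f' y) D x) (hmin : ∀ y, f x ≤ f y) :
    0 ≤ D := by
  have hx : f' x = 0 :=
    IsLocalMin.hasDerivAt_eq_zero (Eventually.of_forall hmin) (hf x)
  by_contra! hD
  have h1 := (hasDerivWithinAt_iff_tendsto_slope' (s := Ioi x) (by simp)).1 hg.hasDerivWithinAt
  obtain ⟨u, hu, hsub⟩ := (mem_nhdsGT_iff_exists_Ioo_subset' (lt_add_one x)).1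
    (h1.eventually_lt_const hD)
  have hu' : x < u := hu
  obtain ⟨y, hy, hyeq⟩ := exists_hasDerivAt_eq_slope f f' (by linarith : x < (x + u) / 2)
    (fun z _ => (hf z).continuousAt.continuousWithinAt) (fun z _ => hf z)
  have hyI : y ∈ Ioo x u := ⟨hy.1, by linarith [hy.2]⟩
  have h2 : slope (fun y => m y * f' y) x y < 0 := hsub hyI
  rw [slope_def_field, hx, mul_zero, sub_zero, div_neg_iff] at h2
  have h3 : m y * f' y < 0 := by
    rcases h2 with h | h
    · linarith [h.2, hy.1]
    · exact h.1
  have h4 : f' y < 0 := by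
    by_contra! h
    exact absurd h3 (not_lt.2 (mul_nonneg (hm y).le h))
  rw [hyeq, div_neg_iff] at h4
  have := hmin ((x + u) / 2)
  rcases h4 with h | h
  · linarith [h.2]
  · linarith [h.1]

lemma deriv_nonneg_of_max_Icc {h : ℝ → ℝ} {h' T t : ℝ} (ht : t ∈ Icc 0 T) (ht0 : 0 < t)
    (hd : HasDerivWithinAt h h' (Icc 0 T) t) (hmax : ∀ s ∈ Icc 0 T, h s ≤ h t) : 0 ≤ h' := by
  have h1 : HasDerivWithinAt h h' (Ico 0 t) t :=
    hd.mono fun s hs => ⟨hs.1, hs.2.le.trans ht.2⟩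
  rw [hasDerivWithinAt_iff_tendsto_slope' (by simp)] at h1
  have : (𝓝[Ico 0 t] t).NeBot := by
    rw [nhdsWithin_Ico_eq_nhdsLT ht0]; infer_instance
  refine ge_of_tendsto h1 ?_
  filter_upwards [self_mem_nhdsWithin] with s hs
  rw [slope_def_field]
  have := hmax s ⟨hs.1, hs.2.le.trans ht.2⟩
  exact div_nonneg_of_nonpos (by linarith) (by linarith [hs.2])

namespace MHDFlow

variable {α β T : ℝ} (S : MHDFlow α β T)

lemma θt_ge_of_min (hα : 0 ≤ α) {x t c : ℝ} (hc : 0 < c) (hv : c ≤ S.v x t)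
    (hmin : ∀ y, S.θ x t ≤ S.θ y t) : -(S.θ x t ^ 2 / (4 * c)) ≤ S.θt x t := by
  have h := flux_deriv_nonneg_of_min (f := fun y => S.θ y t) (f' := fun y => S.θx y t)
    (m := fun y => S.θ y t ^ β / S.v y t) (fun y => S.dθx y t)
    (fun y => div_pos (Real.rpow_pos_of_pos (S.θ_pos y t) _) (S.v_pos y t))
    ((S.temp x t).congr_of_eventuallyEq (Eventually.of_forall fun y => by ring)) hmin
  have hv0 := S.v_pos x t
  have hm := visc_ge_one hα hv0
  have h1 : S.θ x t / S.v x t * S.ux x t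
      - (visc α (S.v x t) * S.ux x t ^ 2 + S.w₁x x t ^ 2 + S.w₂x x t ^ 2
        + S.b₁x x t ^ 2 + S.b₂x x t ^ 2) / S.v x t ≤ S.θ x t ^ 2 / (4 * c) := by
    calc _ = (S.θ x t * S.ux x t
          - (visc α (S.v x t) * S.ux x t ^ 2 + S.w₁x x t ^ 2 + S.w₂x x t ^ 2
        + S.b₁x x t ^ 2 + S.b₂x x t ^ 2)) / S.v x t := by ring
      _ ≤ (S.θ x t ^ 2 / 4) / S.v x t := by
        refine div_le_div_of_nonneg_right ?_ hv0.le
        nlinarith [sq_nonneg (S.θ x t / 2 - S.ux x t), sq_nonneg (S.ux x t), sq_nonneg (S.w₁x x t),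
          sq_nonneg (S.w₂x x t), sq_nonneg (S.b₁x x t), sq_nonneg (S.b₂x x t)]
      _ ≤ (S.θ x t ^ 2 / 4) / c := div_le_div_of_nonneg_left (by positivity) hc hv
      _ = _ := by ring
  linarith

lemma θ_lower (hα : 0 ≤ α) (hT : 0 ≤ T) {c δ : ℝ} (hc : 0 < c) (hδ : 0 < δ) (hδ1 : δ ≤ 1)
    (hv : ∀ x, ∀ t ∈ Icc 0 T, c ≤ S.v x t) (hθ : ∀ x, δ ≤ S.θ x 0) :
    ∀ x, ∀ t ∈ Icc 0 T, (1 / δ + T / c)⁻¹ ≤ S.θ x t := by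
  set z : ℝ → ℝ → ℝ := fun x t => (S.θ x t)⁻¹ - t / c with hz
  have hzc : Continuous fun p : ℝ × ℝ => z p.1 p.2 := by
    simp only [hz]; fun_prop (disch := simp)
  suffices hmain : ∀ x, ∀ t ∈ Icc 0 T, z x t ≤ 1 / δ by
    intro x t ht
    rw [inv_le_comm₀ (by positivity) (S.θ_pos x t)]
    have h1 := hmain x t ht
    have h2 : t / c ≤ T / c := div_le_div_of_nonneg_right ht.2 hc.le
    simp only [hz] at h1
    linarith
  by_contra! hcon
  obtain ⟨x₀, t₀, ht₀, hlt⟩ := hcon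
  set z₀ := z x₀ t₀ with hz₀
  have h1δ : 1 ≤ 1 / δ := by rw [le_div_iff₀ hδ]; linarith
  have hz0 : 1 < z₀ := by linarith
  obtain ⟨R, hR⟩ := S.far (1 - z₀⁻¹) (by linarith [inv_lt_one_of_one_lt₀ hz0])
  have hfar : ∀ x, ∀ t ∈ Icc 0 T, R ≤ |x| → z x t < z₀ := by
    intro x t ht hx
    obtain ⟨-, -, h, -⟩ := hR x t hx
    have h1 : z₀⁻¹ < S.θ x t := by linarith [(abs_lt.1 h).1]
    have h2 := inv_lt_of_inv_lt₀ (by linarith) h1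
    have h3 : 0 ≤ t / c := div_nonneg ht.1 hc.le
    simp only [hz]
    linarith
  have hx₀ : |x₀| < R := by
    by_contra! h
    exact lt_irrefl _ (hfar x₀ t₀ ht₀ h)
  obtain ⟨⟨x₁, t₁⟩, hmem, hmax⟩ := ((isCompact_Icc (a := -R) (b := R)).prod
    (isCompact_Icc (a := 0) (b := T))).exists_isMaxOn
    ⟨(x₀, t₀), abs_le.1 hx₀.le, ht₀⟩ hzc.continuousOn
  have ht₁ : t₁ ∈ Icc 0 T := hmem.2
  have hz₁ : z₀ ≤ z x₁ t₁ := hmax (show (x₀, t₀) ∈ Icc (-R) R ×ˢ Icc 0 T from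
    ⟨abs_le.1 hx₀.le, ht₀⟩)
  have hglob : ∀ x, ∀ t ∈ Icc 0 T, z x t ≤ z x₁ t₁ := by
    intro x t ht
    rcases le_or_gt R |x| with h | h
    · exact (hfar x t ht h).le.trans hz₁
    · exact hmax (show (x, t) ∈ Icc (-R) R ×ˢ Icc 0 T from ⟨abs_le.1 h.le, ht⟩)
  have ht₁0 : 0 < t₁ := by
    rcases ht₁.1.eq_or_lt with h | h
    · exfalso
      have h2 : (S.θ x₁ 0)⁻¹ ≤ 1 / δ := by
        rw [one_div]; exact inv_anti₀ hδ (hθ x₁)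
      have h3 : z x₁ t₁ = (S.θ x₁ 0)⁻¹ := by simp [hz, ← h]
      linarith
    · exact h
  have hmin : ∀ y, S.θ x₁ t₁ ≤ S.θ y t₁ := by
    intro y
    have := hglob y t₁ ht₁
    simp only [hz] at this
    exact (inv_le_inv₀ (S.θ_pos _ _) (S.θ_pos _ _)).1 (by linarith)
  have hd : HasDerivWithinAt (z x₁) (-S.θt x₁ t₁ / S.θ x₁ t₁ ^ 2 - 1 / c) (Icc 0 T) t₁ :=
    ((S.dθt x₁ t₁ ht₁).fun_inv (S.θ_ne _ _)).sub ((hasDerivWithinAt_id _ _).div_const c)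
  have h1 := deriv_nonneg_of_max_Icc ht₁ ht₁0 hd (fun s hs => hglob x₁ s hs)
  have h2 := S.θt_ge_of_min hα hc (hv x₁ t₁ ht₁) hmin
  have hθ0 : 0 < S.θ x₁ t₁ ^ 2 := pow_pos (S.θ_pos _ _) 2
  have h3 : -S.θt x₁ t₁ / S.θ x₁ t₁ ^ 2 ≤ 1 / (4 * c) := by
    rw [div_le_iff₀ hθ0]
    have : 1 / (4 * c) * S.θ x₁ t₁ ^ 2 = S.θ x₁ t₁ ^ 2 / (4 * c) := by ring
    linarith
  have h4 : 1 / (4 * c) < 1 / c := one_div_lt_one_div_of_lt hc (by linarith)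
  linarith

end MHDFlow

/-- The convex function with derivative `1 - z ^ (-p)` vanishing at `1`. -/
def relEntPow (p z : ℝ) : ℝ := z - 1 - (z ^ (1 - p) - 1) / (1 - p)

lemma hasDerivAt_relEntPow {p z : ℝ} (hp : p < 1) (hz : 0 < z) :
    HasDerivAt (relEntPow p) (1 - z ^ (-p)) z := by
  refine (((hasDerivAt_id z).sub_const 1).sub (((Real.hasDerivAt_rpow_const
    (p := 1 - p) (Or.inl hz.ne')).sub_const 1).div_const (1 - p))).congr_deriv ?_
  have : 1 - p ≠ 0 := by linarith
  rw [show 1 - p - 1 = -p by ring]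
  field_simp

lemma relEntPow_nonneg {p z : ℝ} (hp0 : 0 ≤ p) (hp : p < 1) (hz : 0 < z) : 0 ≤ relEntPow p z := by
  have h := _root_.rpow_one_add_le_one_add_mul_self (s := z - 1) (by linarith)
    (by linarith : 0 ≤ 1 - p) (by linarith)
  rw [show 1 + (z - 1) = z by ring] at h
  unfold relEntPow
  rw [sub_nonneg, div_le_iff₀ (by linarith)]
  linarith

lemma relEntPow_le {p z : ℝ} (hp : p < 1) (hz : 0 < z) : relEntPow p z ≤ relEnt z := by
  have h := Real.log_le_sub_one_of_pos (Real.rpow_pos_of_pos hz (1 - p))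
  rw [Real.log_rpow hz] at h
  unfold relEntPow relEnt
  have : Real.log z ≤ (z ^ (1 - p) - 1) / (1 - p) := by
    rw [le_div_iff₀ (by linarith)]; linarith
  linarith

lemma sq_rpow_sub_one_le {p z : ℝ} (hp0 : 0 ≤ p) (hp : p < 1) (hz : 0 < z) :
    (z * z ^ (-p) - 1) ^ 2 / z ^ (-p) ≤ 4 * (1 + z * z ^ (-p)) * relEnt z := by
  have hR := relEnt_nonneg hz
  have hsq := sq_le_relEnt hz
  have h1p : z * z ^ (-p) = z ^ (1 - p) := by
    rw [show 1 - p = 1 + -p by ring, Real.rpow_add hz, Real.rpow_one]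
  have he : 0 < z ^ (-p) := Real.rpow_pos_of_pos hz _
  rcases le_total 1 z with h | h
  · have h1 : z ^ (-p) ≤ 1 := Real.rpow_le_one_of_one_le_of_nonpos h (by linarith)
    have h2 : 1 ≤ z * z ^ (-p) := by rw [h1p]; exact Real.one_le_rpow h (by linarith)
    generalize z ^ (-p) = e at *
    rw [div_le_iff₀ he]
    have h3 : (z * e - 1) ^ 2 ≤ (e * (z - 1)) ^ 2 :=
      pow_le_pow_left₀ (by linarith) (by linarith) 2
    have h4 : e ^ 2 * (z - 1) ^ 2 ≤ e ^ 2 * (2 * (1 + z) * relEnt z) :=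
      mul_le_mul_of_nonneg_left hsq (by positivity)
    have h5 : e * (e * (1 + z)) ≤ e * (1 + z * e) :=
      mul_le_mul_of_nonneg_left (by linarith) he.le
    have h6 := mul_le_mul_of_nonneg_right h5 hR
    have h7 : 0 ≤ e * (1 + z * e) * relEnt z := by positivity
    linarith
  · have h1 : 1 ≤ z ^ (-p) := Real.one_le_rpow_of_pos_of_le_one_of_nonpos hz h (by linarith)
    have h2 : z * z ^ (-p) ≤ 1 := by rw [h1p]; exact Real.rpow_le_one hz.le h (by linarith)
    generalize z ^ (-p) = e at *
    have h3 : z ≤ z * e := le_mul_of_one_le_right hz.le h1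
    have h4 : (z * e - 1) ^ 2 / e ≤ (z * e - 1) ^ 2 := div_le_self (sq_nonneg _) h1
    have h5 : (z * e - 1) ^ 2 ≤ (z - 1) ^ 2 := by
      rw [← neg_sq (z * e - 1), ← neg_sq (z - 1)]
      exact pow_le_pow_left₀ (by linarith) (by linarith) 2
    have h6 := mul_le_mul_of_nonneg_right (by linarith : 2 * (1 + z) ≤ 4 * (1 + z * e)) hR
    linarith

lemma rpow_le_add_mul_rpow {p β A z : ℝ} (hp : p < 1) (hβ : 0 < β) (hA : 0 < A) (hz : 0 < z) :
    z * z ^ (-p) ≤ A ^ (1 - p) + A ^ (-β) * z ^ (1 + β - p) := by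
  have h1p : z * z ^ (-p) = z ^ (1 - p) := by
    rw [show 1 - p = 1 + -p by ring, Real.rpow_add hz, Real.rpow_one]
  have hA1 := Real.rpow_pos_of_pos hA (1 - p)
  have hA2 := Real.rpow_pos_of_pos hA (-β)
  have hz1 := Real.rpow_pos_of_pos hz (1 + β - p)
  have hz2 := Real.rpow_pos_of_pos hz (1 - p)
  rw [h1p]
  rcases le_total z A with h | h
  · have := Real.rpow_le_rpow hz.le h (by linarith : 0 ≤ 1 - p)
    have : 0 < A ^ (-β) * z ^ (1 + β - p) := by positivity
    linarith
  · have h1 := Real.rpow_le_rpow_of_nonpos hA h (by linarith : -β ≤ 0)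
    have h2 : z ^ (1 - p) = z ^ (-β) * z ^ (1 + β - p) := by
      rw [← Real.rpow_add hz]; congr 1; ring
    rw [h2]
    have := mul_le_mul_of_nonneg_right h1 hz1.le
    linarith

namespace MHDFlow

variable {α β T : ℝ} (S : MHDFlow α β T)

/-- Localized dissipation rate. -/
def dissInt (p L t : ℝ) : ℝ := ∫ x in (-L)..L, bump L x * S.diss p x t

@[fun_prop]
lemma continuous_dissInt (p L : ℝ) : Continuous (S.dissInt p L) := by
  unfold dissInt
  exact intervalIntegral.continuous_parametric_intervalIntegral_of_continuous'
    (f := fun t x => bump L x * S.diss p x t) (by unfold Function.uncurry; fun_prop) _ _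

variable {S}

lemma dissInt_nonneg (hα : 0 ≤ α) {p : ℝ} (hp : 0 ≤ p) {L : ℝ} (hL : 0 ≤ L) (t : ℝ) :
    0 ≤ S.dissInt p L t :=
  intervalIntegral.integral_nonneg (by linarith) fun x _ =>
    mul_nonneg (bump_nonneg _ _) (S.diss_nonneg hα hp x t)

lemma cell_diss_le (hα : 0 ≤ α) {p : ℝ} (hp : 0 ≤ p) {L x : ℝ} (hL : 0 < L)
    (hx : |x| ≤ L / 2 - 1) (t : ℝ) :
    ∫ y in x..(x + 1), S.diss p y t ≤ 2 * S.dissInt p L t := by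
  rw [abs_le] at hx
  unfold dissInt
  rw [← intervalIntegral.integral_const_mul]
  calc ∫ y in x..(x + 1), S.diss p y t
      ≤ ∫ y in x..(x + 1), 2 * (bump L y * S.diss p y t) := by
        refine integral_mono_cont (by linarith) (by fun_prop) (by fun_prop) fun y hy => ?_
        have h1 : |y| ≤ L / 2 := abs_le.2 ⟨by linarith [hy.1], by linarith [hy.2]⟩
        nlinarith [half_le_bump hL h1, S.diss_nonneg hα hp y t]
    _ ≤ _ := by
        refine integral_mono_subinterval (by linarith) (by linarith) (by linarith) (by fun_prop)
          fun y _ => ?_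
        exact mul_nonneg zero_le_two (mul_nonneg (bump_nonneg _ _) (S.diss_nonneg hα hp y t))

lemma θx_sq_le_diss (hα : 0 ≤ α) {p : ℝ} (hp : 0 < p) (x t : ℝ) :
    S.θ x t ^ (β - p - 1) * S.θx x t ^ 2 / S.v x t ≤ S.diss p x t / p := by
  have h1 := S.v_pos x t
  have h2 := S.θ_pos x t
  have h3 := visc_ge_one hα h1
  have h4 : S.θ x t ^ (β - p - 1) = S.θ x t ^ (-p) * S.θ x t ^ β / S.θ x t := by
    rw [Real.rpow_sub_one h2.ne', ← Real.rpow_add h2]; congr 2; ring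
  rw [le_div_iff₀ hp, h4]
  unfold diss
  have h5 := Real.rpow_pos_of_pos h2 (-p)
  have h6 := Real.rpow_pos_of_pos h2 β
  have : 0 ≤ S.θ x t ^ (-p) * (visc α (S.v x t) * S.ux x t ^ 2
    + S.w₁x x t ^ 2 + S.w₂x x t ^ 2 + S.b₁x x t ^ 2 + S.b₂x x t ^ 2) / S.v x t := by positivity
  calc _ = S.θ x t ^ (-p) * (p * S.θ x t ^ β * S.θx x t ^ 2 / S.θ x t) / S.v x t := by
        field_simp
    _ ≤ S.θ x t ^ (-p) * (p * S.θ x t ^ β * S.θx x t ^ 2 / S.θ x t) / S.v x t + _ :=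
        le_add_of_nonneg_right this
    _ = _ := by ring

lemma ux_sq_le_diss (hα : 0 ≤ α) {p : ℝ} (hp : 0 < p) (x t : ℝ) :
    S.θ x t ^ (-p) * S.ux x t ^ 2 / S.v x t ≤ S.diss p x t := by
  have h1 := S.v_pos x t
  have h2 := S.θ_pos x t
  have h3 := visc_ge_one hα h1
  unfold diss
  have h5 := Real.rpow_pos_of_pos h2 (-p)
  have h6 := Real.rpow_pos_of_pos h2 β
  refine div_le_div_of_nonneg_right (mul_le_mul_of_nonneg_left ?_ h5.le) h1.le
  have : 0 ≤ p * S.θ x t ^ β * S.θx x t ^ 2 / S.θ x t := by positivity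
  nlinarith [sq_nonneg (S.ux x t), sq_nonneg (S.w₁x x t), sq_nonneg (S.w₂x x t),
    sq_nonneg (S.b₁x x t), sq_nonneg (S.b₂x x t)]

lemma bx_sq_le_diss (hα : 0 ≤ α) {p : ℝ} (hp : 0 < p) (x t : ℝ) :
    S.θ x t ^ (-p) * (S.b₁x x t ^ 2 + S.b₂x x t ^ 2) / S.v x t ≤ S.diss p x t := by
  have h1 := S.v_pos x t
  have h2 := S.θ_pos x t
  have h3 := visc_ge_one hα h1
  unfold diss
  have h5 := Real.rpow_pos_of_pos h2 (-p)
  have h6 := Real.rpow_pos_of_pos h2 β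
  refine div_le_div_of_nonneg_right (mul_le_mul_of_nonneg_left ?_ h5.le) h1.le
  have : 0 ≤ p * S.θ x t ^ β * S.θx x t ^ 2 / S.θ x t := by positivity
  nlinarith [sq_nonneg (S.ux x t), sq_nonneg (S.w₁x x t), sq_nonneg (S.w₂x x t),
    sq_nonneg (S.b₁x x t), sq_nonneg (S.b₂x x t)]

variable {K δ : ℝ}

lemma InitBound.cell_θ_bound (hS : S.InitBound K δ) (hα : 0 ≤ α) (hK : 0 < K) (hδ : 0 < δ)
    {p q N : ℝ} (hp : 0 < p) (hq : q = (1 + β - p) / 2) (hq0 : 0 < q)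
    (hN : N = 2 * energyConst K δ T + 2) (hN0 : 0 < N)
    {t : ℝ} (ht : t ∈ Icc 0 T) (x : ℝ) :
    S.θ x t ^ (1 + β - p) ≤ 2 * N ^ (1 + β - p)
      + 2 * q ^ 2 / p * N * ∫ y in x..(x + 1), S.diss p y t := by
  have hx1 : x ≤ x + 1 := by linarith
  obtain ⟨y, hy, hyle⟩ := exists_le_unit_integral (f := fun y => S.θ y t) (by fun_prop) x
  have hyN : S.θ y t ≤ N := by
    refine hyle.trans ?_
    calc ∫ x in x..(x + 1), S.θ x t ≤ ∫ x in x..(x + 1), (2 * S.energy relEnt x t + 2) := by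
          refine integral_mono_cont hx1 (by fun_prop) (by fun_prop) fun z _ => ?_
          have h1 := S.relEnt_θ_add_le_energy z t
          have h2 := le_two_mul_relEnt (S.θ_pos z t)
          have h3 := S.v_pos z t
          have h4 : 0 ≤ S.v z t * (S.b₁ z t ^ 2 + S.b₂ z t ^ 2) := by positivity
          linarith
      _ ≤ N := by
          rw [intervalIntegral.integral_add (Continuous.intervalIntegrable (by fun_prop) _ _)
            (by simp), intervalIntegral.integral_const_mul, hN]
          have := hS.energy_bound hα hK hδ ht hx1
          simpa using this
  have hd : ∀ z, HasDerivAt (fun z => S.θ z t ^ q) (S.θx z t * q * S.θ z t ^ (q - 1)) z :=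
    fun z => (S.dθx z t).rpow_const (Or.inl (S.θ_ne _ _))
  have hθc : ∀ r : ℝ, Continuous fun z => S.θ z t ^ r := fun r =>
    Continuous.rpow_const (f := fun z => S.θ z t) (p := r) (by fun_prop) fun z => Or.inl (S.θ_ne z t)
  have hc1 := hθc (q - 1)
  have hc2 := hθc (β - p - 1)
  have h1 := le_add_integral_abs_deriv hd (by fun_prop) hy
  have h2 := sq_integral_mul_le (f := fun z => |S.θx z t * q * S.θ z t ^ (q - 1)| / √(S.v z t))
    (g := fun z => √(S.v z t)) hx1 (Continuous.div (by fun_prop) (by fun_prop)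
      fun z => (Real.sqrt_pos.2 (S.v_pos z t)).ne') (by fun_prop)
  have h3 : ∀ z, |S.θx z t * q * S.θ z t ^ (q - 1)| / √(S.v z t) * √(S.v z t)
      = |S.θx z t * q * S.θ z t ^ (q - 1)| := fun z =>
    div_mul_cancel₀ _ (Real.sqrt_pos.2 (S.v_pos z t)).ne'
  have h4 : ∀ z, √(S.v z t) ^ 2 = S.v z t := fun z => Real.sq_sqrt (S.v_pos z t).le
  have h5 : ∀ z, (|S.θx z t * q * S.θ z t ^ (q - 1)| / √(S.v z t)) ^ 2
      = q ^ 2 * (S.θ z t ^ (β - p - 1) * S.θx z t ^ 2 / S.v z t) := by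
    intro z
    have : S.θ z t ^ (β - p - 1) = (S.θ z t ^ (q - 1)) ^ 2 := by
      rw [sq, ← Real.rpow_add (S.θ_pos z t)]; congr 1; rw [hq]; ring
    rw [div_pow, h4, sq_abs, this]; ring
  simp only [h3, h4, h5] at h2
  have h6 : ∫ z in x..(x + 1), q ^ 2 * (S.θ z t ^ (β - p - 1) * S.θx z t ^ 2 / S.v z t)
      ≤ q ^ 2 / p * ∫ z in x..(x + 1), S.diss p z t := by
    rw [← intervalIntegral.integral_const_mul]
    refine integral_mono_cont hx1 (by fun_prop (disch := simp)) (by fun_prop) fun z _ => ?_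
    have := mul_le_mul_of_nonneg_left (S.θx_sq_le_diss hα hp z t) (sq_nonneg q)
    refine this.trans (le_of_eq (by ring))
  have h7 := hS.integral_v_le hα hK hδ ht x
  rw [← hN] at h7
  have h8 : 0 ≤ ∫ z in x..(x + 1), S.diss p z t :=
    intervalIntegral.integral_nonneg hx1 fun z _ => S.diss_nonneg hα hp.le z t
  have h9 : 0 ≤ ∫ z in x..(x + 1), S.v z t :=
    intervalIntegral.integral_nonneg hx1 fun z _ => (S.v_pos z t).le
  have h10 := h2.trans (mul_le_mul h6 h7 h9 (by positivity))
  have h11 : S.θ y t ^ q ≤ N ^ q := Real.rpow_le_rpow (S.θ_pos _ _).le hyN hq0.le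
  have hpow : ∀ z : ℝ, 0 < z → z ^ (1 + β - p) = (z ^ q) ^ 2 := by
    intro z hz
    rw [sq, ← Real.rpow_add hz]; congr 1; rw [hq]; ring
  rw [hpow _ (S.θ_pos x t), hpow _ hN0]
  have h12 : 0 < S.θ x t ^ q := Real.rpow_pos_of_pos (S.θ_pos x t) _
  have h13 := pow_le_pow_left₀ h12.le (h1.trans (add_le_add_left h11 _)) 2
  refine h13.trans ?_
  have : 2 * q ^ 2 / p * N * ∫ y in x..(x + 1), S.diss p y t
      = 2 * (q ^ 2 / p * (∫ z in x..(x + 1), S.diss p z t) * N) := by ring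
  rw [this]
  nlinarith [sq_nonneg (N ^ q - ∫ z in x..(x + 1), |S.θx z t * q * S.θ z t ^ (q - 1)|)]

end MHDFlow

namespace MHDFlow

variable {α β T : ℝ} {S : MHDFlow α β T} {K δ : ℝ}

lemma source_le (hα : 0 ≤ α) {p c : ℝ} (hp : 0 < p) (hp1 : p < 1) (hc : 0 < c) {x t : ℝ}
    (hv : c ≤ S.v x t) : S.source p x t
      ≤ S.diss p x t / 4 + 4 / c * (1 + S.θ x t * S.θ x t ^ (-p)) * relEnt (S.θ x t) := by
  have h0 := S.v_pos x t
  have hθ := S.θ_pos x t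
  have h1 := S.ux_sq_le_diss hα hp x t
  have h2 := sq_rpow_sub_one_le hp.le hp1 hθ
  have he : 0 < S.θ x t ^ (-p) := Real.rpow_pos_of_pos hθ _
  unfold source
  generalize S.θ x t ^ (-p) = e at *
  have h3 : (S.θ x t * e - 1) * S.ux x t / S.v x t
      ≤ e * S.ux x t ^ 2 / S.v x t / 4 + (S.θ x t * e - 1) ^ 2 / e / S.v x t := by
    have h5 : e * S.ux x t ^ 2 / S.v x t / 4 + (S.θ x t * e - 1) ^ 2 / e / S.v x t
        - (S.θ x t * e - 1) * S.ux x t / S.v x t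
        = (e * S.ux x t / 2 - (S.θ x t * e - 1)) ^ 2 / (e * S.v x t) := by
      field_simp; ring
    have : 0 ≤ (e * S.ux x t / 2 - (S.θ x t * e - 1)) ^ 2 / (e * S.v x t) := by positivity
    linarith
  have h4 : (S.θ x t * e - 1) ^ 2 / e / S.v x t
      ≤ 4 / c * (1 + S.θ x t * e) * relEnt (S.θ x t) := by
    calc _ ≤ (S.θ x t * e - 1) ^ 2 / e / c :=
          div_le_div_of_nonneg_left (by positivity) hc hv
      _ ≤ 4 * (1 + S.θ x t * e) * relEnt (S.θ x t) / c := div_le_div_of_nonneg_right h2 hc.le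
      _ = _ := by ring
  linarith

lemma InitBound.integral_relEnt_θ_le (hS : S.InitBound K δ) (hα : 0 ≤ α) (hK : 0 < K)
    (hδ : 0 < δ) {t : ℝ} (ht : t ∈ Icc 0 T) {a b : ℝ} (hab : a ≤ b) :
    ∫ x in a..b, relEnt (S.θ x t) ≤ energyConst K δ T := by
  refine le_trans (integral_mono_cont hab ?_ (by fun_prop) fun x _ => ?_)
    (hS.energy_bound hα hK hδ ht hab)
  · unfold relEnt; fun_prop (disch := simp)
  · have h1 := S.relEnt_θ_add_le_energy x t
    have h3 := S.v_pos x t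
    have h4 : 0 ≤ S.v x t * (S.b₁ x t ^ 2 + S.b₂ x t ^ 2) := by positivity
    linarith

/-- Sup bound for the temperature by the dissipation rate, and smallness outside of the region
where the weight is at least one half. -/
lemma exists_θ_bound (hα : 0 ≤ α) (hβ : 0 < β) (hT : 0 ≤ T) (hK : 0 < K) (hδ : 0 < δ)
    {p : ℝ} (hp : 0 < p) (hp1 : p < 1) :
    ∃ C : ℝ, 1 ≤ C ∧ ∀ S : MHDFlow α β T, S.InitBound K δ → ∃ L₀ : ℝ, 1 ≤ L₀ ∧ ∀ L ≥ L₀,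
      (∀ x, ∀ t ∈ Icc 0 T, S.θ x t ^ (1 + β - p) ≤ C * (1 + S.dissInt p L t)) ∧
      ∀ x t, |x| ≤ L / 2 - 1 ∨ (S.b₁ x t ^ 2 + S.b₂ x t ^ 2 ≤ 1) := by
  have hE := energyConst_pos hK hδ hT
  set N := 2 * energyConst K δ T + 2 with hN
  set q := (1 + β - p) / 2 with hq
  have hN0 : 0 < N := by positivity
  have hq0 : 0 < q := by rw [hq]; linarith
  have hr : 0 < N ^ (1 + β - p) := Real.rpow_pos_of_pos hN0 _
  refine ⟨2 * N ^ (1 + β - p) + 4 * q ^ 2 / p * N + 1, ?_, fun S hS => ?_⟩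
  · have : 0 < 4 * q ^ 2 / p * N := by positivity
    linarith
  obtain ⟨R, hR⟩ := S.far (1 / 2) (by norm_num)
  refine ⟨max 1 (2 * (|R| + 1)), le_max_left _ _, fun L hL => ?_⟩
  have hL1 : 1 ≤ L := (le_max_left _ _).trans hL
  have hL2 : 2 * (|R| + 1) ≤ L := (le_max_right _ _).trans hL
  have hRL : R ≤ L / 2 - 1 := by linarith [le_abs_self R]
  refine ⟨fun x t ht => ?_, fun x t => ?_⟩
  · have hV := S.dissInt_nonneg hα hp.le (by linarith : 0 ≤ L) t
    rcases le_total |x| (L / 2 - 1) with h | h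
    · have h1 := hS.cell_θ_bound hα hK hδ hp hq hq0 hN hN0 ht x
      have h2 := mul_le_mul_of_nonneg_left (S.cell_diss_le hα hp.le (by linarith) h t)
        (by positivity : 0 ≤ 2 * q ^ 2 / p * N)
      have h3 : 0 ≤ 4 * q ^ 2 / p * N := by positivity
      have h4 : 0 ≤ 2 * N ^ (1 + β - p) * S.dissInt p L t := by positivity
      calc _ ≤ _ := h1
        _ ≤ 2 * N ^ (1 + β - p) + 2 * q ^ 2 / p * N * (2 * S.dissInt p L t) := by linarith
        _ ≤ 2 * N ^ (1 + β - p) + 4 * q ^ 2 / p * N * S.dissInt p L t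
            + (2 * N ^ (1 + β - p) * S.dissInt p L t + 4 * q ^ 2 / p * N + 1
            + S.dissInt p L t) := by
          have : 2 * q ^ 2 / p * N * (2 * S.dissInt p L t)
            = 4 * q ^ 2 / p * N * S.dissInt p L t := by ring
          linarith
        _ = _ := by ring
    · obtain ⟨-, -, h1, -⟩ := hR x t (hRL.trans h)
      have h2 : S.θ x t ≤ N := by linarith [(abs_lt.1 h1).2]
      have h3 := Real.rpow_le_rpow (S.θ_pos x t).le h2 (by linarith : 0 ≤ 1 + β - p)
      have h4 : 0 ≤ 4 * q ^ 2 / p * N := by positivity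
      have h5 : 2 * N ^ (1 + β - p) + 4 * q ^ 2 / p * N + 1
          ≤ (2 * N ^ (1 + β - p) + 4 * q ^ 2 / p * N + 1) * (1 + S.dissInt p L t) :=
        le_mul_of_one_le_right (by positivity) (by linarith)
      linarith
  · rcases le_total |x| (L / 2 - 1) with h | h
    · exact Or.inl h
    · right
      obtain ⟨-, -, -, -, -, h1, h2⟩ := hR x t (hRL.trans h)
      rw [abs_lt] at h1 h2
      nlinarith

/-- Time-integrated bound for the dissipation rate, uniform in the localization. -/
lemma exists_dissipation_bound (hα : 0 ≤ α) (hβ : 0 < β) (hT : 0 ≤ T) (hK : 0 < K) (hδ : 0 < δ)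
    {p : ℝ} (hp : 0 < p) (hp1 : p < 1) :
    ∃ C : ℝ, 1 ≤ C ∧ ∀ S : MHDFlow α β T, S.InitBound K δ → ∃ L₀ : ℝ, 1 ≤ L₀ ∧ ∀ L ≥ L₀,
      (∫ t in 0..T, S.dissInt p L t) ≤ C ∧
      (∀ x, ∀ t ∈ Icc 0 T, S.θ x t ^ (1 + β - p) ≤ C * (1 + S.dissInt p L t)) ∧
      ∀ x t, |x| ≤ L / 2 - 1 ∨ (S.b₁ x t ^ 2 + S.b₂ x t ^ 2 ≤ 1) := by
  obtain ⟨c, hc, Cv, hCv, hv⟩ := exists_v_bounds (α := α) (β := β) hα hT hK hδ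
  obtain ⟨C₁, hC₁, hθ⟩ := exists_θ_bound (α := α) (β := β) hα hβ hT hK hδ hp hp1
  have hE := energyConst_pos hK hδ hT
  set E := energyConst K δ T with hE'
  set A := (32 * E * C₁ / c) ^ (1 / β) with hA
  have hB : 0 < 32 * E * C₁ / c := by positivity
  have hA0 : 0 < A := Real.rpow_pos_of_pos hB _
  have hAβ : A ^ (-β) = c / (32 * E * C₁) := by
    rw [hA, ← Real.rpow_mul hB.le, show 1 / β * -β = -1 by field_simp, Real.rpow_neg_one, inv_div]
  set D := 4 * E / c * (1 + A ^ (1 - p)) + 1 / 8 with hD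
  have hAp : 0 < A ^ (1 - p) := Real.rpow_pos_of_pos hA0 _
  have hD0 : 0 < D := by positivity
  set E₀ := (1 + 2 * K + 1 / δ) * K ^ 2 with hE₀
  have hE₀0 : 0 < E₀ := by positivity
  refine ⟨C₁ + 8 * (E₀ + (1 + D) * T), by
    have : 0 ≤ 8 * (E₀ + (1 + D) * T) := by positivity
    linarith, fun S hS => ?_⟩
  obtain ⟨L₁, hL₁, h1⟩ := hθ S hS
  obtain ⟨L₂, hL₂, h2⟩ := S.local_energy hα hp fun z hz => hasDerivAt_relEntPow hp1 hz
  refine ⟨max L₁ L₂, hL₁.trans (le_max_left _ _), fun L hL => ?_⟩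
  obtain ⟨h3, h4⟩ := h1 L ((le_max_left _ _).trans hL)
  have h5 := h2 L ((le_max_right _ _).trans hL) T ⟨hT, le_rfl⟩
  have hLpos : 0 < L := by linarith [hL₁.trans ((le_max_left L₁ L₂).trans hL)]
  have hV0 : ∀ t, 0 ≤ S.dissInt p L t := S.dissInt_nonneg hα hp.le hLpos.le
  refine ⟨?_, fun x t ht => ?_, h4⟩
  swap
  · refine (h3 x t ht).trans (mul_le_mul_of_nonneg_right ?_ (by linarith [hV0 t]))
    have : 0 ≤ 8 * (E₀ + (1 + D) * T) := by positivity
    linarith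
  have hsrc : ∀ t ∈ Icc 0 T, ∫ x in (-L)..L, bump L x * S.source p x t
      ≤ 3 / 8 * S.dissInt p L t + D := by
    intro t ht
    set G := 4 / c * (1 + A ^ (1 - p) + A ^ (-β) * (C₁ * (1 + S.dissInt p L t))) with hG
    have hG0 : 0 ≤ G := by
      have := hV0 t
      have := Real.rpow_pos_of_pos hA0 (-β)
      positivity
    have hrc : Continuous fun x => relEnt (S.θ x t) := by
      unfold relEnt; fun_prop (disch := simp)
    calc ∫ x in (-L)..L, bump L x * S.source p x t
        ≤ ∫ x in (-L)..L, (1 / 4 * (bump L x * S.diss p x t) + G * relEnt (S.θ x t)) := by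
          refine integral_mono_cont (by linarith) (by fun_prop) (by fun_prop) fun x hx => ?_
          have e1 := S.source_le hα hp hp1 hc (hv S hS x t ht).1
          have e2 := rpow_le_add_mul_rpow hp1 hβ hA0 (S.θ_pos x t)
          have e3 := mul_le_mul_of_nonneg_left (h3 x t ht) (Real.rpow_pos_of_pos hA0 (-β)).le
          have hR := relEnt_nonneg (S.θ_pos x t)
          have e4 : 4 / c * (1 + S.θ x t * S.θ x t ^ (-p)) ≤ G := by
            rw [hG]
            exact mul_le_mul_of_nonneg_left (by linarith) (by positivity)
          have e5 := mul_le_mul_of_nonneg_right e4 hR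
          have e6 := mul_le_mul_of_nonneg_left (e1.trans (add_le_add_right e5 _))
            (bump_nonneg L x)
          have e7 := mul_le_mul_of_nonneg_right (bump_le_one hLpos hx) (mul_nonneg hG0 hR)
          linarith
      _ = 1 / 4 * S.dissInt p L t + G * ∫ x in (-L)..L, relEnt (S.θ x t) := by
          rw [intervalIntegral.integral_add, intervalIntegral.integral_const_mul,
            intervalIntegral.integral_const_mul]
          · rfl
          all_goals exact Continuous.intervalIntegrable (by fun_prop) _ _
      _ ≤ 1 / 4 * S.dissInt p L t + G * E := by
          have := hS.integral_relEnt_θ_le hα hK hδ ht (by linarith : -L ≤ L)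
          have := mul_le_mul_of_nonneg_left this hG0
          linarith
      _ = _ := by
          rw [hG, hAβ, hD]
          field_simp
          ring
  have h6 := hS.bump_energy_le hK hδ (H := relEntPow p)
    (fun z hz => (hasDerivAt_relEntPow hp1 hz).continuousAt)
    (fun z hz => relEntPow_nonneg hp.le hp1 hz) (fun z hz => relEntPow_le hp1 hz) hLpos
  have h7 : 0 ≤ ∫ x in (-L)..L, bump L x * S.energy (relEntPow p) x T :=
    intervalIntegral.integral_nonneg (by linarith) fun x _ =>
      mul_nonneg (bump_nonneg _ _)
        (S.energy_nonneg (fun z hz => relEntPow_nonneg hp.le hp1 hz) x T)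
  have h8 : ∫ s in 0..T, ∫ x in (-L)..L, bump L x * (S.diss p x s / 2)
      = 1 / 2 * ∫ s in 0..T, S.dissInt p L s := by
    rw [← intervalIntegral.integral_const_mul]
    congr 1; ext s
    unfold dissInt
    rw [← intervalIntegral.integral_const_mul]
    congr 1; ext x; ring
  have h9 : ∫ s in 0..T, (1 + ∫ x in (-L)..L, bump L x * S.source p x s)
      ≤ ∫ s in 0..T, ((1 + D) + 3 / 8 * S.dissInt p L s) := by
    refine integral_mono_cont hT ?_ (by fun_prop) fun s hs => by linarith [hsrc s hs]
    exact continuous_const.add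
      (intervalIntegral.continuous_parametric_intervalIntegral_of_continuous'
      (f := fun t x => bump L x * S.source p x t) (by unfold Function.uncurry; fun_prop) _ _)
  have h10 : ∫ s in 0..T, ((1 + D) + 3 / 8 * S.dissInt p L s)
      = T * (1 + D) + 3 / 8 * ∫ s in 0..T, S.dissInt p L s := by
    rw [intervalIntegral.integral_add (by simp) (Continuous.intervalIntegrable (by fun_prop) _ _),
      intervalIntegral.integral_const_mul, intervalIntegral.integral_const, smul_eq_mul, sub_zero]
  rw [h10] at h9
  rw [h8] at h5
  linarith

end MHDFlow

lemma exists_intermediate_power {p r V : ℝ} (hp : 0 ≤ p) (hp3 : 3 * p ≤ 1) (hr : 1 ≤ r)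
    (hV : 1 ≤ V) :
    ∃ m : ℝ, 1 ≤ m ∧ m ^ 3 ≤ V ∧ ∀ z > 0, z ^ r ≤ V → z ^ p ≤ m ∧ z ≤ V := by
  have hV0 : 0 < V := by linarith
  have hr0 : 0 < r := by linarith
  refine ⟨V ^ (p / r), Real.one_le_rpow hV (by positivity), ?_, fun z hz h => ⟨?_, ?_⟩⟩
  · rw [← Real.rpow_natCast, ← Real.rpow_mul hV0.le]
    conv_rhs => rw [← Real.rpow_one V]
    refine Real.rpow_le_rpow_of_exponent_le hV ?_
    rw [div_mul_eq_mul_div, div_le_one hr0]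
    push_cast; linarith
  · calc z ^ p = (z ^ r) ^ (p / r) := by
          rw [← Real.rpow_mul hz.le]; congr 1; field_simp
      _ ≤ _ := Real.rpow_le_rpow (by positivity) h (by positivity)
  · rcases le_total z 1 with h1 | h1
    · linarith
    · calc z = z ^ (1 : ℝ) := (Real.rpow_one z).symm
        _ ≤ z ^ r := Real.rpow_le_rpow_of_exponent_le h1 hr
        _ ≤ V := h

lemma rpow_le_of_exponent_le_one {c s z : ℝ} (hc : 0 < c) (hs : s ≤ 1) (hz : c ≤ z) :
    z ^ s ≤ z + 1 + c ^ s := by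
  have hz0 : 0 < z := hc.trans_le hz
  have hcs : 0 < c ^ s := Real.rpow_pos_of_pos hc s
  rcases le_total 1 z with h | h
  · have := Real.rpow_le_rpow_of_exponent_le h hs
    rw [Real.rpow_one] at this
    linarith
  · rcases le_total 0 s with h1 | h1
    · have := Real.rpow_le_one hz0.le h h1
      linarith
    · have := Real.rpow_le_rpow_of_nonpos hc hz h1
      linarith

namespace MHDFlow

variable {α β T : ℝ} {S : MHDFlow α β T} {K δ : ℝ}

/-- Weighted sup bound for the magnetic field in terms of the dissipation on a unit interval. -/
lemma InitBound.cell_b_bound (hS : S.InitBound K δ) (hα : 0 ≤ α) (hK : 0 < K)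
    (hδ : 0 < δ) {p c m : ℝ} (hp : 0 < p) (hc : 0 < c) (hm : 1 ≤ m) {x t : ℝ}
    (ht : t ∈ Icc 0 T) (hv : ∀ y, c ≤ S.v y t) (hθ : ∀ y, S.θ y t ^ p ≤ m) :
    m * (S.b₁ x t ^ 2 + S.b₂ x t ^ 2)
      ≤ m * (2 * energyConst K δ T / c) + (∫ y in x..(x + 1), S.diss p y t)
        + m ^ 3 * (2 * energyConst K δ T) := by
  set E := energyConst K δ T
  have hm0 : 0 < m := by linarith
  have hvb : ∫ y in x..(x + 1), S.v y t * (S.b₁ y t ^ 2 + S.b₂ y t ^ 2) ≤ 2 * E := by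
    calc _ ≤ ∫ y in x..(x + 1), 2 * S.energy relEnt y t := by
          refine integral_mono_cont (by linarith) (by fun_prop) (by fun_prop) fun y _ => ?_
          have h1 := S.relEnt_θ_add_le_energy y t
          have h2 := relEnt_nonneg (S.θ_pos y t)
          linarith
      _ = 2 * ∫ y in x..(x + 1), S.energy relEnt y t := intervalIntegral.integral_const_mul _ _
      _ ≤ _ := by
          have := hS.energy_bound hα hK hδ ht (by linarith : x ≤ x + 1)
          linarith
  obtain ⟨y, hy, hyb⟩ := exists_le_unit_integral
    (f := fun y => S.v y t * (S.b₁ y t ^ 2 + S.b₂ y t ^ 2)) (by fun_prop) x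
  have hb : S.b₁ y t ^ 2 + S.b₂ y t ^ 2 ≤ 2 * E / c := by
    rw [le_div_iff₀ hc]
    have := mul_le_mul_of_nonneg_right (hv y) (by positivity : 0 ≤ S.b₁ y t ^ 2 + S.b₂ y t ^ 2)
    linarith
  have h1 := le_add_integral_abs_deriv (f := fun y => S.b₁ y t ^ 2 + S.b₂ y t ^ 2)
    (f' := fun y => 2 * (S.b₁ y t * S.b₁x y t + S.b₂ y t * S.b₂x y t))
    (fun z => ((((S.db₁x z t).fun_pow 2).fun_add ((S.db₂x z t).fun_pow 2))).congr_deriv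
      (by push_cast; ring)) (by fun_prop) hy
  have h2 : m * ∫ y in x..(x + 1), |2 * (S.b₁ y t * S.b₁x y t + S.b₂ y t * S.b₂x y t)|
      ≤ (∫ y in x..(x + 1), S.diss p y t) + m ^ 3 * (2 * E) := by
    calc _ = ∫ y in x..(x + 1), m * |2 * (S.b₁ y t * S.b₁x y t + S.b₂ y t * S.b₂x y t)| :=
          (intervalIntegral.integral_const_mul _ _).symm
      _ ≤ ∫ y in x..(x + 1), (S.diss p y t
            + m ^ 3 * (S.v y t * (S.b₁ y t ^ 2 + S.b₂ y t ^ 2))) := by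
          refine integral_mono_cont (by linarith) (by fun_prop) (by fun_prop) fun z _ => ?_
          have e1 := S.bx_sq_le_diss hα hp z t
          have e2 := hθ z
          have e3 := S.v_pos z t
          rw [Real.rpow_neg (S.θ_pos z t).le] at e1
          have e4 : 0 < S.θ z t ^ p := Real.rpow_pos_of_pos (S.θ_pos z t) p
          generalize S.θ z t ^ p = e at *
          have key : ∀ X Y : ℝ, |m * (2 * (S.b₁ z t * X + S.b₂ z t * Y))|
              ≤ e⁻¹ * (X ^ 2 + Y ^ 2) / S.v z t
                + e * m ^ 2 * (S.v z t * (S.b₁ z t ^ 2 + S.b₂ z t ^ 2)) := by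
            intro X Y
            have d1 : e⁻¹ * (X ^ 2 + Y ^ 2) / S.v z t
                + e * m ^ 2 * (S.v z t * (S.b₁ z t ^ 2 + S.b₂ z t ^ 2))
                - m * (2 * (S.b₁ z t * X + S.b₂ z t * Y))
                = ((X - e * m * S.v z t * S.b₁ z t) ^ 2
                  + (Y - e * m * S.v z t * S.b₂ z t) ^ 2) / (e * S.v z t) := by
              field_simp; ring
            have d2 : e⁻¹ * (X ^ 2 + Y ^ 2) / S.v z t
                + e * m ^ 2 * (S.v z t * (S.b₁ z t ^ 2 + S.b₂ z t ^ 2))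
                + m * (2 * (S.b₁ z t * X + S.b₂ z t * Y))
                = ((X + e * m * S.v z t * S.b₁ z t) ^ 2
                  + (Y + e * m * S.v z t * S.b₂ z t) ^ 2) / (e * S.v z t) := by
              field_simp; ring
            have d3 : 0 ≤ ((X - e * m * S.v z t * S.b₁ z t) ^ 2
                  + (Y - e * m * S.v z t * S.b₂ z t) ^ 2) / (e * S.v z t) := by positivity
            have d4 : 0 ≤ ((X + e * m * S.v z t * S.b₁ z t) ^ 2
                  + (Y + e * m * S.v z t * S.b₂ z t) ^ 2) / (e * S.v z t) := by positivity
            rw [abs_le]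
            constructor <;> linarith
          have e5 := key (S.b₁x z t) (S.b₂x z t)
          rw [abs_mul, abs_of_pos hm0] at e5
          have e6 : e * m ^ 2 * (S.v z t * (S.b₁ z t ^ 2 + S.b₂ z t ^ 2))
              ≤ m * m ^ 2 * (S.v z t * (S.b₁ z t ^ 2 + S.b₂ z t ^ 2)) := by gcongr
          calc _ ≤ _ := e5
            _ ≤ S.diss p z t + m * m ^ 2 * (S.v z t * (S.b₁ z t ^ 2 + S.b₂ z t ^ 2)) :=
              add_le_add e1 e6
            _ = _ := by ring
      _ = (∫ y in x..(x + 1), S.diss p y t)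
          + m ^ 3 * ∫ y in x..(x + 1), S.v y t * (S.b₁ y t ^ 2 + S.b₂ y t ^ 2) := by
          rw [intervalIntegral.integral_add, intervalIntegral.integral_const_mul]
          all_goals exact Continuous.intervalIntegrable (by fun_prop) _ _
      _ ≤ _ := by gcongr
  have h3 := mul_le_mul_of_nonneg_left (h1.trans (add_le_add_left hb _)) hm0.le
  linarith

lemma exists_pressure_bound (hα : 0 ≤ α) (hβ : 0 < β) (hT : 0 ≤ T) (hK : 0 < K) (hδ : 0 < δ)
    {p : ℝ} (hp : 0 < p) (hpβ : p ≤ β) (hp3 : 3 * p ≤ 1) :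
    ∃ C : ℝ, 1 ≤ C ∧ ∀ S : MHDFlow α β T, S.InitBound K δ → ∃ L₀ : ℝ, 1 ≤ L₀ ∧ ∀ L ≥ L₀,
      (∫ t in 0..T, S.dissInt p L t) ≤ C ∧
      ∀ x, ∀ t ∈ Icc 0 T, S.θ x t ≤ C * (1 + S.dissInt p L t) ∧
        S.θ x t ^ p * (S.b₁ x t ^ 2 + S.b₂ x t ^ 2) ≤ C * (1 + S.dissInt p L t) ∧
        S.b₁ x t ^ 2 + S.b₂ x t ^ 2 ≤ C * (1 + S.dissInt p L t) := by
  obtain ⟨c, hc, Cv, hCv, hv⟩ := exists_v_bounds (α := α) (β := β) hα hT hK hδ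
  obtain ⟨C₁, hC₁, hD⟩ := exists_dissipation_bound (α := α) (β := β) hα hβ hT hK hδ hp
    (by linarith)
  have hE := energyConst_pos hK hδ hT
  set E := energyConst K δ T with hE'
  set B := 2 * E / c + 2 + 2 * E with hB
  have hB1 : 1 ≤ B := by
    have : 0 < 2 * E / c := by positivity
    linarith
  refine ⟨B * C₁, by nlinarith, fun S hS => ?_⟩
  obtain ⟨L₀, hL₀, h1⟩ := hD S hS
  refine ⟨L₀, hL₀, fun L hL => ?_⟩
  obtain ⟨h2, h3, h4⟩ := h1 L hL
  refine ⟨by nlinarith, fun x t ht => ?_⟩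
  have hV0 := S.dissInt_nonneg hα hp.le (by linarith : 0 ≤ L) t
  set V := C₁ * (1 + S.dissInt p L t) with hV
  have hV1 : 1 ≤ V := by nlinarith
  have hVd : S.dissInt p L t ≤ V := by nlinarith
  obtain ⟨m, hm1, hm3, hm⟩ := exists_intermediate_power (r := 1 + β - p) hp.le hp3
    (by linarith) hV1
  have hmV : m ≤ V := le_trans (by nlinarith [sq_nonneg m]) hm3
  have hθ : ∀ y, S.θ y t ^ p ≤ m ∧ S.θ y t ≤ V := fun y => hm _ (S.θ_pos y t) (h3 y t ht)
  have hBV : V ≤ B * V := le_mul_of_one_le_left (by linarith) hB1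
  have key : m * (S.b₁ x t ^ 2 + S.b₂ x t ^ 2) ≤ B * V := by
    rcases h4 x t with h | h
    · have e1 := hS.cell_b_bound hα hK hδ hp hc hm1 (x := x) ht (fun y => (hv S hS y t ht).1)
        fun y => (hθ y).1
      have e2 := S.cell_diss_le hα hp.le (by linarith) h t
      have e3 : m * (2 * E / c) ≤ V * (2 * E / c) := by gcongr
      have e4 : m ^ 3 * (2 * E) ≤ V * (2 * E) := by gcongr
      rw [hB]
      linarith
    · nlinarith
  have hb0 : 0 ≤ S.b₁ x t ^ 2 + S.b₂ x t ^ 2 := by positivity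
  have hfin : B * V = B * C₁ * (1 + S.dissInt p L t) := by rw [hV]; ring
  rw [← hfin]
  refine ⟨(hθ x).2.trans hBV, ?_, ?_⟩
  · exact (mul_le_mul_of_nonneg_right (hθ x).1 hb0).trans key
  · exact (le_mul_of_one_le_left hb0 hm1).trans key

/-- All pointwise bounds needed for the estimate of `vx`. -/
lemma exists_uniform_bounds (hα : 0 ≤ α) (hβ : 0 < β) (hT : 0 ≤ T) (hK : 0 < K) (hδ : 0 < δ)
    (hδ1 : δ ≤ 1) {p : ℝ} (hp : 0 < p) (hpβ : p ≤ β) (hp3 : 3 * p ≤ 1) :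
    ∃ c > 0, ∃ C : ℝ, 1 ≤ C ∧ ∀ S : MHDFlow α β T, S.InitBound K δ → ∃ L₀ : ℝ, 1 ≤ L₀ ∧
      ∀ L ≥ L₀, (∫ t in 0..T, S.dissInt p L t) ≤ C ∧
      ∀ x, ∀ t ∈ Icc 0 T, c ≤ S.v x t ∧ S.v x t ≤ C ∧ S.θ x t ≤ C * (1 + S.dissInt p L t) ∧
        S.θ x t ^ p * (S.b₁ x t ^ 2 + S.b₂ x t ^ 2) ≤ C * (1 + S.dissInt p L t) ∧
        S.θ x t ^ (1 + p - β) ≤ C * (1 + S.dissInt p L t) := by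
  obtain ⟨c, hc, Cv, hCv, hv⟩ := exists_v_bounds (α := α) (β := β) hα hT hK hδ
  obtain ⟨C₁, hC₁, hD⟩ := exists_pressure_bound (α := α) (β := β) hα hβ hT hK hδ hp hpβ hp3
  set A := C₁ / c + C₁ with hA
  have hA0 : 0 < A := by positivity
  set c₂ := (1 / δ + T / c)⁻¹ with hc₂
  have hc₂0 : 0 < c₂ := by positivity
  have hc₂r : 0 < c₂ ^ (1 + p - β) := Real.rpow_pos_of_pos hc₂0 _
  set F := Cv * Real.exp (A * (T + C₁)) with hF
  have hF0 : 0 < F := by positivity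
  refine ⟨c, hc, C₁ + F + 1 + c₂ ^ (1 + p - β), by linarith, fun S hS => ?_⟩
  obtain ⟨L₀, hL₀, h1⟩ := hD S hS
  refine ⟨L₀, hL₀, fun L hL => ?_⟩
  obtain ⟨h2, h3⟩ := h1 L hL
  have hV0 := S.dissInt_nonneg hα hp.le (by linarith : 0 ≤ L)
  refine ⟨by linarith, fun x t ht => ?_⟩
  obtain ⟨e1, e2, e3⟩ := h3 x t ht
  have hmono : C₁ * (1 + S.dissInt p L t)
      ≤ (C₁ + F + 1 + c₂ ^ (1 + p - β)) * (1 + S.dissInt p L t) :=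
    mul_le_mul_of_nonneg_right (by linarith) (by linarith [hV0 t])
  have hpress : S.pressInt x t ≤ A * (T + C₁) := by
    calc S.pressInt x t ≤ ∫ s in 0..T, S.press x s :=
          integral_mono_subinterval le_rfl ht.1 ht.2 (by fun_prop) fun s _ => (S.press_pos x s).le
      _ ≤ ∫ s in 0..T, A * (1 + S.dissInt p L s) := by
          refine integral_mono_cont hT (by fun_prop) (by fun_prop) fun s hs => ?_
          obtain ⟨d1, -, d3⟩ := h3 x s hs
          have d4 : S.θ x s / S.v x s ≤ C₁ * (1 + S.dissInt p L s) / c :=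
            div_le_div₀ (by have := hV0 s; positivity) d1 hc (hv S hS x s hs).1
          have d5 : 0 ≤ S.b₁ x s ^ 2 + S.b₂ x s ^ 2 := by positivity
          unfold press
          rw [hA, add_mul, div_mul_eq_mul_div]
          linarith
      _ = A * (T + ∫ s in 0..T, S.dissInt p L s) := by
          rw [intervalIntegral.integral_const_mul, intervalIntegral.integral_add (by simp)
            (Continuous.intervalIntegrable (by fun_prop) _ _), intervalIntegral.integral_const]
          simp
      _ ≤ _ := by gcongr
  obtain ⟨v1, v2⟩ := hv S hS x t ht
  refine ⟨v1, ?_, e1.trans hmono, e2.trans hmono, ?_⟩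
  · have : S.v x t ≤ F := v2.trans (by rw [hF]; gcongr)
    linarith
  · have d1 := S.θ_lower hα hT hc hδ hδ1 (fun x t ht => (hv S hS x t ht).1)
      hS.θ_ge x t ht
    have d2 := rpow_le_of_exponent_le_one hc₂0 (by linarith : 1 + p - β ≤ 1) d1
    have d3 : 0 ≤ (F + 1 + c₂ ^ (1 + p - β)) * S.dissInt p L t :=
      mul_nonneg (by positivity) (hV0 t)
    nlinarith

end MHDFlow

namespace MHDFlow

section EffectiveVelocity

variable {α β T : ℝ} (S : MHDFlow α β T)

/-- Spatial derivative of the total pressure. -/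
def pressx (x t : ℝ) : ℝ :=
  S.θx x t / S.v x t - S.θ x t * S.vx x t / S.v x t ^ 2
    + (S.b₁ x t * S.b₁x x t + S.b₂ x t * S.b₂x x t)

/-- Effective velocity: the derivative of `logVisc v` minus the velocity. -/
def effVel (x t : ℝ) : ℝ := visc α (S.v x t) * S.vx x t / S.v x t - S.u x t

@[fun_prop]
lemma continuous_pressx : Continuous (Function.uncurry fun x t => S.pressx x t) := by
  unfold Function.uncurry pressx
  fun_prop (disch := simp)

@[fun_prop]
lemma continuous_effVel : Continuous (Function.uncurry fun x t => S.effVel x t) := by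
  unfold Function.uncurry effVel
  fun_prop (disch := simp)

lemma hasDerivAt_press (x t : ℝ) : HasDerivAt (fun y => S.press y t) (S.pressx x t) x := by
  have h := ((S.dθx x t).div (S.dvx x t) (S.v_ne x t)).add
    ((((S.db₁x x t).pow 2).add ((S.db₂x x t).pow 2)).div_const 2)
  refine h.congr_deriv ?_
  have := S.v_ne x t
  unfold pressx
  norm_num
  field_simp

lemma pressInt_sub (a y t : ℝ) :
    S.pressInt y t - S.pressInt a t = ∫ x in a..y, ∫ s in 0..t, S.pressx x s := by
  have h1 : ∫ x in a..y, ∫ s in 0..t, S.pressx x s = ∫ s in 0..t, ∫ x in a..y, S.pressx x s := by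
    apply intervalIntegral_intervalIntegral_swap
    apply IntegrableOn.mono_set (t := uIcc a y ×ˢ uIcc 0 t)
    · exact (Continuous.continuousOn (by fun_prop)).integrableOn_compact
        (isCompact_uIcc.prod isCompact_uIcc)
    · exact prod_mono uIoc_subset_uIcc uIoc_subset_uIcc
  rw [h1]
  unfold pressInt
  rw [← intervalIntegral.integral_sub]
  · exact intervalIntegral.integral_congr fun s _ =>
      (ftc_cont (fun x => S.hasDerivAt_press x s) (by fun_prop)).symm
  all_goals exact Continuous.intervalIntegrable (by fun_prop) _ _

lemma hasDerivAt_logVisc_v (x t : ℝ) :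
    HasDerivAt (fun y => logVisc α (S.v y t)) (S.effVel x t + S.u x t) x := by
  refine ((hasDerivAt_logVisc (S.v_pos x t)).comp x (S.dvx x t)).congr_deriv ?_
  unfold effVel
  ring

lemma effVel_eq (x : ℝ) {t : ℝ} (ht : t ∈ Icc 0 T) :
    S.effVel x t = S.effVel x 0 + ∫ s in 0..t, S.pressx x s := by
  have hI : Continuous fun y => ∫ s in 0..t, S.pressx y s :=
    intervalIntegral.continuous_parametric_intervalIntegral_of_continuous'
      (f := fun y s => S.pressx y s) (by unfold Function.uncurry; fun_prop) _ _
  have h1 := S.hasDerivAt_logVisc_v x t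
  have h2 : HasDerivAt (fun y => logVisc α (S.v x t) + (∫ z in x..y, ∫ s in 0..t, S.pressx z s)
      + (logVisc α (S.v y 0) - logVisc α (S.v x 0))
      + ((∫ z in x..y, S.u z t) - ∫ z in x..y, S.u z 0))
      ((∫ s in 0..t, S.pressx x s) + (S.effVel x 0 + S.u x 0) + (S.u x t - S.u x 0)) x := by
    refine HasDerivAt.fun_add (HasDerivAt.fun_add (HasDerivAt.const_add _ ?_)
      ((S.hasDerivAt_logVisc_v x 0).sub_const _)) (HasDerivAt.fun_sub ?_ ?_)
    · exact (hI.integral_hasStrictDerivAt x x).hasDerivAt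
    · exact (Continuous.integral_hasStrictDerivAt (f := fun z => S.u z t)
        (by fun_prop) x x).hasDerivAt
    · exact (Continuous.integral_hasStrictDerivAt (f := fun z => S.u z 0)
        (by fun_prop) x x).hasDerivAt
  have h3 : (fun y => logVisc α (S.v y t)) = fun y => logVisc α (S.v x t)
      + (∫ z in x..y, ∫ s in 0..t, S.pressx z s)
      + (logVisc α (S.v y 0) - logVisc α (S.v x 0))
      + ((∫ z in x..y, S.u z t) - ∫ z in x..y, S.u z 0) := by
    ext y
    have := S.logVisc_sub_pressInt x y ht
    rw [← S.pressInt_sub]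
    linarith
  rw [h3] at h1
  have := h1.unique h2
  linarith

lemma hasDerivWithinAt_effVel (x : ℝ) {t : ℝ} (ht : t ∈ Icc 0 T) :
    HasDerivWithinAt (S.effVel x) (S.pressx x t) (Icc 0 T) t := by
  have h : HasDerivAt (fun t => S.effVel x 0 + ∫ s in 0..t, S.pressx x s) (S.pressx x t) t :=
    ((Continuous.integral_hasStrictDerivAt (f := S.pressx x)
      (by fun_prop) 0 t).hasDerivAt).const_add _
  exact h.hasDerivWithinAt.congr (fun s hs => S.effVel_eq x hs) (S.effVel_eq x ht)

end EffectiveVelocity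

variable {α β T : ℝ} {S : MHDFlow α β T} {K δ : ℝ}

lemma integral_diss_le (hα : 0 ≤ α) {p : ℝ} (hp : 0 ≤ p) {L R : ℝ} (hR : 0 ≤ R)
    (hL : 2 * R ≤ L) (hL0 : 0 < L) (t : ℝ) :
    ∫ y in (-R)..R, S.diss p y t ≤ 2 * S.dissInt p L t := by
  unfold dissInt
  rw [← intervalIntegral.integral_const_mul]
  calc ∫ y in (-R)..R, S.diss p y t
      ≤ ∫ y in (-R)..R, 2 * (bump L y * S.diss p y t) := by
        refine integral_mono_cont (by linarith) (by fun_prop) (by fun_prop) fun y hy => ?_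
        have h1 := half_le_bump hL0 (x := y) (by rw [abs_le]; constructor <;> linarith [hy.1, hy.2])
        have h2 := mul_le_mul_of_nonneg_right h1 (S.diss_nonneg hα hp y t)
        linarith
    _ ≤ _ := integral_mono_subinterval (by linarith) (by linarith) (by linarith) (by fun_prop)
        fun y _ => mul_nonneg zero_le_two (mul_nonneg (bump_nonneg _ _) (S.diss_nonneg hα hp y t))

lemma effVel_mul_pressx_le (hα : 0 ≤ α) {p c C V : ℝ} (hp : 0 < p) (hc : 0 < c) {x t : ℝ}
    (hv : c ≤ S.v x t) (hvC : S.v x t ≤ C) (hθ : S.θ x t ≤ V)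
    (hb : S.θ x t ^ p * (S.b₁ x t ^ 2 + S.b₂ x t ^ 2) ≤ V) (hr : S.θ x t ^ (1 + p - β) ≤ V) :
    2 * S.effVel x t * S.pressx x t ≤ (1 / p + 1) * S.diss p x t
      + (1 / c + C) * V * S.effVel x t ^ 2 + V / c * S.energy relEnt x t := by
  have h1 := S.v_pos x t
  have h2 := S.θ_pos x t
  have h3 := visc_ge_one hα h1
  have hV : 0 < V := h2.trans_le hθ
  have d1 := S.θx_sq_le_diss hα hp x t
  have d2 := S.bx_sq_le_diss hα hp x t
  have d3 := S.u_sq_le_energy x t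
  set z := S.effVel x t with hz
  have hvx : S.vx x t = (z + S.u x t) * S.v x t / visc α (S.v x t) := by
    rw [hz]; unfold effVel; field_simp; ring
  have e1 : 2 * z * (S.θx x t / S.v x t) ≤ S.diss p x t / p + V / c * z ^ 2 := by
    have hi : S.θ x t ^ (β - p - 1) = (S.θ x t ^ (1 + p - β))⁻¹ := by
      rw [← Real.rpow_neg h2.le]; congr 1; ring
    rw [hi] at d1
    have hrp : 0 < S.θ x t ^ (1 + p - β) := Real.rpow_pos_of_pos h2 _
    generalize S.θ x t ^ (1 + p - β) = r at *
    have q1 : r⁻¹ * S.θx x t ^ 2 / S.v x t + r / S.v x t * z ^ 2 - 2 * z * (S.θx x t / S.v x t)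
        = (S.θx x t - r * z) ^ 2 / (r * S.v x t) := by field_simp; ring
    have q2 : 0 ≤ (S.θx x t - r * z) ^ 2 / (r * S.v x t) := by positivity
    have q3 : r / S.v x t * z ^ 2 ≤ V / c * z ^ 2 := by gcongr
    linarith
  have e2 : -(2 * z * (S.θ x t * S.vx x t / S.v x t ^ 2)) ≤ V / c * S.energy relEnt x t := by
    have q1 : S.θ x t * S.u x t ^ 2 / (2 * (S.v x t * visc α (S.v x t)))
        - -(2 * z * (S.θ x t * S.vx x t / S.v x t ^ 2))
        = S.θ x t * (S.u x t + 2 * z) ^ 2 / (2 * (S.v x t * visc α (S.v x t))) := by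
      rw [hvx]; field_simp; ring
    have q2 : 0 ≤ S.θ x t * (S.u x t + 2 * z) ^ 2 / (2 * (S.v x t * visc α (S.v x t))) := by
      positivity
    have q3 : c ≤ S.v x t * visc α (S.v x t) := by nlinarith
    calc _ ≤ S.θ x t * S.u x t ^ 2 / (2 * (S.v x t * visc α (S.v x t))) := by linarith
      _ ≤ V * S.u x t ^ 2 / (2 * c) := by gcongr
      _ = V / c * (S.u x t ^ 2 / 2) := by field_simp
      _ ≤ _ := by gcongr
  have e3 : 2 * z * (S.b₁ x t * S.b₁x x t + S.b₂ x t * S.b₂x x t)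
      ≤ S.diss p x t + C * V * z ^ 2 := by
    rw [Real.rpow_neg h2.le] at d2
    have hrp : 0 < S.θ x t ^ p := Real.rpow_pos_of_pos h2 _
    generalize S.θ x t ^ p = r at *
    have q1 : r⁻¹ * (S.b₁x x t ^ 2 + S.b₂x x t ^ 2) / S.v x t
        + S.v x t * (r * (S.b₁ x t ^ 2 + S.b₂ x t ^ 2)) * z ^ 2
        - 2 * z * (S.b₁ x t * S.b₁x x t + S.b₂ x t * S.b₂x x t)
        = ((S.b₁x x t - r * S.v x t * S.b₁ x t * z) ^ 2
          + (S.b₂x x t - r * S.v x t * S.b₂ x t * z) ^ 2) / (r * S.v x t) := by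
      field_simp; ring
    have q2 : 0 ≤ ((S.b₁x x t - r * S.v x t * S.b₁ x t * z) ^ 2
          + (S.b₂x x t - r * S.v x t * S.b₂ x t * z) ^ 2) / (r * S.v x t) := by positivity
    have hC : 0 < C := h1.trans_le hvC
    have q3 : S.v x t * (r * (S.b₁ x t ^ 2 + S.b₂ x t ^ 2)) * z ^ 2 ≤ C * V * z ^ 2 := by gcongr
    linarith
  have : 2 * z * S.pressx x t = 2 * z * (S.θx x t / S.v x t)
      + -(2 * z * (S.θ x t * S.vx x t / S.v x t ^ 2))
      + 2 * z * (S.b₁ x t * S.b₁x x t + S.b₂ x t * S.b₂x x t) := by unfold pressx; ring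
  rw [this]
  have e4 : (1 / p + 1) * S.diss p x t + (1 / c + C) * V * z ^ 2
      = S.diss p x t / p + V / c * z ^ 2 + (S.diss p x t + C * V * z ^ 2) := by ring
  linarith

lemma InitBound.effVel_sq_le (hS : S.InitBound K δ) (hα : 0 ≤ α) (hδ : 0 < δ) (x : ℝ) :
    S.effVel x 0 ^ 2 ≤ (2 * ((1 + α * δ ^ (-α)) / δ) ^ 2 + 2) * S.initDensity x := by
  have h1 := S.v_pos x 0
  have h2 := hS.v_ge x
  have h3 : visc α (S.v x 0) ≤ 1 + α * δ ^ (-α) := by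
    have := mul_le_mul_of_nonneg_left
      (Real.rpow_le_rpow_of_nonpos hδ h2 (neg_nonpos.2 hα)) hα
    unfold visc; linarith
  have h4 : 0 < visc α (S.v x 0) := by linarith [visc_ge_one hα h1]
  have h5 : (visc α (S.v x 0) / S.v x 0) ^ 2 ≤ ((1 + α * δ ^ (-α)) / δ) ^ 2 := by gcongr
  have h6 := mul_le_mul_of_nonneg_right h5 (sq_nonneg (S.vx x 0))
  have h7 : S.effVel x 0 ^ 2 ≤ 2 * ((visc α (S.v x 0) / S.v x 0) ^ 2 * S.vx x 0 ^ 2)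
      + 2 * S.u x 0 ^ 2 := by
    have : S.effVel x 0 = visc α (S.v x 0) / S.v x 0 * S.vx x 0 - S.u x 0 := by
      unfold effVel; ring
    rw [this]
    nlinarith [sq_nonneg (visc α (S.v x 0) / S.v x 0 * S.vx x 0 + S.u x 0)]
  have h8 : S.vx x 0 ^ 2 + S.u x 0 ^ 2 ≤ S.initDensity x := by
    have := sq_nonneg (S.v x 0 - 1)
    have := sq_nonneg (S.θ x 0 - 1)
    have := sq_nonneg (S.w₁ x 0)
    have := sq_nonneg (S.w₂ x 0)
    have := sq_nonneg (S.b₁ x 0)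
    have := sq_nonneg (S.b₂ x 0)
    unfold initDensity; linarith
  set G := ((1 + α * δ ^ (-α)) / δ) ^ 2
  have hG : 0 ≤ G := sq_nonneg _
  have := sq_nonneg (S.vx x 0)
  have := sq_nonneg (S.u x 0)
  nlinarith

/-- The a priori bound for `vx` on bounded intervals. -/
lemma exists_vx_bound (hα : 0 ≤ α) (hβ : 0 < β) (hT : 0 ≤ T) (hK : 0 < K) (hδ : 0 < δ)
    (hδ1 : δ ≤ 1) :
    ∃ C > 0, ∀ S : MHDFlow α β T, S.InitBound K δ → ∀ t ∈ Icc 0 T, ∀ R > 0,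
      ∫ x in (-R)..R, S.vx x t ^ 2 ≤ C := by
  set p := min β (1 / 4) with hp'
  have hp : 0 < p := lt_min hβ (by norm_num)
  have hpβ : p ≤ β := min_le_left _ _
  have hp4 : p ≤ 1 / 4 := min_le_right _ _
  obtain ⟨c, hc, C, hC, hB⟩ := exists_uniform_bounds (α := α) hα hβ hT hK hδ hδ1 hp hpβ
    (by linarith)
  have hE := energyConst_pos hK hδ hT
  set E := energyConst K δ T with hE'
  set Y₀ := (2 * ((1 + α * δ ^ (-α)) / δ) ^ 2 + 2) * K ^ 2 with hY₀
  set A := Y₀ + (1 / p + 1) * (2 * C) + E / c * (C * (T + C)) with hA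
  set Y := A * Real.exp ((1 / c + C) * (C * (T + C))) with hY
  have hA0 : 0 < A := by positivity
  have hY0 : 0 < Y := by positivity
  refine ⟨C ^ 2 * (2 * Y + 4 * E), by positivity, fun S hS t ht R hR => ?_⟩
  obtain ⟨L₀, hL₀, h1⟩ := hB S hS
  obtain ⟨hD, h2⟩ := h1 (max L₀ (2 * R)) (le_max_left _ _)
  set L := max L₀ (2 * R) with hL
  have hLpos : 0 < L := by linarith [le_max_left L₀ (2 * R)]
  have hV0 := S.dissInt_nonneg hα hp.le hLpos.le
  have hRR : -R ≤ R := by linarith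
  set y : ℝ → ℝ := fun t => ∫ x in (-R)..R, S.effVel x t ^ 2 with hy
  set V : ℝ → ℝ := fun t => C * (1 + S.dissInt p L t) with hV
  have hVc : Continuous V := by fun_prop
  have hVint : ∫ s in 0..T, V s ≤ C * (T + C) := by
    rw [hV, intervalIntegral.integral_const_mul, intervalIntegral.integral_add (by simp)
      (Continuous.intervalIntegrable (by fun_prop) _ _), intervalIntegral.integral_const]
    simp only [sub_zero, smul_eq_mul, mul_one]
    gcongr
  have hVpos : ∀ s, 0 ≤ V s := fun s => by have := hV0 s; positivity
  have hyc : Continuous y := intervalIntegral.continuous_parametric_intervalIntegral_of_continuous'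
      (f := fun s x => S.effVel x s ^ 2) (by unfold Function.uncurry; fun_prop) _ _
  have hy0 : y 0 ≤ Y₀ := by
    calc y 0 ≤ ∫ x in (-R)..R, (2 * ((1 + α * δ ^ (-α)) / δ) ^ 2 + 2) * S.initDensity x :=
          integral_mono_cont hRR (by fun_prop) (by fun_prop) fun x _ => hS.effVel_sq_le hα hδ x
      _ = (2 * ((1 + α * δ ^ (-α)) / δ) ^ 2 + 2) * ∫ x in (-R)..R, S.initDensity x :=
          intervalIntegral.integral_const_mul _ _
      _ ≤ _ := mul_le_mul_of_nonneg_left (hS.int_le _ _ hRR) (by positivity)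
  have hint : ∀ s ∈ Icc 0 T, ∫ x in (-R)..R, 2 * S.effVel x s * S.pressx x s
      ≤ ((1 / p + 1) * (2 * S.dissInt p L s) + E / c * V s) + (1 / c + C) * V s * y s := by
    intro s hs
    calc _ ≤ ∫ x in (-R)..R, ((1 / p + 1) * S.diss p x s
            + (1 / c + C) * V s * S.effVel x s ^ 2 + V s / c * S.energy relEnt x s) := by
          refine integral_mono_cont hRR (by fun_prop) (by fun_prop) fun x _ => ?_
          obtain ⟨d1, d2, d3, d4, d5⟩ := h2 x s hs
          exact S.effVel_mul_pressx_le hα hp hc d1 d2 d3 d4 d5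
      _ = (1 / p + 1) * (∫ x in (-R)..R, S.diss p x s) + (1 / c + C) * V s * y s
            + V s / c * ∫ x in (-R)..R, S.energy relEnt x s := by
          rw [intervalIntegral.integral_add, intervalIntegral.integral_add,
            intervalIntegral.integral_const_mul, intervalIntegral.integral_const_mul,
            intervalIntegral.integral_const_mul]
          all_goals exact Continuous.intervalIntegrable (by fun_prop) _ _
      _ ≤ (1 / p + 1) * (2 * S.dissInt p L s) + (1 / c + C) * V s * y s + V s / c * E := by
          have := S.integral_diss_le hα hp.le hR.le (le_max_right L₀ (2 * R)) hLpos s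
          have := hS.energy_bound hα hK hδ hs hRR
          have := hVpos s
          gcongr
      _ = _ := by ring
  have hgron : ∀ t ∈ Icc 0 T, y t ≤ A + ∫ s in 0..t, (1 / c + C) * V s * y s := by
    intro t ht
    have e1 := integral_param_ftc (a := -R) (b := R) (f := fun x t => S.effVel x t ^ 2)
      (f' := fun x t => 2 * S.effVel x t * S.pressx x t)
      (by unfold Function.uncurry; fun_prop) (by unfold Function.uncurry; fun_prop)
      (fun x t ht => ((S.hasDerivWithinAt_effVel x ht).fun_pow 2).congr_deriv (by norm_num)) ht
    have e2 : ∫ s in 0..t, ∫ x in (-R)..R, 2 * S.effVel x s * S.pressx x s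
        ≤ ∫ s in 0..t, (((1 / p + 1) * (2 * S.dissInt p L s) + E / c * V s)
          + (1 / c + C) * V s * y s) := by
      refine integral_mono_cont ht.1 ?_ (by fun_prop) fun s hs => hint s ⟨hs.1, hs.2.trans ht.2⟩
      exact intervalIntegral.continuous_parametric_intervalIntegral_of_continuous'
        (f := fun s x => 2 * S.effVel x s * S.pressx x s)
        (by unfold Function.uncurry; fun_prop) _ _
    have e3 : ∫ s in 0..t, ((1 / p + 1) * (2 * S.dissInt p L s) + E / c * V s)
        ≤ (1 / p + 1) * (2 * C) + E / c * (C * (T + C)) := by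
      calc _ ≤ ∫ s in 0..T, ((1 / p + 1) * (2 * S.dissInt p L s) + E / c * V s) :=
            integral_mono_subinterval le_rfl ht.1 ht.2 (by fun_prop) fun s _ => by
              have := hV0 s
              have := hVpos s
              positivity
        _ = (1 / p + 1) * (2 * ∫ s in 0..T, S.dissInt p L s) + E / c * ∫ s in 0..T, V s := by
            rw [intervalIntegral.integral_add, intervalIntegral.integral_const_mul,
              intervalIntegral.integral_const_mul, intervalIntegral.integral_const_mul]
            all_goals exact Continuous.intervalIntegrable (by fun_prop) _ _
        _ ≤ _ := by gcongr
    rw [intervalIntegral.integral_add (Continuous.intervalIntegrable (by fun_prop) _ _)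
      (Continuous.intervalIntegrable (by fun_prop) _ _)] at e2
    have e4 : y t = y 0 + ∫ s in 0..t, ∫ x in (-R)..R, 2 * S.effVel x s * S.pressx x s := e1
    rw [hA]
    linarith
  have hyt : y t ≤ Y := by
    refine (gronwall_integral hyc (k := fun s => (1 / c + C) * V s) (by fun_prop)
      (fun s => by have := hVpos s; positivity) hgron t ht).trans ?_
    have e1 : ∫ s in 0..t, (1 / c + C) * V s ≤ (1 / c + C) * (C * (T + C)) := by
      rw [intervalIntegral.integral_const_mul]
      have := (integral_mono_subinterval le_rfl ht.1 ht.2 hVc fun s _ => hVpos s).trans hVint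
      gcongr
    rw [hY]
    gcongr
  calc ∫ x in (-R)..R, S.vx x t ^ 2
      ≤ ∫ x in (-R)..R, C ^ 2 * (2 * S.effVel x t ^ 2 + 4 * S.energy relEnt x t) := by
        refine integral_mono_cont hRR (by fun_prop) (by fun_prop) fun x _ => ?_
        obtain ⟨d1, d2, -⟩ := h2 x t ht
        have q1 := S.v_pos x t
        have q2 := visc_ge_one hα q1
        have q3 := S.u_sq_le_energy x t
        have q4 : S.vx x t
            = S.v x t / visc α (S.v x t) * (S.effVel x t + S.u x t) := by
          unfold effVel; field_simp; ring
        have q5 : S.v x t / visc α (S.v x t) ≤ C :=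
          (div_le_self q1.le q2).trans d2
        have q6 : 0 ≤ S.v x t / visc α (S.v x t) := by positivity
        rw [q4, mul_pow]
        have q7 : (S.effVel x t + S.u x t) ^ 2
            ≤ 2 * S.effVel x t ^ 2 + 4 * S.energy relEnt x t := by
          nlinarith [sq_nonneg (S.effVel x t - S.u x t)]
        gcongr
    _ = C ^ 2 * (2 * y t + 4 * ∫ x in (-R)..R, S.energy relEnt x t) := by
        rw [intervalIntegral.integral_const_mul, intervalIntegral.integral_add,
          intervalIntegral.integral_const_mul, intervalIntegral.integral_const_mul]
        all_goals exact Continuous.intervalIntegrable (by fun_prop) _ _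
    _ ≤ _ := by
        have := hS.energy_bound hα hK hδ ht hRR
        gcongr

end MHDFlow

/-- Truncation of the time variable to `[0, T]`. -/
def clampTime (T t : ℝ) : ℝ := max 0 (min t T)

lemma clampTime_mem {T : ℝ} (hT : 0 < T) (t : ℝ) : clampTime T t ∈ Icc 0 T :=
  ⟨le_max_left _ _, max_le hT.le (min_le_right _ _)⟩

lemma clampTime_of_mem {T t : ℝ} (ht : t ∈ Icc 0 T) : clampTime T t = t := by
  rw [clampTime, min_eq_left ht.2, max_eq_right ht.1]

lemma continuous_comp_clampTime {T : ℝ} (hT : 0 < T) {f : ℝ → ℝ → ℝ}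
    (hf : ContinuousOn (fun p : ℝ × ℝ => f p.1 p.2) (univ ×ˢ Icc 0 T)) :
    Continuous (Function.uncurry fun x t => f x (clampTime T t)) :=
  hf.comp_continuous (f := fun p : ℝ × ℝ => (p.1, clampTime T p.2))
    (by unfold clampTime; fun_prop) fun p => ⟨mem_univ _, clampTime_mem hT p.2⟩

lemma hasDerivWithinAt_comp_clampTime {T : ℝ} {f : ℝ → ℝ} {f' t : ℝ} (ht : t ∈ Icc 0 T)
    (hf : HasDerivWithinAt f f' (Icc 0 T) t) :
    HasDerivWithinAt (fun s => f (clampTime T s)) f' (Icc 0 T) t :=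
  hf.congr (fun s hs => by rw [clampTime_of_mem hs]) (by rw [clampTime_of_mem ht])

lemma abs_lt_of_sqrt_sq2_lt {p : ℝ × ℝ} {ε : ℝ} (h : Real.sqrt (sq2 p) < ε) :
    |p.1| < ε ∧ |p.2| < ε := by
  refine ⟨lt_of_le_of_lt ?_ h, lt_of_le_of_lt ?_ h⟩ <;>
  · apply Real.abs_le_sqrt
    unfold sq2
    nlinarith [sq_nonneg p.1, sq_nonneg p.2]

lemma HasDerivAt.fst_prod {f : ℝ → ℝ × ℝ} {f' : ℝ × ℝ} {x : ℝ} (h : HasDerivAt f f' x) :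
    HasDerivAt (fun y => (f y).1) f'.1 x :=
  (ContinuousLinearMap.fst ℝ ℝ ℝ).hasFDerivAt.comp_hasDerivAt x h

lemma HasDerivAt.snd_prod {f : ℝ → ℝ × ℝ} {f' : ℝ × ℝ} {x : ℝ} (h : HasDerivAt f f' x) :
    HasDerivAt (fun y => (f y).2) f'.2 x :=
  (ContinuousLinearMap.snd ℝ ℝ ℝ).hasFDerivAt.comp_hasDerivAt x h

lemma HasDerivWithinAt.fst_prod {f : ℝ → ℝ × ℝ} {f' : ℝ × ℝ} {s : Set ℝ} {x : ℝ}
    (h : HasDerivWithinAt f f' s x) : HasDerivWithinAt (fun y => (f y).1) f'.1 s x :=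
  (ContinuousLinearMap.fst ℝ ℝ ℝ).hasFDerivAt.comp_hasDerivWithinAt x h

lemma HasDerivWithinAt.snd_prod {f : ℝ → ℝ × ℝ} {f' : ℝ × ℝ} {s : Set ℝ} {x : ℝ}
    (h : HasDerivWithinAt f f' s x) : HasDerivWithinAt (fun y => (f y).2) f'.2 s x :=
  (ContinuousLinearMap.snd ℝ ℝ ℝ).hasFDerivAt.comp_hasDerivWithinAt x h

namespace IsClassicalSolution

variable {α β T : ℝ} {v u θ : ℝ → ℝ → ℝ} {w b : ℝ → ℝ → ℝ × ℝ}

lemma hasDerivAt_v (h : IsClassicalSolution α β T v u θ w b) (x : ℝ) {t : ℝ}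
    (ht : t ∈ Icc 0 T) :
    HasDerivAt (fun y => v y t) (pdx v x t) x := (h.diff_x x t ht).1.hasDerivAt

lemma hasDerivAt_u (h : IsClassicalSolution α β T v u θ w b) (x : ℝ) {t : ℝ}
    (ht : t ∈ Icc 0 T) :
    HasDerivAt (fun y => u y t) (pdx u x t) x := (h.diff_x x t ht).2.1.hasDerivAt

lemma hasDerivAt_θ (h : IsClassicalSolution α β T v u θ w b) (x : ℝ) {t : ℝ}
    (ht : t ∈ Icc 0 T) :
    HasDerivAt (fun y => θ y t) (pdx θ x t) x :=
  (h.diff_x x t ht).2.2.1.hasDerivAt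

lemma hasDerivAt_w (h : IsClassicalSolution α β T v u θ w b) (x : ℝ) {t : ℝ}
    (ht : t ∈ Icc 0 T) :
    HasDerivAt (fun y => w y t) (pdx w x t) x :=
  (h.diff_x x t ht).2.2.2.1.hasDerivAt

lemma hasDerivAt_b (h : IsClassicalSolution α β T v u θ w b) (x : ℝ) {t : ℝ}
    (ht : t ∈ Icc 0 T) :
    HasDerivAt (fun y => b y t) (pdx b x t) x :=
  (h.diff_x x t ht).2.2.2.2.hasDerivAt

lemma hasDerivAt_ux (h : IsClassicalSolution α β T v u θ w b) (x : ℝ) {t : ℝ}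
    (ht : t ∈ Icc 0 T) :
    HasDerivAt (fun y => pdx u y t) (pdx (pdx u) x t) x :=
  (h.diff_xx x t ht).1.hasDerivAt

lemma hasDerivAt_θx (h : IsClassicalSolution α β T v u θ w b) (x : ℝ) {t : ℝ}
    (ht : t ∈ Icc 0 T) :
    HasDerivAt (fun y => pdx θ y t) (pdx (pdx θ) x t) x :=
  (h.diff_xx x t ht).2.1.hasDerivAt

lemma hasDerivAt_mom (h : IsClassicalSolution α β T v u θ w b) (x : ℝ) {t : ℝ}
    (ht : t ∈ Icc 0 T) :
    HasDerivAt (fun y => visc α (v y t) * pdx u y t / v y t)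
    (pdt T u x t + (pdx θ x t / v x t - θ x t * pdx v x t / v x t ^ 2
      + (b x t).1 * (pdx b x t).1 + (b x t).2 * (pdx b x t).2)) x := by
  have hv := h.v_pos x t ht
  have h1 : DifferentiableAt ℝ (fun y => visc α (v y t) * pdx u y t / v y t) x :=
    ((((h.diff_x x t ht).1.rpow_const (Or.inl hv.ne')).const_mul α |>.const_add 1).mul
      (h.diff_xx x t ht).1).div (h.diff_x x t ht).1 hv.ne'
  have h2 : HasDerivAt (fun y => θ y t / v y t + sq2 (b y t) / 2)
      (pdx θ x t / v x t - θ x t * pdx v x t / v x t ^ 2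
        + (b x t).1 * (pdx b x t).1 + (b x t).2 * (pdx b x t).2) x := by
    have hb := h.hasDerivAt_b x ht
    refine (((h.hasDerivAt_θ x ht).div (h.hasDerivAt_v x ht) hv.ne').add
      (((hb.fst_prod.fun_pow 2).add (hb.snd_prod.fun_pow 2)).div_const 2)).congr_deriv ?_
    norm_num
    field_simp
    ring
  refine h1.hasDerivAt.congr_deriv ?_
  rw [← h2.deriv]
  exact (h.eq_mom x t ht).symm

lemma hasDerivAt_wx (h : IsClassicalSolution α β T v u θ w b) (x : ℝ) {t : ℝ}
    (ht : t ∈ Icc 0 T) :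
    HasDerivAt (fun y => (v y t)⁻¹ • pdx w y t)
    (pdt T w x t - pdx b x t) x := by
  rw [h.eq_w x t ht]
  exact (((h.diff_x x t ht).1.inv (h.v_pos x t ht).ne').smul
    (h.diff_xx x t ht).2.2.1).hasDerivAt

lemma hasDerivAt_bx (h : IsClassicalSolution α β T v u θ w b) (x : ℝ) {t : ℝ}
    (ht : t ∈ Icc 0 T) (hT : 0 < T) :
    HasDerivAt (fun y => (v y t)⁻¹ • pdx b y t)
    (v x t • pdt T b x t + pdx u x t • b x t - pdx w x t) x := by
  have h1 : pdt T (fun y s => v y s • b y s) x t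
      = v x t • pdt T b x t + pdx u x t • b x t := by
    have := ((h.diff_t x t ht).1.hasDerivWithinAt.fun_smul
      (h.diff_t x t ht).2.2.2.2.hasDerivWithinAt).derivWithin (uniqueDiffOn_Icc hT t ht)
    rw [← h.eq_mass x t ht]
    exact this
  rw [← h1, h.eq_b x t ht]
  exact (((h.diff_x x t ht).1.inv (h.v_pos x t ht).ne').smul
    (h.diff_xx x t ht).2.2.2).hasDerivAt

lemma hasDerivAt_temp (h : IsClassicalSolution α β T v u θ w b) (x : ℝ) {t : ℝ}
    (ht : t ∈ Icc 0 T) :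
    HasDerivAt (fun y => θ y t ^ β * pdx θ y t / v y t)
    (pdt T θ x t + θ x t / v x t * pdx u x t
      - (visc α (v x t) * pdx u x t ^ 2 + sq2 (pdx w x t) + sq2 (pdx b x t)) / v x t) x := by
  have h1 : DifferentiableAt ℝ (fun y => θ y t ^ β * pdx θ y t / v y t) x :=
    (((h.diff_x x t ht).2.2.1.rpow_const (Or.inl (h.θ_pos x t ht).ne')).mul
      (h.diff_xx x t ht).2.1).div (h.diff_x x t ht).1 (h.v_pos x t ht).ne'
  refine h1.hasDerivAt.congr_deriv ?_
  have := h.eq_temp x t ht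
  rw [this]
  unfold pdx
  ring

/-- A classical solution, written in components and extended in time by its end values. -/
def toFlow (h : IsClassicalSolution α β T v u θ w b) (hT : 0 < T) : MHDFlow α β T where
  v x t := v x (clampTime T t)
  u x t := u x (clampTime T t)
  θ x t := θ x (clampTime T t)
  w₁ x t := (w x (clampTime T t)).1
  w₂ x t := (w x (clampTime T t)).2
  b₁ x t := (b x (clampTime T t)).1
  b₂ x t := (b x (clampTime T t)).2
  vx x t := pdx v x (clampTime T t)
  ux x t := pdx u x (clampTime T t)
  θx x t := pdx θ x (clampTime T t)
  w₁x x t := (pdx w x (clampTime T t)).1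
  w₂x x t := (pdx w x (clampTime T t)).2
  b₁x x t := (pdx b x (clampTime T t)).1
  b₂x x t := (pdx b x (clampTime T t)).2
  uxx x t := pdx (pdx u) x (clampTime T t)
  θxx x t := pdx (pdx θ) x (clampTime T t)
  ut x t := pdt T u x (clampTime T t)
  θt x t := pdt T θ x (clampTime T t)
  w₁t x t := (pdt T w x (clampTime T t)).1
  w₂t x t := (pdt T w x (clampTime T t)).2
  b₁t x t := (pdt T b x (clampTime T t)).1
  b₂t x t := (pdt T b x (clampTime T t)).2
  cv := continuous_comp_clampTime (f := v) hT h.cont.fst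
  cu := continuous_comp_clampTime (f := u) hT h.cont.snd.fst
  cθ := continuous_comp_clampTime (f := θ) hT h.cont.snd.snd.fst
  cw₁ := continuous_comp_clampTime (f := fun x t => (w x t).1) hT h.cont.snd.snd.snd.fst.fst
  cw₂ := continuous_comp_clampTime (f := fun x t => (w x t).2) hT h.cont.snd.snd.snd.fst.snd
  cb₁ := continuous_comp_clampTime (f := fun x t => (b x t).1) hT h.cont.snd.snd.snd.snd.fst
  cb₂ := continuous_comp_clampTime (f := fun x t => (b x t).2) hT h.cont.snd.snd.snd.snd.snd
  cvx := continuous_comp_clampTime (f := pdx v) hT h.cont_dx.fst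
  cux := continuous_comp_clampTime (f := pdx u) hT h.cont_dx.snd.fst
  cθx := continuous_comp_clampTime (f := pdx θ) hT h.cont_dx.snd.snd.fst
  cw₁x := continuous_comp_clampTime (f := fun x t => (pdx w x t).1) hT
    h.cont_dx.snd.snd.snd.fst.fst
  cw₂x := continuous_comp_clampTime (f := fun x t => (pdx w x t).2) hT
    h.cont_dx.snd.snd.snd.fst.snd
  cb₁x := continuous_comp_clampTime (f := fun x t => (pdx b x t).1) hT
    h.cont_dx.snd.snd.snd.snd.fst
  cb₂x := continuous_comp_clampTime (f := fun x t => (pdx b x t).2) hT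
    h.cont_dx.snd.snd.snd.snd.snd
  cuxx := continuous_comp_clampTime (f := pdx (pdx u)) hT h.cont_dxx.fst
  cθxx := continuous_comp_clampTime (f := pdx (pdx θ)) hT h.cont_dxx.snd.fst
  cut := continuous_comp_clampTime (f := pdt T u) hT h.cont_dt.snd.fst
  cθt := continuous_comp_clampTime (f := pdt T θ) hT h.cont_dt.snd.snd.fst
  cw₁t := continuous_comp_clampTime (f := fun x t => (pdt T w x t).1) hT
    h.cont_dt.snd.snd.snd.fst.fst
  cw₂t := continuous_comp_clampTime (f := fun x t => (pdt T w x t).2) hT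
    h.cont_dt.snd.snd.snd.fst.snd
  cb₁t := continuous_comp_clampTime (f := fun x t => (pdt T b x t).1) hT
    h.cont_dt.snd.snd.snd.snd.fst
  cb₂t := continuous_comp_clampTime (f := fun x t => (pdt T b x t).2) hT
    h.cont_dt.snd.snd.snd.snd.snd
  v_pos x t := h.v_pos x _ (clampTime_mem hT t)
  θ_pos x t := h.θ_pos x _ (clampTime_mem hT t)
  dvx x t := h.hasDerivAt_v x (clampTime_mem hT t)
  dux x t := h.hasDerivAt_u x (clampTime_mem hT t)
  dθx x t := h.hasDerivAt_θ x (clampTime_mem hT t)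
  dw₁x x t := (h.hasDerivAt_w x (clampTime_mem hT t)).fst_prod
  dw₂x x t := (h.hasDerivAt_w x (clampTime_mem hT t)).snd_prod
  db₁x x t := (h.hasDerivAt_b x (clampTime_mem hT t)).fst_prod
  db₂x x t := (h.hasDerivAt_b x (clampTime_mem hT t)).snd_prod
  duxx x t := h.hasDerivAt_ux x (clampTime_mem hT t)
  dθxx x t := h.hasDerivAt_θx x (clampTime_mem hT t)
  dvt x t ht := by
    rw [clampTime_of_mem ht, ← h.eq_mass x t ht]
    exact hasDerivWithinAt_comp_clampTime ht (h.diff_t x t ht).1.hasDerivWithinAt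
  dut x t ht := by
    rw [clampTime_of_mem ht]
    exact hasDerivWithinAt_comp_clampTime ht (h.diff_t x t ht).2.1.hasDerivWithinAt
  dθt x t ht := by
    rw [clampTime_of_mem ht]
    exact hasDerivWithinAt_comp_clampTime ht (h.diff_t x t ht).2.2.1.hasDerivWithinAt
  dw₁t x t ht := by
    rw [clampTime_of_mem ht]
    exact hasDerivWithinAt_comp_clampTime (f := fun s => (w x s).1) ht
      (h.diff_t x t ht).2.2.2.1.hasDerivWithinAt.fst_prod
  dw₂t x t ht := by
    rw [clampTime_of_mem ht]
    exact hasDerivWithinAt_comp_clampTime (f := fun s => (w x s).2) ht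
      (h.diff_t x t ht).2.2.2.1.hasDerivWithinAt.snd_prod
  db₁t x t ht := by
    rw [clampTime_of_mem ht]
    exact hasDerivWithinAt_comp_clampTime (f := fun s => (b x s).1) ht
      (h.diff_t x t ht).2.2.2.2.hasDerivWithinAt.fst_prod
  db₂t x t ht := by
    rw [clampTime_of_mem ht]
    exact hasDerivWithinAt_comp_clampTime (f := fun s => (b x s).2) ht
      (h.diff_t x t ht).2.2.2.2.hasDerivWithinAt.snd_prod
  mom x t := h.hasDerivAt_mom x (clampTime_mem hT t)
  w₁eq x t := by
    simpa [div_eq_inv_mul] using (h.hasDerivAt_wx x (clampTime_mem hT t)).fst_prod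
  w₂eq x t := by
    simpa [div_eq_inv_mul] using (h.hasDerivAt_wx x (clampTime_mem hT t)).snd_prod
  b₁eq x t := by
    simpa [div_eq_inv_mul, add_comm] using (h.hasDerivAt_bx x (clampTime_mem hT t) hT).fst_prod
  b₂eq x t := by
    simpa [div_eq_inv_mul, add_comm] using (h.hasDerivAt_bx x (clampTime_mem hT t) hT).snd_prod
  temp x t := by
    refine (h.hasDerivAt_temp x (clampTime_mem hT t)).congr_deriv ?_
    unfold sq2
    ring
  far ε hε := by
    obtain ⟨M, hM⟩ := h.farfield ε hε
    refine ⟨M, fun x t hx => ?_⟩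
    obtain ⟨h1, h2, h3, h4, h5⟩ := hM x _ (clampTime_mem hT t) hx
    have h6 := abs_lt_of_sqrt_sq2_lt h4
    have h7 := abs_lt_of_sqrt_sq2_lt h5
    exact ⟨h1, h2, h3, h7.1, h7.2, h6.1, h6.2⟩
  clamp x t := by
    refine ⟨clampTime T t, clampTime_mem hT t, ?_⟩
    simp only [clampTime_of_mem (clampTime_mem hT t), and_self]

lemma initBound_toFlow (h : IsClassicalSolution α β T v u θ w b) (hT : 0 < T) {K δ : ℝ}
    (hA : Admissible K δ v u θ w b) : (h.toFlow hT).InitBound K δ := by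
  have h0 : (0 : ℝ) ∈ Icc 0 T := ⟨le_rfl, hT.le⟩
  obtain ⟨hK, hv, hθ⟩ := hA
  refine ⟨fun a c hac => ?_, fun x => ?_, fun x => ?_⟩
  · obtain ⟨i1, i2, i3, i4, i5, i6, i7, i8, i9, i10⟩ := h.sq_int 0 h0
    have hint := ((((((((i1.add i2).add i3).add i4).add i5).add i6).add i7).add i8).add i9).add i10
    refine le_trans ?_ hK
    rw [intervalIntegral.integral_of_le hac]
    refine le_trans ?_ (setIntegral_le_integral (s := Ioc a c) hint (ae_of_all _ fun x => ?_))
    · refine setIntegral_mono_on ?_ hint.integrableOn measurableSet_Ioc fun x _ => ?_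
      · exact ((Continuous.integrableOn_Icc (by fun_prop)).mono_set Ioc_subset_Icc_self)
      · simp only [MHDFlow.initDensity, toFlow, clampTime_of_mem h0, sq2]
        have := sq_nonneg (pdx u x 0)
        have := sq_nonneg (pdx θ x 0)
        have := sq_nonneg (pdx b x 0).1
        have := sq_nonneg (pdx b x 0).2
        have := sq_nonneg (pdx w x 0).1
        have := sq_nonneg (pdx w x 0).2
        linarith
    · simp only [Pi.zero_apply, sq2]
      positivity
  · simpa only [toFlow, clampTime_of_mem h0] using hv x
  · simpa only [toFlow, clampTime_of_mem h0] using hθ x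

end IsClassicalSolution

/-- Lemma 2.5 of the paper: uniform-in-time bound for `∫ v_x²`. -/
theorem vx_L2_bound (α β T K δ : ℝ) (hα : 0 ≤ α) (hβ : 0 < β) (hT : 0 < T)
    (hK : 0 < K) (hδ₀ : 0 < δ) (hδ₁ : δ ≤ 1) :
    ∃ C : ℝ, 0 < C ∧
      ∀ (v u θ : ℝ → ℝ → ℝ) (w b : ℝ → ℝ → ℝ × ℝ),
        IsClassicalSolution α β T v u θ w b → Admissible K δ v u θ w b →
        ∀ t ∈ Icc (0:ℝ) T, (∫ x : ℝ, (pdx v x t) ^ 2) ≤ C := by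
  obtain ⟨C, hC, hbound⟩ := MHDFlow.exists_vx_bound (α := α) (β := β) hα hβ hT.le hK hδ₀ hδ₁
  refine ⟨C, hC, fun v u θ w b h hA t ht => ?_⟩
  have hint := (h.sq_int t ht).2.2.2.2.2.1
  have hlim := intervalIntegral_tendsto_integral hint tendsto_neg_atTop_atBot tendsto_id
  refine le_of_tendsto hlim ?_
  filter_upwards [eventually_gt_atTop 0] with R hR
  have := hbound (h.toFlow hT) (h.initBound_toFlow hT hA) t ht R hR
  simpa only [IsClassicalSolution.toFlow, clampTime_of_mem ht, id] using this
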